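/- Let G=(X,Y;E) be a bipartite graph with |X|=m and |Y|=n. Suppose that n ≥ m ≥ 2k+2 for some natural number k. If e(G) ≥ n(m−k−1)+k+2, then G contains cycles of all even lengths from 4 up to 2m−2k, i.e. for every integer ℓ with 2 ≤ ℓ ≤ m−k, G contains a cycle of length 2ℓ. -/

import Mathlib

open Finset

/-- `l` is the vertex list of a path of `G` from `a` to `b`. -/
structure PathList {V : Type} (G : SimpleGraph V) (l : List V) (a b : V) : Prop where
  chain : l.IsChain G.Adj
  nodup : l.Nodup
  head : l.head? = some a
  last : l.getLast? = some b

/-- `l` is the vertex list of a path of `G` whose last vertex is adjacent to its first one. -/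
def ClosedList {V : Type} (G : SimpleGraph V) (l : List V) : Prop :=
  ∃ a b, PathList G l a b ∧ G.Adj b a

section Lists

variable {V : Type} {G : SimpleGraph V}

namespace PathList

theorem ne_nil {l : List V} {a b : V} (h : PathList G l a b) : l ≠ [] := by
  rintro rfl; simpa using h.head

theorem head_mem {l : List V} {a b : V} (h : PathList G l a b) : a ∈ l :=
  List.mem_of_mem_head? (by simp [h.head])

theorem last_mem {l : List V} {a b : V} (h : PathList G l a b) : b ∈ l :=
  List.mem_of_mem_getLast? (by simp [h.last])

theorem singleton (a : V) : PathList G [a] a a := ⟨by simp, by simp, by simp, by simp⟩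

theorem length_pos {l : List V} {a b : V} (h : PathList G l a b) : 1 ≤ l.length :=
  List.length_pos_iff.2 h.ne_nil

theorem append {l₁ l₂ : List V} {a b c d : V} (h₁ : PathList G l₁ a b) (h₂ : PathList G l₂ c d)
    (hbc : G.Adj b c) (hd : ∀ x ∈ l₁, x ∉ l₂) : PathList G (l₁ ++ l₂) a d := by
  refine ⟨?_, ?_, ?_, ?_⟩
  · rw [List.isChain_append]
    refine ⟨h₁.chain, h₂.chain, ?_⟩
    rw [h₁.last, h₂.head]
    simpa using hbc
  · rw [List.nodup_append]
    refine ⟨h₁.nodup, h₂.nodup, ?_⟩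
    rintro x hx y hy rfl
    exact hd x hx hy
  · simp [List.head?_append, h₁.head]
  · simp [List.getLast?_append, h₂.last]

theorem cons {l : List V} {a b c : V} (h : PathList G l a b) (hc : G.Adj c a) (hl : c ∉ l) :
    PathList G (c :: l) c b := by
  have := (singleton (G := G) c).append h hc (by simpa using hl)
  simpa using this

theorem concat {l : List V} {a b c : V} (h : PathList G l a b) (hc : G.Adj b c) (hl : c ∉ l) :
    PathList G (l ++ [c]) a c :=
  h.append (singleton c) hc (by intro x hx; simp; rintro rfl; exact hl hx)

theorem reverse {l : List V} {a b : V} (h : PathList G l a b) : PathList G l.reverse b a := by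
  refine ⟨?_, List.nodup_reverse.2 h.nodup, by simp [h.last], by simp [h.head]⟩
  rw [List.isChain_reverse]
  simpa [G.adj_comm] using h.chain

theorem cases {l : List V} {a b : V} (h : PathList G l a b) :
    (l = [a] ∧ a = b) ∨ ∃ l' c, l = a :: l' ∧ G.Adj a c ∧ a ∉ l' ∧ PathList G l' c b := by
  obtain ⟨hc, hn, hh, hl⟩ := h
  match l with
  | [] => simp at hh
  | [x] => simp at hh hl; left; subst hh; simp [hl]
  | x :: y :: l' =>
    right
    simp at hh
    subst hh
    rw [List.isChain_cons_cons] at hc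
    rw [List.nodup_cons] at hn
    exact ⟨y :: l', y, rfl, hc.1, hn.1, hc.2, hn.2, by simp, by simpa using hl⟩

theorem split {l : List V} {a b x : V} (h : PathList G l a b) (hx : x ∈ l) :
    ∃ l₁ l₂, l = l₁ ++ l₂ ∧ PathList G (l₁ ++ [x]) a x ∧ PathList G l₂ x b := by
  obtain ⟨s, t, rfl⟩ := List.append_of_mem hx
  obtain ⟨hc, hn, hh, hl⟩ := h
  refine ⟨s, x :: t, rfl, ⟨?_, ?_, ?_, by simp⟩, ?_, ?_, by simp, ?_⟩
  · have : s ++ x :: t = (s ++ [x]) ++ t := by simp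
    rw [this] at hc
    exact (List.isChain_append.1 hc).1
  · have : s ++ x :: t = (s ++ [x]) ++ t := by simp
    rw [this] at hn
    exact (List.nodup_append.1 hn).1
  · cases s <;> simpa using hh
  · exact (List.isChain_append.1 hc).2.1
  · exact (List.nodup_append.1 hn).2.1
  · simpa [List.getLast?_append] using hl

theorem mono {H : SimpleGraph V} {l : List V} {a b : V} (h : PathList G l a b)
    (hGH : ∀ u v, G.Adj u v → H.Adj u v) : PathList H l a b :=
  ⟨h.chain.imp hGH, h.nodup, h.head, h.last⟩

/-- The first place where a path meets a set. -/
theorem first_hit {l : List V} {a b : V} (h : PathList G l a b) (S : Set V) (hb : b ∈ S) :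
    ∃ l' x, PathList G l' a x ∧ x ∈ S ∧ (∀ y ∈ l', y ∈ l) ∧ ∀ y ∈ l', y ≠ x → y ∉ S := by
  induction l generalizing a with
  | nil => exact absurd rfl h.ne_nil
  | cons c l ih =>
    by_cases ha : a ∈ S
    · refine ⟨[a], a, singleton a, ha, ?_, by simp⟩
      simpa using h.head_mem
    rcases h.cases with ⟨_, rfl⟩ | ⟨l', d, heq, had, hal, hp⟩
    · exact absurd hb ha
    · obtain ⟨rfl, rfl⟩ := List.cons.inj heq
      obtain ⟨l', x, h1, h2, h3, h4⟩ := ih hp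
      refine ⟨c :: l', x, h1.cons had (fun hh => hal (h3 _ hh)), h2, ?_, ?_⟩
      · intro y hy
        rcases List.mem_cons.1 hy with rfl | hy
        · simp
        · exact List.mem_cons_of_mem _ (h3 y hy)
      · intro y hy hyx
        rcases List.mem_cons.1 hy with rfl | hy
        · exact ha
        · exact h4 y hy hyx

/-- A walk contains a path with the same ends. -/
theorem of_chain (l : List V) (a b : V) (hc : l.IsChain G.Adj) (hh : l.head? = some a)
    (hl : l.getLast? = some b) : ∃ l', PathList G l' a b ∧ ∀ x ∈ l', x ∈ l := by
  induction l generalizing a with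
  | nil => simp at hh
  | cons c l ih =>
    obtain rfl : c = a := by simpa using hh
    match l with
    | [] =>
      obtain rfl : c = b := by simpa using hl
      exact ⟨[c], singleton c, by simp⟩
    | d :: l =>
      rw [List.isChain_cons_cons] at hc
      obtain ⟨l', hp, hs⟩ := ih d hc.2 (by simp) (by simpa using hl)
      by_cases hcl : c ∈ l'
      · obtain ⟨l₁, l₂, rfl, -, h2⟩ := hp.split hcl
        exact ⟨l₂, h2, fun x hx => List.mem_cons_of_mem _ (hs x (by simp [hx]))⟩
      · refine ⟨c :: l', hp.cons hc.1 hcl, ?_⟩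
        intro x hx
        rcases List.mem_cons.1 hx with rfl | hx
        · simp
        · exact List.mem_cons_of_mem _ (hs x hx)

end PathList

namespace ClosedList

theorem mono {H : SimpleGraph V} {l : List V} (h : ClosedList G l)
    (hGH : ∀ u v, G.Adj u v → H.Adj u v) : ClosedList H l := by
  obtain ⟨a, b, h1, h2⟩ := h
  exact ⟨a, b, h1.mono hGH, hGH _ _ h2⟩

theorem nodup {l : List V} (h : ClosedList G l) : l.Nodup := by
  obtain ⟨a, b, h1, h2⟩ := h
  exact h1.nodup

/-- Open a closed path at a given vertex. -/
theorem open_at {l : List V} {x : V} (h : ClosedList G l) (hx : x ∈ l) :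
    ∃ l' y, PathList G l' x y ∧ G.Adj y x ∧ l.Perm l' := by
  obtain ⟨a, b, h1, h2⟩ := h
  obtain ⟨l₁, l₂, rfl, h3, h4⟩ := h1.split hx
  rcases List.eq_nil_or_concat l₁ with rfl | ⟨L, y, rfl⟩
  · have : a = x := by simpa using h3.head.symm
    subst this
    exact ⟨l₂, b, h4, h2, by simp⟩
  · rw [List.concat_eq_append] at *
    have h5 : PathList G (L ++ [y]) a y := by
      refine ⟨?_, ?_, ?_, by simp⟩
      · exact (List.isChain_append.1 h1.chain).1
      · exact (List.nodup_append.1 h1.nodup).1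
      · have := h3.head
        cases L <;> simpa using this
    have hd := List.nodup_append.1 h1.nodup
    refine ⟨l₂ ++ (L ++ [y]), y, h4.append h5 h2 ?_, ?_, List.perm_append_comm⟩
    · intro z hz hz'
      exact hd.2.2 z hz' z hz rfl
    · have := List.isChain_append.1 h3.chain
      exact this.2.2 y (by simp) x (by simp)

theorem exists_cycle {l : List V} (h : ClosedList G l) (hl : 3 ≤ l.length) :
    ∃ (v : V) (w : G.Walk v v), w.IsCycle ∧ w.length = l.length := by
  obtain ⟨a, b, h1, h2⟩ := h
  have key : ∀ (l : List V) (a b : V), PathList G l a b → ∃ w : G.Walk a b, w.support = l := by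
    intro l
    induction l with
    | nil => intro a b h; exact absurd rfl h.ne_nil
    | cons c l ih =>
      intro a b h
      rcases h.cases with ⟨heq, rfl⟩ | ⟨l', d, heq, had, hal, hp⟩
      · exact ⟨SimpleGraph.Walk.nil, by simp [heq]⟩
      · obtain ⟨rfl, rfl⟩ := List.cons.inj heq
        obtain ⟨w, hw⟩ := ih d b hp
        exact ⟨SimpleGraph.Walk.cons had w, by simp [hw]⟩
  obtain ⟨w, hw⟩ := key l a b h1
  have hlen : w.length + 1 = l.length := by rw [← hw, w.length_support]
  refine ⟨b, SimpleGraph.Walk.cons h2 w, ?_, by simpa using hlen⟩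
  rw [SimpleGraph.Walk.isCycle_iff_isPath_tail_and_le_length]
  refine ⟨?_, by simp; omega⟩
  rw [SimpleGraph.Walk.isPath_def]
  simp [hw, h1.nodup]

end ClosedList

end Lists

section Segments

variable {V : Type} {G : SimpleGraph V}

/-- The list `v i, v (i + 1), …, v j`. -/
def seg {V : Type} (v : ℕ → V) (i j : ℕ) : List V := (List.range' i (j + 1 - i)).map v

/-- `v 0, v 1, …, v k` is a path of `G`. -/
structure PathFun {V : Type} (G : SimpleGraph V) (v : ℕ → V) (k : ℕ) : Prop where
  inj : ∀ i j, i ≤ k → j ≤ k → v i = v j → i = j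
  adj : ∀ i, i < k → G.Adj (v i) (v (i + 1))

theorem mem_seg {v : ℕ → V} {i j : ℕ} {x : V} : x ∈ seg v i j ↔ ∃ p, i ≤ p ∧ p ≤ j ∧ v p = x := by
  simp only [seg, List.mem_map, List.mem_range'_1]
  constructor
  · rintro ⟨p, hp, rfl⟩; exact ⟨p, by omega, by omega, rfl⟩
  · rintro ⟨p, h1, h2, rfl⟩; exact ⟨p, by omega, rfl⟩

@[simp] theorem length_seg (v : ℕ → V) (i j : ℕ) : (seg v i j).length = j + 1 - i := by simp [seg]

theorem seg_eq_nil {v : ℕ → V} {i j : ℕ} (h : j < i) : seg v i j = [] := by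
  have : j + 1 - i = 0 := by omega
  simp [seg, this]

theorem seg_self (v : ℕ → V) (i : ℕ) : seg v i i = [v i] := by simp [seg]

theorem seg_succ {v : ℕ → V} {i j : ℕ} (h : i ≤ j + 1) :
    seg v i (j + 1) = seg v i j ++ [v (j + 1)] := by
  have h1 : j + 1 + 1 - i = (j + 1 - i) + 1 := by omega
  have h2 : i + (j + 1 - i) = j + 1 := by omega
  simp [seg, h1, List.range'_1_concat, h2]

namespace PathFun

theorem seg {v : ℕ → V} {k : ℕ} (h : PathFun G v k) {i j : ℕ} (hij : i ≤ j) (hj : j ≤ k) :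
    PathList G (seg v i j) (v i) (v j) := by
  induction j, hij using Nat.le_induction with
  | base => rw [seg_self]; exact PathList.singleton _
  | succ j hij ih =>
    rw [seg_succ (by omega)]
    refine (ih (by omega)).concat (h.adj j (by omega)) ?_
    rw [mem_seg]
    rintro ⟨p, h1, h2, h3⟩
    have := h.inj _ _ (by omega) (by omega) h3
    omega

theorem extend {v : ℕ → V} {k : ℕ} (h : PathFun G v k) {M : List V} {a : V} {l u : ℕ}
    (hM : PathList G M a (v l)) (hlu : l ≤ u) (hu : u ≤ k)
    (hd : ∀ p, l < p → p ≤ u → v p ∉ M) : PathList G (M ++ _root_.seg v (l + 1) u) a (v u) := by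
  rcases hlu.eq_or_lt with rfl | hlu
  · rw [seg_eq_nil (by omega)]; simpa using hM
  · refine hM.append (h.seg (by omega) hu) (h.adj l (by omega)) ?_
    intro x hx hx'
    obtain ⟨p, h1, h2, rfl⟩ := mem_seg.1 hx'
    exact hd p (by omega) h2 hx

/-- Append to a path ending in `v l` the vertices `v (l - 1), …, v u`. -/
theorem extend_down {v : ℕ → V} {k : ℕ} (h : PathFun G v k) {M : List V} {a : V} {l u : ℕ}
    (hM : PathList G M a (v l)) (hlu : u ≤ l) (hl : l ≤ k)
    (hd : ∀ p, u ≤ p → p < l → v p ∉ M) :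
    ∃ L, PathList G L a (v u) ∧ (∀ x, x ∈ L ↔ x ∈ M ∨ ∃ p, u ≤ p ∧ p < l ∧ v p = x) ∧
      L.length = M.length + (l - u) := by
  rcases hlu.eq_or_lt with rfl | hlu
  · refine ⟨M, hM, fun x => ⟨Or.inl, ?_⟩, by simp⟩
    rintro (hx | ⟨p, h1, h2, -⟩)
    · exact hx
    · omega
  · refine ⟨M ++ (_root_.seg v u (l - 1)).reverse,
      hM.append (h.seg (by omega) (by omega)).reverse ?_ ?_, ?_, ?_⟩
    · have := h.adj (l - 1) (by omega)
      rw [show l - 1 + 1 = l by omega] at this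
      exact this.symm
    · intro x hx hx'
      obtain ⟨p, h1, h2, rfl⟩ := mem_seg.1 (List.mem_reverse.1 hx')
      exact hd p (by omega) (by omega) hx
    · intro x
      rw [List.mem_append, List.mem_reverse, mem_seg]
      constructor
      · rintro (hx | ⟨p, h1, h2, h3⟩)
        · exact Or.inl hx
        · exact Or.inr ⟨p, h1, by omega, h3⟩
      · rintro (hx | ⟨p, h1, h2, h3⟩)
        · exact Or.inl hx
        · exact Or.inr ⟨p, h1, by omega, h3⟩
    · simp; omega

theorem flip {v : ℕ → V} {k : ℕ} (h : PathFun G v k) : PathFun G (fun i => v (k - i)) k := by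
  refine ⟨?_, ?_⟩
  · intro i j hi hj hij
    have := h.inj _ _ (by omega) (by omega) hij
    omega
  · intro i hi
    have := h.adj (k - (i + 1)) (by omega)
    rw [show k - (i + 1) + 1 = k - i by omega] at this
    exact this.symm

end PathFun

theorem PathList.exists_pathFun {l : List V} {a b : V} (h : PathList G l a b) :
    ∃ v k, PathFun G v k ∧ l = seg v 0 k ∧ v 0 = a ∧ v k = b := by
  have hpos := h.length_pos
  have hget : ∀ i, i < l.length → l[i]? = some (l.getD i a) := by
    intro i hi; simp [List.getD, hi]
  refine ⟨fun i => l.getD i a, l.length - 1, ⟨?_, ?_⟩, ?_, ?_, ?_⟩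
  · intro i j hi hj hij
    refine (List.nodup_iff_injective_getElem.1 h.nodup |>.eq_iff (a := ⟨i, by omega⟩)
      (b := ⟨j, by omega⟩)).1 ?_ |> Fin.mk.inj_iff.1
    have h1 := hget i (by omega)
    have h2 := hget j (by omega)
    simp only [List.getElem?_eq_getElem (show i < l.length by omega),
      List.getElem?_eq_getElem (show j < l.length by omega), Option.some.injEq] at h1 h2
    simp only [h1, h2]; exact hij
  · intro i hi
    have := List.isChain_iff_getElem.1 h.chain i (by omega)
    simpa [List.getD, show i < l.length by omega, show i + 1 < l.length by omega] using this
  · apply List.ext_getElem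
    · simp; omega
    · intro i h1 h2
      simp [seg, List.getD, h1]
  · have := h.head
    rw [List.head?_eq_getElem?, hget 0 (by omega)] at this
    simpa using this
  · have := h.last
    rw [List.getLast?_eq_getElem?, hget _ (by omega)] at this
    simpa using this

end Segments

section Bipartite

open scoped Classical

variable {V : Type} {G : SimpleGraph V} {A B : Finset V}

/-- Every edge of `G` joins a vertex of `A` to a vertex of `B`. -/
structure IsBip {V : Type} (G : SimpleGraph V) (A B : Finset V) : Prop where
  disj : Disjoint A B
  adj : ∀ u v, G.Adj u v → (u ∈ A ∧ v ∈ B) ∨ (u ∈ B ∧ v ∈ A)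

namespace IsBip

theorem symm (h : IsBip G A B) : IsBip G B A :=
  ⟨h.disj.symm, fun u v huv => (h.adj u v huv).symm⟩

theorem not_mem_right (h : IsBip G A B) {x : V} (hx : x ∈ A) : x ∉ B :=
  Finset.disjoint_left.1 h.disj hx

theorem not_mem_left (h : IsBip G A B) {x : V} (hx : x ∈ B) : x ∉ A :=
  Finset.disjoint_right.1 h.disj hx

theorem right_of_left (h : IsBip G A B) {x y : V} (hx : x ∈ A) (hxy : G.Adj x y) : y ∈ B := by
  rcases h.adj x y hxy with hh | hh
  · exact hh.2
  · exact absurd hh.1 (h.not_mem_right hx)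

theorem left_of_right (h : IsBip G A B) {x y : V} (hx : x ∈ B) (hxy : G.Adj x y) : y ∈ A :=
  h.symm.right_of_left hx hxy

end IsBip

/-- The number of elements of `A` in the list `l`. -/
noncomputable def cnt {V : Type} (A : Finset V) (l : List V) : ℕ := (A.filter (· ∈ l)).card

theorem cnt_cons_of_mem {a : V} {l : List V} (ha : a ∈ A) (hl : a ∉ l) :
    cnt A (a :: l) = cnt A l + 1 := by
  have : A.filter (· ∈ a :: l) = insert a (A.filter (· ∈ l)) := by
    ext x; simp only [Finset.mem_filter, List.mem_cons, Finset.mem_insert]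
    constructor
    · rintro ⟨h1, rfl | h2⟩
      · simp
      · exact Or.inr ⟨h1, h2⟩
    · rintro (rfl | ⟨h1, h2⟩)
      · exact ⟨ha, Or.inl rfl⟩
      · exact ⟨h1, Or.inr h2⟩
  rw [cnt, this, Finset.card_insert_of_notMem (by simp [hl]), cnt]

theorem cnt_cons_of_not_mem {a : V} {l : List V} (ha : a ∉ A) : cnt A (a :: l) = cnt A l := by
  unfold cnt; congr 1; ext x
  simp only [Finset.mem_filter, List.mem_cons]
  constructor
  · rintro ⟨h1, rfl | h2⟩
    · exact absurd h1 ha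
    · exact ⟨h1, h2⟩
  · rintro ⟨h1, h2⟩; exact ⟨h1, Or.inr h2⟩

theorem cnt_nil : cnt A ([] : List V) = 0 := by simp [cnt]

theorem le_cnt {F : Finset V} {l : List V} (hF : F ⊆ A) (hl : ∀ x ∈ F, x ∈ l) : F.card ≤ cnt A l :=
  Finset.card_le_card fun x hx => Finset.mem_filter.2 ⟨hF hx, hl x hx⟩

theorem cnt_le {l : List V} : cnt A l ≤ A.card := Finset.card_filter_le _ _

theorem cnt_perm {l₁ l₂ : List V} (h : l₁.Perm l₂) : cnt A l₁ = cnt A l₂ := by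
  unfold cnt; congr 1; ext x; simp [h.mem_iff]

theorem PathList.length_eq (hG : IsBip G A B) {l : List V} {a b : V} (h : PathList G l a b) :
    (a ∈ A → b ∈ A → l.length + 1 = 2 * cnt A l ∧ l.length = 2 * cnt B l + 1) ∧
    (a ∈ A → b ∈ B → l.length = 2 * cnt A l ∧ l.length = 2 * cnt B l) ∧
    (a ∈ B → b ∈ A → l.length = 2 * cnt A l ∧ l.length = 2 * cnt B l) ∧
    (a ∈ B → b ∈ B → l.length = 2 * cnt A l + 1 ∧ l.length + 1 = 2 * cnt B l) := by
  induction l generalizing a with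
  | nil => exact absurd rfl h.ne_nil
  | cons c l ih =>
    rcases h.cases with ⟨heq, rfl⟩ | ⟨l', d, heq, had, hal, hp⟩
    · rw [heq]
      refine ⟨fun h1 _ => ?_, fun h1 h2 => ?_, fun h1 h2 => ?_, fun h1 _ => ?_⟩
      · rw [cnt_cons_of_mem h1 (by simp), cnt_cons_of_not_mem (hG.not_mem_right h1)]; simp [cnt_nil]
      · exact absurd h2 (hG.not_mem_right h1)
      · exact absurd h1 (hG.not_mem_right h2)
      · rw [cnt_cons_of_mem h1 (by simp), cnt_cons_of_not_mem (hG.not_mem_left h1)]; simp [cnt_nil]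
    · obtain ⟨rfl, rfl⟩ := List.cons.inj heq
      obtain ⟨i1, i2, i3, i4⟩ := ih hp
      rw [List.length_cons]
      refine ⟨fun h1 h2 => ?_, fun h1 h2 => ?_, fun h1 h2 => ?_, fun h1 h2 => ?_⟩
      · have := i3 (hG.right_of_left h1 had) h2
        rw [cnt_cons_of_mem h1 hal, cnt_cons_of_not_mem (hG.not_mem_right h1)]; omega
      · have := i4 (hG.right_of_left h1 had) h2
        rw [cnt_cons_of_mem h1 hal, cnt_cons_of_not_mem (hG.not_mem_right h1)]; omega
      · have := i1 (hG.left_of_right h1 had) h2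
        rw [cnt_cons_of_mem h1 hal, cnt_cons_of_not_mem (hG.not_mem_left h1)]; omega
      · have := i2 (hG.left_of_right h1 had) h2
        rw [cnt_cons_of_mem h1 hal, cnt_cons_of_not_mem (hG.not_mem_left h1)]; omega

theorem ClosedList.length_eq (hG : IsBip G A B) {l : List V} (h : ClosedList G l) :
    l.length = 2 * cnt A l ∧ l.length = 2 * cnt B l := by
  obtain ⟨a, b, h1, h2⟩ := h
  obtain ⟨-, i2, i3, -⟩ := h1.length_eq hG
  rcases hG.adj _ _ h2 with ⟨h3, h4⟩ | ⟨h3, h4⟩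
  · exact i3 h4 h3
  · exact i2 h4 h3

theorem ClosedList.le_length (hG : IsBip G A B) {l : List V} (h : ClosedList G l) {F : Finset V}
    (hF : F ⊆ A) (hl : ∀ x ∈ F, x ∈ l) : 2 * F.card ≤ l.length := by
  rw [(h.length_eq hG).1]
  exact Nat.mul_le_mul_left _ (le_cnt hF hl)

/-- The number of neighbours of `v` in `B`. -/
noncomputable def dg {V : Type} (G : SimpleGraph V) (B : Finset V) (v : V) : ℕ :=
  (B.filter (G.Adj v)).card

end Bipartite

section Links

variable {V : Type} {G : SimpleGraph V}

/-- `x` and `y` are joined by a walk all of whose inner vertices lie outside `P`. -/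
def Link {V : Type} (G : SimpleGraph V) (P : Set V) (x y : V) : Prop :=
  ∃ S : List V, (x :: (S ++ [y])).IsChain G.Adj ∧ ∀ s ∈ S, s ∉ P

namespace Link

variable {P : Set V}

theorem of_adj {x y : V} (h : G.Adj x y) : Link G P x y := ⟨[], by simpa using h, by simp⟩

theorem trans {x s y : V} (h : Link G P x s) (h' : Link G P s y) (hs : s ∉ P) : Link G P x y := by
  obtain ⟨S, h1, h2⟩ := h
  obtain ⟨T, h3, h4⟩ := h'
  refine ⟨S ++ s :: T, ?_, ?_⟩
  · have e : x :: (S ++ s :: T ++ [y]) = (x :: S) ++ s :: (T ++ [y]) := by simp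
    have e' : x :: (S ++ [s]) = (x :: S) ++ [s] := by simp
    rw [e', List.isChain_append] at h1
    rw [e, List.isChain_append]
    exact ⟨h1.1, h3, by simpa using h1.2.2⟩
  · intro t ht
    rcases List.mem_append.1 ht with ht | ht
    · exact h2 t ht
    · rcases List.mem_cons.1 ht with rfl | ht
      · exact hs
      · exact h4 t ht

theorem exists_path {x y : V} (h : Link G P x y) (hxy : x ≠ y) :
    ∃ S, PathList G (x :: (S ++ [y])) x y ∧ ∀ s ∈ S, s ∉ P := by
  obtain ⟨S, h1, h2⟩ := h
  obtain ⟨L, hL, hs⟩ := PathList.of_chain _ x y h1 (by simp) (by simp [List.getLast?_cons])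
  rcases hL.cases with ⟨_, rfl⟩ | ⟨L', c, rfl, _, hx, hL'⟩
  · exact absurd rfl hxy
  · rcases List.eq_nil_or_concat L' with rfl | ⟨T, z, rfl⟩
    · exact absurd rfl hL'.ne_nil
    · rw [List.concat_eq_append] at *
      have hz : z = y := by simpa using hL'.last
      subst hz
      refine ⟨T, hL, fun s hs' => ?_⟩
      have hn := List.nodup_append.1 hL'.nodup
      have := hs s (by simp [hs'])
      simp only [List.mem_cons, List.mem_append, List.not_mem_nil, or_false] at this
      rcases this with rfl | hh | rfl
      · exact absurd (List.mem_append_left _ hs') hx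
      · exact h2 s hh
      · exact absurd rfl (hn.2.2 s hs' s (by simp))

end Link

theorem PathList.link_of_mem {P : Set V} {S : List V} {x y s : V}
    (h : PathList G (x :: (S ++ [y])) x y) (hS : ∀ s ∈ S, s ∉ P) (hs : s ∈ S) :
    Link G P x s ∧ Link G P s y := by
  obtain ⟨S₁, S₂, rfl⟩ := List.append_of_mem hs
  have e : x :: (S₁ ++ s :: S₂ ++ [y]) = (x :: S₁) ++ s :: (S₂ ++ [y]) := by simp
  have hc := h.chain
  rw [e] at hc
  have h2 := List.isChain_append.1 hc
  refine ⟨⟨S₁, ?_, fun t ht => hS t (by simp [ht])⟩, ⟨S₂, h2.2.1, fun t ht => hS t (by simp [ht])⟩⟩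
  have e' : x :: (S₁ ++ [s]) = (x :: S₁) ++ [s] := by simp
  rw [e', List.isChain_append]
  exact ⟨h2.1, by simp, by simpa using h2.2.2⟩

theorem PathList.append_tail {M T : List V} {a x y : V} (hM : PathList G M a x)
    (hT : PathList G (x :: (T ++ [y])) x y) (hd : ∀ s ∈ T ++ [y], s ∉ M) :
    PathList G (M ++ (T ++ [y])) a y := by
  rcases hT.cases with ⟨h, _⟩ | ⟨L', c, heq, hxc, hx, hL'⟩
  · simp at h
  · obtain ⟨-, rfl⟩ := List.cons.inj heq
    exact hM.append hL' hxc fun z hz₁ hz₂ => hd z hz₂ hz₁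

/-- Deleting any single vertex does not disconnect the vertex set `U`. -/
def Conn2 {V : Type} (G : SimpleGraph V) (U : Finset V) : Prop :=
  ∀ (R : Set V) (v : V), R.Nonempty → (∀ x ∈ R, x ∈ U) → v ∉ R → (∃ z ∈ U, z ∉ R ∧ z ≠ v) →
    ∃ r ∈ R, ∃ b, b ∉ R ∧ b ≠ v ∧ G.Adj r b

/-- The vertices of the path `v 0, …, v k`. -/
def verts {V : Type} (v : ℕ → V) (k : ℕ) : Set V := {x | ∃ i, i ≤ k ∧ v i = x}

theorem mem_verts {v : ℕ → V} {k i : ℕ} (hi : i ≤ k) : v i ∈ verts v k := ⟨i, hi, rfl⟩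

theorem exists_jump {v : ℕ → V} {k : ℕ} (hv : PathFun G v k) {U : Finset V} (hc : Conn2 G U)
    (hU : ∀ x y, G.Adj x y → x ∈ U) {m : ℕ} (h0 : 0 < m) (hm : m < k) :
    ∃ u m₂, u < m ∧ m < m₂ ∧ m₂ ≤ k ∧ Link G (verts v k) (v u) (v m₂) ∧
      ∀ u' < m, ∀ m', m₂ < m' → m' ≤ k → ¬ Link G (verts v k) (v u') (v m') := by
  classical
  have hex : ∃ m₂, m < m₂ ∧ m₂ ≤ k ∧ ∃ u < m, Link G (verts v k) (v u) (v m₂) := by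
    let R : Set V := {x | (∃ i < m, v i = x) ∨ (x ∉ verts v k ∧ ∃ i < m, Link G (verts v k) (v i) x)}
    have hvU : ∀ i < k, v i ∈ U := fun i hi => hU _ _ (hv.adj i hi)
    have hkU : v k ∈ U := by
      have := hv.adj (k - 1) (by omega)
      rw [show k - 1 + 1 = k by omega] at this
      exact hU _ _ this.symm
    have hidx : ∀ i, i ≤ k → v i ∈ R → i < m := by
      rintro i hi (⟨j, hj, hij⟩ | ⟨h, -⟩)
      · have := hv.inj _ _ (by omega) hi hij
        omega
      · exact absurd (mem_verts hi) h
    have hRU : ∀ x ∈ R, x ∈ U := by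
      rintro x (⟨i, hi, rfl⟩ | ⟨-, i, hi, S, hS, -⟩)
      · exact hvU i (by omega)
      · have : ((v i :: S) ++ [x]).IsChain G.Adj := by simpa using hS
        have h3 := (List.isChain_append.1 this).2.2
        obtain ⟨y, hy⟩ : ∃ y, (v i :: S).getLast? = some y := by
          cases h : (v i :: S).getLast? with
          | none => simp at h
          | some y => exact ⟨y, rfl⟩
        exact hU _ _ (h3 y (by simp [hy]) x (by simp)).symm
    obtain ⟨r, hr, b, hb, hbm, hrb⟩ := hc R (v m) ⟨v 0, Or.inl ⟨0, h0, rfl⟩⟩ hRU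
      (fun h => by have := hidx _ hm.le h; omega)
      ⟨v k, hkU, fun h => by have := hidx _ le_rfl h; omega, fun h => by
        have := hv.inj _ _ le_rfl hm.le h; omega⟩
    have hl : ∃ i < m, Link G (verts v k) (v i) b := by
      rcases hr with ⟨i, hi, rfl⟩ | ⟨hr, i, hi, hl⟩
      · exact ⟨i, hi, Link.of_adj hrb⟩
      · exact ⟨i, hi, hl.trans (Link.of_adj hrb) hr⟩
    by_cases hbP : b ∈ verts v k
    · obtain ⟨j, hj, rfl⟩ := hbP
      refine ⟨j, ?_, hj, hl⟩
      rcases lt_trichotomy j m with h | rfl | h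
      · exact absurd (Or.inl ⟨j, h, rfl⟩) hb
      · exact absurd rfl hbm
      · exact h
    · exact absurd (Or.inr ⟨hbP, hl⟩) hb
  obtain ⟨m₀, hm0, hm0k, hu0⟩ := hex
  have hP : ∃ u < m, Link G (verts v k) (v u) (v (Nat.findGreatest
      (fun m₂ => ∃ u < m, Link G (verts v k) (v u) (v m₂)) k)) :=
    Nat.findGreatest_spec (P := fun m₂ => ∃ u < m, Link G (verts v k) (v u) (v m₂)) hm0k hu0
  obtain ⟨u, hu, hl⟩ := hP
  refine ⟨u, _, hu, lt_of_lt_of_le hm0 (Nat.le_findGreatest hm0k hu0), Nat.findGreatest_le _, hl, ?_⟩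
  intro u' hu' m' hm' hm'k hl'
  exact Nat.findGreatest_is_greatest hm' hm'k ⟨u', hu', hl'⟩

theorem exists_closed_of_path {v : ℕ → V} {k : ℕ} (hv : PathFun G v k) {M : List V} {l m i : ℕ}
    (hM : PathList G M (v m) (v l)) (hli : l ≤ i) (him : i < m) (hm : m ≤ k)
    (hMP : ∀ p, p ≤ k → l < p → v p ∈ M → p = m) (hik : G.Adj (v i) (v k)) :
    ∃ L, ClosedList G L ∧ ∀ x, x ∈ L ↔
      x ∈ M ∨ (∃ p, l < p ∧ p ≤ i ∧ v p = x) ∨ ∃ p, m < p ∧ p ≤ k ∧ v p = x := by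
  have h1 := hv.extend hM hli (by omega) (fun p h1 h2 h3 => by
    have := hMP p (by omega) h1 h3; omega)
  have h2 := hv.extend h1.reverse hm le_rfl ?_
  · refine ⟨_, ⟨_, _, h2, hik.symm⟩, fun x => ?_⟩
    simp only [List.mem_append, List.mem_reverse, mem_seg, Nat.succ_le_iff, or_assoc]
  · intro p hp hpk hmem
    rw [List.mem_reverse, List.mem_append, mem_seg] at hmem
    rcases hmem with h | ⟨q, hq1, hq2, hq3⟩
    · have := hMP p hpk (by omega) h; omega
    · have := hv.inj _ _ (by omega) hpk hq3; omega

/-- Extending a vine along the path `v 0, …, v k` until it covers a neighbour of `v k`. -/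
theorem exists_closed_of_vine {v : ℕ → V} {k : ℕ} (hv : PathFun G v k) {U : Finset V}
    (hc : Conn2 G U) (hU : ∀ x y, G.Adj x y → x ∈ U) (hk0 : 0 < k) :
    ∀ n l m M, k - m ≤ n → l < m → m ≤ k → PathList G M (v m) (v l) →
      (∀ p, p ≤ k → l < p → v p ∈ M → p = m) →
      (∀ i ≤ k, G.Adj (v 0) (v i) → v i ∈ M) →
      (∀ i ≤ k, G.Adj (v k) (v i) → l ≤ i) →
      (∀ i < l, ∀ m', m < m' → m' ≤ k → ¬ Link G (verts v k) (v i) (v m')) →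
      (∀ s ∈ M, s ∉ verts v k → ∀ m', m < m' → m' ≤ k → ¬ Link G (verts v k) s (v m')) →
      ∃ L i₀, ClosedList G L ∧ (∀ i ≤ k, G.Adj (v 0) (v i) → v i ∈ L) ∧
        ∀ i ≤ k, G.Adj (v k) (v i) → i ≠ i₀ → v (i + 1) ∈ L := by
  classical
  intro n
  induction n with
  | zero =>
    intro l m M hn hlm hmk hM hMP hN0 hNk hi1 hi2
    obtain rfl : m = k := by omega
    have hadj : G.Adj (v (m - 1)) (v m) := by
      have := hv.adj (m - 1) (by omega); rwa [show m - 1 + 1 = m by omega] at this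
    obtain ⟨L, hL, hmem⟩ := exists_closed_of_path hv hM (show l ≤ m - 1 by omega)
      (by omega) le_rfl hMP hadj
    refine ⟨L, m - 1, hL, fun i hi h => (hmem _).2 (Or.inl (hN0 i hi h)), fun i hi h hne => ?_⟩
    have := hNk i hi h
    rcases hi.eq_or_lt with rfl | hi
    · exact absurd h (G.loopless.irrefl _)
    · exact (hmem _).2 (Or.inr (Or.inl ⟨i + 1, by omega, by omega, rfl⟩))
  | succ n ih =>
    intro l m M hn hlm hmk hM hMP hN0 hNk hi1 hi2
    by_cases hex : ∃ i, i < m ∧ G.Adj (v k) (v i)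
    · obtain ⟨i1, hi1m, hi1a⟩ := hex
      let i₀ := Nat.findGreatest (fun i => G.Adj (v k) (v i)) (m - 1)
      have h1 : G.Adj (v k) (v i₀) :=
        Nat.findGreatest_spec (P := fun i => G.Adj (v k) (v i)) (show i1 ≤ m - 1 by omega) hi1a
      have h2 : i₀ ≤ m - 1 := Nat.findGreatest_le _
      have h3 : ∀ i, i₀ < i → i ≤ m - 1 → ¬ G.Adj (v k) (v i) := fun i hi hi' =>
        Nat.findGreatest_is_greatest hi hi'
      obtain ⟨L, hL, hmem⟩ := exists_closed_of_path hv hM (hNk i₀ (by omega) h1)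
        (by omega) hmk hMP h1.symm
      refine ⟨L, i₀, hL, fun i hi h => (hmem _).2 (Or.inl (hN0 i hi h)), fun i hi h hne => ?_⟩
      have := hNk i hi h
      rcases hi.eq_or_lt with rfl | hi
      · exact absurd h (G.loopless.irrefl _)
      · rcases lt_or_ge i m with him | him
        · have : i ≤ i₀ := by
            by_contra hcon
            exact h3 i (by omega) (by omega) h
          exact (hmem _).2 (Or.inr (Or.inl ⟨i + 1, by omega, by omega, rfl⟩))
        · exact (hmem _).2 (Or.inr (Or.inr ⟨i + 1, by omega, by omega, rfl⟩))
    · push Not at hex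
      have hmk' : m < k := by
        have hadj : G.Adj (v (k - 1)) (v k) := by
          have := hv.adj (k - 1) (by omega); rwa [show k - 1 + 1 = k by omega] at this
        by_contra hcon
        exact hex (k - 1) (by omega) hadj.symm
      obtain ⟨u, m₂, hum, hmm, hmk2, hl, hmax⟩ := exists_jump hv hc hU (show 0 < m by omega) hmk'
      have hlu : l ≤ u := by
        by_contra hcon
        exact hi1 u (by omega) m₂ hmm hmk2 hl
      obtain ⟨S, hS, hSP⟩ := hl.exists_path (fun h => by
        have := hv.inj _ _ (by omega) hmk2 h; omega)
      have h1 := hv.extend hM hlu (by omega) (fun p h1 h2 h3 => by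
        have := hMP p (by omega) h1 h3; omega)
      have h2 := h1.append_tail hS ?_
      · refine ih m m₂ _ (by omega) hmm hmk2 h2.reverse ?_ ?_ ?_ ?_ ?_
        · intro p hp hmp hmem
          simp only [List.mem_reverse, List.mem_append, mem_seg, List.mem_singleton] at hmem
          rcases hmem with (h | ⟨q, hq1, hq2, hq3⟩) | h | h
          · have := hMP p hp (by omega) h; omega
          · have := hv.inj _ _ (by omega) hp hq3; omega
          · exact absurd (mem_verts hp) (hSP _ h)
          · exact hv.inj _ _ hp hmk2 h
        · intro i hi h
          simp [hN0 i hi h]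
        · intro i hi h
          by_contra hcon
          exact hex i (by omega) h
        · exact fun i hi m' h1 h2 => hmax i hi m' h1 h2
        · intro s hs hsP m' h1 h2 hl'
          simp only [List.mem_reverse, List.mem_append, mem_seg, List.mem_singleton] at hs
          rcases hs with (h | ⟨q, hq1, hq2, rfl⟩) | h | h
          · exact hi2 s h hsP m' (by omega) h2 hl'
          · exact hsP (mem_verts (by omega))
          · exact hmax u hum m' h1 h2 ((hS.link_of_mem hSP h).1.trans hl' hsP)
          · subst h; exact hsP (mem_verts (by omega))
      · intro s hs hs'
        simp only [List.mem_append, mem_seg, List.mem_singleton] at hs hs'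
        rcases hs with hs | rfl
        · rcases hs' with h | ⟨q, hq1, hq2, rfl⟩
          · exact hi2 s h (hSP s hs) m₂ hmm hmk2 (hS.link_of_mem hSP hs).2
          · exact hSP _ hs (mem_verts (by omega))
        · rcases hs' with h | ⟨q, hq1, hq2, hq3⟩
          · have := hMP _ hmk2 (by omega) h; omega
          · have := hv.inj _ _ (by omega) hmk2 hq3; omega

end Links

section PosaType

open scoped Classical

variable {V : Type} {G : SimpleGraph V} {A B : Finset V}

theorem PathFun.parity (hG : IsBip G A B) {v : ℕ → V} {k : ℕ} (hv : PathFun G v k)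
    (h0 : v 0 ∈ A) : ∀ i ≤ k, (i % 2 = 0 → v i ∈ A) ∧ (i % 2 = 1 → v i ∈ B) := by
  intro i
  induction i with
  | zero => intro _; exact ⟨fun _ => h0, fun h => by omega⟩
  | succ i ih =>
    intro hi
    obtain ⟨h1, h2⟩ := ih (by omega)
    have := hv.adj i (by omega)
    exact ⟨fun h => hG.left_of_right (h2 (by omega)) this,
      fun h => hG.right_of_left (h1 (by omega)) this⟩

theorem PathFun.parity_of_adj (hG : IsBip G A B) {v : ℕ → V} {k : ℕ} (hv : PathFun G v k)
    (h0 : v 0 ∈ A) {i j : ℕ} (hi : i ≤ k) (hj : j ≤ k) (h : G.Adj (v i) (v j)) :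
    i % 2 ≠ j % 2 := by
  obtain ⟨h1, h2⟩ := hv.parity hG h0 i hi
  obtain ⟨h3, h4⟩ := hv.parity hG h0 j hj
  intro heq
  rcases Nat.mod_two_eq_zero_or_one i with hh | hh
  · exact hG.not_mem_right (h3 (by omega)) (hG.right_of_left (h1 hh) h)
  · exact hG.not_mem_left (h4 (by omega)) (hG.left_of_right (h2 hh) h)

/-- The indices `i ≤ k` for which `v i` is a neighbour of `y`. -/
noncomputable def nbIdx {V : Type} (G : SimpleGraph V) (v : ℕ → V) (k : ℕ) (y : V) : Finset ℕ :=
  (range (k + 1)).filter fun i => G.Adj y (v i)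

theorem mem_nbIdx {v : ℕ → V} {k i : ℕ} {y : V} : i ∈ nbIdx G v k y ↔ i ≤ k ∧ G.Adj y (v i) := by
  simp [nbIdx]

theorem dg_eq_card_nbIdx (hG : IsBip G A B) {v : ℕ → V} {k : ℕ} (hv : PathFun G v k) {y : V}
    (hy : y ∈ A) (hN : ∀ x, G.Adj y x → x ∈ verts v k) : dg G B y = (nbIdx G v k y).card := by
  have : B.filter (G.Adj y) = (nbIdx G v k y).image v := by
    ext x
    simp only [Finset.mem_filter, Finset.mem_image, mem_nbIdx]
    constructor
    · rintro ⟨-, h⟩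
      obtain ⟨i, hi, rfl⟩ := hN x h
      exact ⟨i, ⟨hi, h⟩, rfl⟩
    · rintro ⟨i, ⟨hi, h⟩, rfl⟩
      exact ⟨hG.right_of_left hy h, h⟩
  rw [dg, this, Finset.card_image_of_injOn]
  intro i hi j hj hij
  exact hv.inj i j (mem_nbIdx.1 hi).1 (mem_nbIdx.1 hj).1 hij

theorem ClosedList.le_of_idx (hG : IsBip G A B) {L : List V} (hL : ClosedList G L) {v : ℕ → V}
    {k : ℕ} (hv : PathFun G v k) (F : Finset ℕ) (hF : ∀ i ∈ F, i ≤ k ∧ v i ∈ A ∧ v i ∈ L) :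
    2 * F.card ≤ L.length := by
  have hinj : Set.InjOn v F := fun i hi j hj hij => hv.inj i j (hF i hi).1 (hF j hj).1 hij
  rw [← Finset.card_image_of_injOn hinj]
  refine hL.le_length hG ?_ ?_
  · intro x hx
    obtain ⟨i, hi, rfl⟩ := Finset.mem_image.1 hx
    exact (hF i hi).2.1
  · intro x hx
    obtain ⟨i, hi, rfl⟩ := Finset.mem_image.1 hx
    exact (hF i hi).2.2

/-- A path joining the two classes both of whose ends have all their neighbours on the path either
closes up to a cycle on the same vertices, or there is a cycle containing all but one of the
neighbours of one end and of the successors of the neighbours of the other end. -/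
theorem exists_closed_of_ends (hG : IsBip G A B) (hc : Conn2 G (A ∪ B)) {v : ℕ → V} {k : ℕ}
    (hv : PathFun G v k) (h0 : v 0 ∈ A) (hk : v k ∈ B) (hN0 : ∀ x, G.Adj (v 0) x → x ∈ verts v k)
    (hNk : ∀ x, G.Adj (v k) x → x ∈ verts v k) :
    ∃ L, ClosedList G L ∧ ((∀ x, x ∈ L ↔ x ∈ verts v k) ∨
      2 * (dg G B (v 0) + dg G A (v k)) ≤ L.length + 2) := by
  have hk1 : k % 2 = 1 := by
    by_contra hcon
    exact hG.not_mem_left hk ((hv.parity hG h0 k le_rfl).1 (by omega))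
  by_cases hfull : ∃ w, w < k ∧ G.Adj (v k) (v w) ∧ G.Adj (v 0) (v (w + 1))
  · obtain ⟨w, hw, h1, h2⟩ := hfull
    refine ⟨(seg v 0 w).reverse ++ seg v (w + 1) k, ⟨_, _, (hv.seg (Nat.zero_le _) hw.le).reverse.append
      (hv.seg hw le_rfl) h2 ?_, h1⟩, Or.inl fun x => ?_⟩
    · intro x hx hx'
      obtain ⟨p, -, hp, rfl⟩ := mem_seg.1 (List.mem_reverse.1 hx)
      obtain ⟨q, hq, hq', hqp⟩ := mem_seg.1 hx'
      have := hv.inj _ _ hq' (by omega) hqp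
      omega
    · simp only [List.mem_append, List.mem_reverse, mem_seg, verts, Set.mem_ofPred_eq]
      constructor
      · rintro (⟨p, h1, h2, h3⟩ | ⟨p, h1, h2, h3⟩)
        · exact ⟨p, by omega, h3⟩
        · exact ⟨p, by omega, h3⟩
      · rintro ⟨p, h1, h2⟩
        rcases le_or_gt p w with h | h
        · exact Or.inl ⟨p, by omega, h, h2⟩
        · exact Or.inr ⟨p, h, h1, h2⟩
  push Not at hfull
  have hU : ∀ x y, G.Adj x y → x ∈ A ∪ B := by
    intro x y h
    rcases hG.adj x y h with hh | hh <;> simp [hh.1]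
  suffices H : ∃ L i₀, ClosedList G L ∧ (∀ i ≤ k, G.Adj (v 0) (v i) → v i ∈ L) ∧
        ∀ i ≤ k, G.Adj (v k) (v i) → i ≠ i₀ → v (i + 1) ∈ L by
    obtain ⟨L, i₀, hL, hL1, hL2⟩ := H
    refine ⟨L, hL, Or.inr ?_⟩
    rw [dg_eq_card_nbIdx hG hv h0 hN0, dg_eq_card_nbIdx hG.symm hv hk hNk]
    have hlt : ∀ i, i ≤ k → G.Adj (v k) (v i) → i < k := by
      intro i hi h
      rcases hi.eq_or_lt with rfl | hi
      · exact absurd h (G.loopless.irrefl _)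
      · exact hi
    have hd : Disjoint (nbIdx G v k (v 0)) (((nbIdx G v k (v k)).erase i₀).image (· + 1)) := by
      rw [Finset.disjoint_left]
      intro i hi hi'
      obtain ⟨j, hj, rfl⟩ := Finset.mem_image.1 hi'
      have hj := mem_nbIdx.1 (Finset.mem_of_mem_erase hj)
      exact hfull j (hlt j hj.1 hj.2) hj.2 (mem_nbIdx.1 hi).2
    have hle := hL.le_of_idx hG.symm hv
      (nbIdx G v k (v 0) ∪ ((nbIdx G v k (v k)).erase i₀).image (· + 1)) (by
        intro i hi
        rcases Finset.mem_union.1 hi with hi | hi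
        · obtain ⟨h1, h2⟩ := mem_nbIdx.1 hi
          exact ⟨h1, hG.right_of_left h0 h2, hL1 i h1 h2⟩
        · obtain ⟨j, hj, rfl⟩ := Finset.mem_image.1 hi
          obtain ⟨h1, h2⟩ := mem_nbIdx.1 (Finset.mem_of_mem_erase hj)
          have h3 := hlt j h1 h2
          exact ⟨h3, hG.right_of_left (hG.left_of_right hk h2) (hv.adj j h3),
            hL2 j h1 h2 (Finset.ne_of_mem_erase hj)⟩)
    rw [Finset.card_union_of_disjoint hd, Finset.card_image_of_injective _
      (fun a b h => by simpa using h)] at hle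
    have := Finset.pred_card_le_card_erase (s := nbIdx G v k (v k)) (a := i₀)
    omega
  have hk01 : G.Adj (v 0) (v 1) := hv.adj 0 (by omega)
  have hkk : G.Adj (v k) (v (k - 1)) := by
    have := hv.adj (k - 1) (by omega)
    rw [show k - 1 + 1 = k by omega] at this
    exact this.symm
  by_cases hcr : ∃ m, m ≤ k ∧ G.Adj (v 0) (v m) ∧ ∃ l, l < m ∧ G.Adj (v k) (v l)
  · let m := Nat.find hcr
    obtain ⟨hmk, h0m, l₁, hl1m, hl1⟩ : m ≤ k ∧ G.Adj (v 0) (v m) ∧ ∃ l, l < m ∧ G.Adj (v k) (v l) :=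
      Nat.find_spec hcr
    have hmin : ∀ p < m, ¬ (p ≤ k ∧ G.Adj (v 0) (v p) ∧ ∃ l, l < p ∧ G.Adj (v k) (v l)) :=
      fun p hp => Nat.find_min hcr hp
    let l := Nat.findGreatest (fun i => G.Adj (v k) (v i)) (m - 1)
    have hl : G.Adj (v k) (v l) :=
      Nat.findGreatest_spec (P := fun i => G.Adj (v k) (v i)) (show l₁ ≤ m - 1 by omega) hl1
    have hlm : l ≤ m - 1 := Nat.findGreatest_le _
    have hlmax : ∀ i, l < i → i ≤ m - 1 → ¬ G.Adj (v k) (v i) := fun i hi hi' =>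
      Nat.findGreatest_is_greatest hi hi'
    refine ⟨(seg v 0 l).reverse ++ seg v m k, l, ⟨_, _, (hv.seg (Nat.zero_le _) (by omega)).reverse.append
      (hv.seg hmk le_rfl) h0m ?_, hl⟩, ?_, ?_⟩
    · intro x hx hx'
      obtain ⟨p, -, hp, rfl⟩ := mem_seg.1 (List.mem_reverse.1 hx)
      obtain ⟨q, hq, hq', hqp⟩ := mem_seg.1 hx'
      have := hv.inj _ _ hq' (by omega) hqp
      omega
    · intro i hi h
      simp only [List.mem_append, List.mem_reverse, mem_seg]
      rcases le_or_gt i l with hh | hh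
      · exact Or.inl ⟨i, by omega, hh, rfl⟩
      · refine Or.inr ⟨i, ?_, hi, rfl⟩
        by_contra hcon
        exact hmin i (by omega) ⟨hi, h, l, hh, hl⟩
    · intro i hi h hne
      simp only [List.mem_append, List.mem_reverse, mem_seg]
      rcases hi.eq_or_lt with rfl | hik
      · exact absurd h (G.loopless.irrefl _)
      rcases lt_or_ge i l with hh | hh
      · exact Or.inl ⟨i + 1, by omega, hh, rfl⟩
      · refine Or.inr ⟨i + 1, ?_, hik, rfl⟩
        by_contra hcon
        exact hlmax i (by omega) (by omega) h
  · push Not at hcr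
    let f := Nat.findGreatest (fun i => G.Adj (v 0) (v i)) k
    have hf : G.Adj (v 0) (v f) :=
      Nat.findGreatest_spec (P := fun i => G.Adj (v 0) (v i)) (show 1 ≤ k by omega) hk01
    have hfk : f ≤ k := Nat.findGreatest_le _
    have hfmax : ∀ i, f < i → i ≤ k → ¬ G.Adj (v 0) (v i) := fun i hi hi' =>
      Nat.findGreatest_is_greatest hi hi'
    have hf1 : 0 < f := by
      rcases Nat.eq_zero_or_pos f with h | h
      · rw [h] at hf; exact absurd hf (G.loopless.irrefl _)
      · exact h
    have hNkf : ∀ i ≤ k, G.Adj (v k) (v i) → f ≤ i := by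
      intro i hi h
      by_contra hcon
      exact hcr f hfk hf i (by omega) h
    have hfk' : f < k := by
      have := hNkf (k - 1) (by omega) hkk
      omega
    obtain ⟨u, m, hum, hfm, hmk, hl, hmax⟩ := exists_jump hv hc hU hf1 hfk'
    obtain ⟨S, hS, hSP⟩ := hl.exists_path (fun h => by
      have := hv.inj _ _ (by omega) hmk h; omega)
    have hexj : ∃ j, u < j ∧ j ≤ f ∧ G.Adj (v 0) (v j) := ⟨f, hum, le_rfl, hf⟩
    let j := Nat.find hexj
    obtain ⟨huj, hjf, h0j⟩ : u < j ∧ j ≤ f ∧ G.Adj (v 0) (v j) := Nat.find_spec hexj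
    have hjmin : ∀ p < j, ¬ (u < p ∧ p ≤ f ∧ G.Adj (v 0) (v p)) := fun p hp => Nat.find_min hexj hp
    have h1 := (hv.seg (Nat.zero_le u) (by omega)).append_tail hS (by
      intro s hs hs'
      obtain ⟨p, -, hp, rfl⟩ := mem_seg.1 hs'
      rcases List.mem_append.1 hs with hs | hs
      · exact hSP _ hs (mem_verts (by omega))
      · have := hv.inj p m (by omega) hmk (List.mem_singleton.1 hs)
        omega)
    have h2 := h1.reverse.append (hv.seg hjf hfk) h0j (by
      intro s hs hs'
      obtain ⟨p, hp1, hp2, rfl⟩ := mem_seg.1 hs'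
      simp only [List.mem_reverse, List.mem_append, mem_seg, List.mem_singleton] at hs
      rcases hs with ⟨q, -, hq, hqp⟩ | hs | hs
      · have := hv.inj _ _ (by omega) (by omega) hqp; omega
      · exact hSP _ hs (mem_verts (by omega))
      · have := hv.inj _ _ (by omega) hmk hs; omega)
    refine exists_closed_of_vine hv hc hU (by omega) (k - m) f m _ le_rfl hfm hmk h2 ?_ ?_ hNkf ?_ ?_
    · intro p hp hfp hmem
      simp only [List.mem_reverse, List.mem_append, mem_seg, List.mem_singleton] at hmem
      rcases hmem with (⟨q, -, hq, hqp⟩ | hs | hs) | ⟨q, hq1, hq2, hqp⟩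
      · have := hv.inj _ _ (by omega) (by omega) hqp; omega
      · exact absurd (mem_verts hp) (hSP _ hs)
      · exact hv.inj _ _ (by omega) hmk hs
      · have := hv.inj _ _ (by omega) (by omega) hqp; omega
    · intro i hi h
      simp only [List.mem_reverse, List.mem_append, mem_seg, List.mem_singleton]
      rcases le_or_gt i u with hh | hh
      · exact Or.inl (Or.inl ⟨i, by omega, hh, rfl⟩)
      · have hif : i ≤ f := by
          by_contra hcon
          exact hfmax i (by omega) hi h
        refine Or.inr ⟨i, ?_, hif, rfl⟩
        by_contra hcon
        exact hjmin i (by omega) ⟨hh, hif, h⟩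
    · exact fun i hi m' h1 h2 => hmax i hi m' h1 h2
    · intro s hs hsP m' h3 h4 hl'
      simp only [List.mem_reverse, List.mem_append, mem_seg, List.mem_singleton] at hs
      rcases hs with (⟨q, -, hq, rfl⟩ | hs | rfl) | ⟨q, hq1, hq2, rfl⟩
      · exact hsP (mem_verts (by omega))
      · exact hmax u hum m' h3 h4 ((hS.link_of_mem hSP hs).1.trans hl' hsP)
      · exact hsP (mem_verts hmk)
      · exact hsP (mem_verts (by omega))

end PosaType

section LongestPath

open scoped Classical

variable {V : Type} {G : SimpleGraph V} {A B : Finset V}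

/-- `v 0, …, v K` is a longest path of `G`, and both of its ends lie in `B`. -/
structure LongPath {V : Type} (G : SimpleGraph V) (A B : Finset V) (v : ℕ → V) (K : ℕ) : Prop where
  bip : IsBip G A B
  path : PathFun G v K
  zero : v 0 ∈ B
  even : K % 2 = 0
  max : ∀ L a b, PathList G L a b → L.length ≤ K + 1

/-- `Q` is a path outside `v 0, …, v K` that starts at a neighbour of `v p` and ends at `u`. -/
structure Attached {V : Type} (G : SimpleGraph V) (v : ℕ → V) (K p : ℕ) (Q : List V) (u : V) :
    Prop where
  le : p ≤ K
  path : ∃ c, PathList G Q c u ∧ G.Adj (v p) c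
  off : ∀ s ∈ Q, s ∉ verts v K

theorem verts_flip (v : ℕ → V) (K : ℕ) : verts (fun i => v (K - i)) K = verts v K := by
  ext x
  constructor
  · rintro ⟨i, hi, rfl⟩; exact ⟨K - i, by omega, rfl⟩
  · rintro ⟨i, hi, rfl⟩; exact ⟨K - i, by omega, by simp [show K - (K - i) = i by omega]⟩

theorem mem_nbIdx_flip {v : ℕ → V} {K i : ℕ} {y : V} :
    i ∈ nbIdx G (fun i => v (K - i)) K y ↔ i ≤ K ∧ K - i ∈ nbIdx G v K y := by
  simp only [mem_nbIdx]
  constructor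
  · rintro ⟨h1, h2⟩; exact ⟨h1, by omega, h2⟩
  · rintro ⟨h1, h2, h3⟩; exact ⟨h1, h3⟩

theorem card_nbIdx_flip (v : ℕ → V) (K : ℕ) (y : V) :
    (nbIdx G (fun i => v (K - i)) K y).card = (nbIdx G v K y).card := by
  refine Finset.card_bij' (fun i _ => K - i) (fun i _ => K - i) ?_ ?_ ?_ ?_
  · intro i hi; exact (mem_nbIdx_flip.1 hi).2
  · intro i hi
    have := (mem_nbIdx.1 hi).1
    exact mem_nbIdx_flip.2 ⟨by omega, by rwa [show K - (K - i) = i by omega]⟩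
  · intro i hi; have := (mem_nbIdx.1 hi).1; omega
  · intro i hi; have := (mem_nbIdx.1 hi).1; omega

theorem Attached.flip {v : ℕ → V} {K p : ℕ} {Q : List V} {u : V} (h : Attached G v K p Q u) :
    Attached G (fun i => v (K - i)) K (K - p) Q u := by
  have := h.le
  refine ⟨by omega, ?_, by rw [verts_flip]; exact h.off⟩
  simpa [show K - (K - p) = p by omega] using h.path

theorem Attached.pathList {v : ℕ → V} {K p : ℕ} {Q : List V} {u : V} (hQ : Attached G v K p Q u) :
    PathList G (v p :: Q) (v p) u := by
  obtain ⟨c, h1, h2⟩ := hQ.path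
  exact h1.cons h2 fun hh => hQ.off _ hh (mem_verts hQ.le)

namespace LongPath

variable {v : ℕ → V} {K : ℕ}

theorem parity (h : LongPath G A B v K) {i : ℕ} (hi : i ≤ K) :
    (i % 2 = 0 → v i ∈ B) ∧ (i % 2 = 1 → v i ∈ A) :=
  h.path.parity h.bip.symm h.zero i hi

theorem odd_of_adj (h : LongPath G A B v K) {y : V} (hy : y ∈ B) {i : ℕ} (hi : i ≤ K)
    (hyi : G.Adj y (v i)) : i % 2 = 1 := by
  by_contra hcon
  exact h.bip.not_mem_left ((h.parity hi).1 (by omega)) (h.bip.left_of_right hy hyi)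

theorem even_of_adj (h : LongPath G A B v K) {y : V} (hy : y ∈ A) {i : ℕ} (hi : i ≤ K)
    (hyi : G.Adj y (v i)) : i % 2 = 0 := by
  by_contra hcon
  exact h.bip.not_mem_right ((h.parity hi).2 (by omega)) (h.bip.right_of_left hy hyi)

theorem last (h : LongPath G A B v K) : v K ∈ B := (h.parity le_rfl).1 h.even

theorem flip (h : LongPath G A B v K) : LongPath G A B (fun i => v (K - i)) K :=
  ⟨h.bip, h.path.flip, by simpa using h.last, h.even, h.max⟩

theorem nb_zero (h : LongPath G A B v K) {x : V} (hx : G.Adj (v 0) x) : x ∈ verts v K := by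
  by_contra hcon
  have := h.max _ _ _ ((h.path.seg (Nat.zero_le K) le_rfl).cons hx.symm (by
    rw [mem_seg]; rintro ⟨i, -, hi, rfl⟩; exact hcon (mem_verts hi)))
  simp at this

theorem nb_last (h : LongPath G A B v K) {x : V} (hx : G.Adj (v K) x) : x ∈ verts v K := by
  rw [← verts_flip]
  exact h.flip.nb_zero (by simpa using hx)

theorem card_nb_zero (h : LongPath G A B v K) : (nbIdx G v K (v 0)).card = dg G A (v 0) :=
  (dg_eq_card_nbIdx h.bip.symm h.path h.zero fun _ hx => h.nb_zero hx).symm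

theorem card_nb_last (h : LongPath G A B v K) : (nbIdx G v K (v K)).card = dg G A (v K) :=
  (dg_eq_card_nbIdx h.bip.symm h.path h.last fun _ hx => h.nb_last hx).symm

theorem attached_lt (h : LongPath G A B v K) {p i : ℕ} {Q : List V} {u : V}
    (hQ : Attached G v K p Q u) (hi : i ∈ nbIdx G v K (v 0)) (hpi : p < i) :
    p + Q.length + 1 ≤ i := by
  obtain ⟨hiK, hadj⟩ := mem_nbIdx.1 hi
  have hle := hQ.le
  obtain ⟨L, hL, hmem, hlen⟩ := h.path.extend_down hQ.pathList.reverse (Nat.zero_le p) hle (by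
    intro q _ hq hmem
    rw [List.mem_reverse, List.mem_cons] at hmem
    rcases hmem with h1 | h1
    · have := h.path.inj _ _ (by omega) hle h1; omega
    · exact hQ.off _ h1 (mem_verts (by omega)))
  have h2 := hL.append (h.path.seg hiK le_rfl) hadj (by
    intro x hx hx'
    obtain ⟨q, hq1, hq2, rfl⟩ := mem_seg.1 hx'
    rcases (hmem _).1 hx with hx | ⟨r, -, hr, hr'⟩
    · rw [List.mem_reverse, List.mem_cons] at hx
      rcases hx with h1 | h1
      · have := h.path.inj _ _ hq2 hle h1; omega
      · exact hQ.off _ h1 (mem_verts hq2)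
    · have := h.path.inj _ _ (by omega) hq2 hr'; omega)
  have := h.max _ _ _ h2
  simp [hlen] at this
  omega

theorem attached_length (h : LongPath G A B v K) {p : ℕ} {Q : List V} {u : V}
    (hQ : Attached G v K p Q u) (hu : u ∈ A) : Q.length + 1 = 2 * cnt A Q + p % 2 := by
  obtain ⟨c, h1, h2⟩ := hQ.path
  obtain ⟨i1, -, i3, -⟩ := h1.length_eq h.bip
  rcases Nat.mod_two_eq_zero_or_one p with hp | hp
  · have := i1 (h.bip.left_of_right ((h.parity hQ.le).1 hp) h2) hu; omega
  · have := i3 (h.bip.right_of_left ((h.parity hQ.le).2 hp) h2) hu; omega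

/-- The cycle `v 0, …, v i, v K, …, v s`. -/
theorem crossing_cycle (h : LongPath G A B v K) {i s : ℕ} (his : i < s)
    (hi : i ∈ nbIdx G v K (v K)) (hs : s ∈ nbIdx G v K (v 0)) :
    ∃ L, ClosedList G L ∧ ∀ p ≤ K, (p ≤ i ∨ s ≤ p) → v p ∈ L := by
  obtain ⟨hiK, hi⟩ := mem_nbIdx.1 hi
  obtain ⟨hsK, hs⟩ := mem_nbIdx.1 hs
  refine ⟨(seg v 0 i).reverse ++ seg v s K, ⟨_, _, (h.path.seg (Nat.zero_le _) hiK).reverse.append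
    (h.path.seg hsK le_rfl) hs ?_, hi⟩, ?_⟩
  · intro x hx hx'
    obtain ⟨p, -, hp, rfl⟩ := mem_seg.1 (List.mem_reverse.1 hx)
    obtain ⟨q, hq, hq', hqp⟩ := mem_seg.1 hx'
    have := h.path.inj _ _ hq' (by omega) hqp
    omega
  · rintro p hp (h1 | h1)
    · simp only [List.mem_append, List.mem_reverse, mem_seg]
      exact Or.inl ⟨p, Nat.zero_le _, h1, rfl⟩
    · simp only [List.mem_append, mem_seg]
      exact Or.inr ⟨p, h1, hp, rfl⟩

/-- The cycle `v 0, …, v i, D, v j, …, v f`. -/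
theorem bridge_cycle (h : LongPath G A B v K) {i j f : ℕ} (hij : i < j) (hjf : j ≤ f)
    (hf : f ∈ nbIdx G v K (v 0)) {D : List V} (hD : PathList G (v i :: (D ++ [v j])) (v i) (v j))
    (hoff : ∀ s ∈ D, s ∉ verts v K) :
    ∃ L, ClosedList G L ∧ ∀ p ≤ f, (p ≤ i ∨ j ≤ p) → v p ∈ L := by
  obtain ⟨hfK, hf⟩ := mem_nbIdx.1 hf
  have h1 := (h.path.seg (Nat.zero_le i) (by omega)).append_tail hD (by
    intro s hs hs'
    obtain ⟨p, -, hp, rfl⟩ := mem_seg.1 hs'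
    rcases List.mem_append.1 hs with hs | hs
    · exact hoff _ hs (mem_verts (by omega))
    · have := h.path.inj p j (by omega) (by omega) (List.mem_singleton.1 hs)
      omega)
  have h2 := h.path.extend h1 hjf hfK (by
    intro p hp1 hp2 hmem
    simp only [List.mem_append, mem_seg, List.mem_singleton] at hmem
    rcases hmem with ⟨q, -, hq, hqp⟩ | hs | hs
    · have := h.path.inj _ _ (by omega) (by omega) hqp; omega
    · exact hoff _ hs (mem_verts (by omega))
    · have := h.path.inj p j (by omega) (by omega) hs; omega)
  refine ⟨_, ⟨_, _, h2, hf.symm⟩, ?_⟩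
  intro p hp hpp
  simp only [List.mem_append, mem_seg, List.mem_singleton]
  rcases hpp with h3 | h3
  · exact Or.inl (Or.inl ⟨p, by omega, h3, rfl⟩)
  · rcases h3.eq_or_lt with rfl | h3
    · exact Or.inl (Or.inr (Or.inr rfl))
    · exact Or.inr ⟨p, h3, hp, rfl⟩

end LongPath

/-- The first `h` odd numbers greater than `p`. -/
def blk (p h : ℕ) : Finset ℕ := (range h).image fun r => p + 1 + p % 2 + 2 * r

theorem mem_blk {p h i : ℕ} (hi : i ∈ blk p h) : i % 2 = 1 ∧ p < i ∧ i + 1 ≤ p + p % 2 + 2 * h := by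
  obtain ⟨r, hr, rfl⟩ := Finset.mem_image.1 hi
  have := Finset.mem_range.1 hr
  omega

theorem card_blk (p h : ℕ) : (blk p h).card = h := by
  rw [blk, Finset.card_image_of_injective _ (fun a b hab => by simpa using hab), Finset.card_range]

namespace LongPath

variable {v : ℕ → V} {K : ℕ}

theorem disjoint_blk (h : LongPath G A B v K) {p : ℕ} {Q : List V} {u : V}
    (hQ : Attached G v K p Q u) (hu : u ∈ A) :
    Disjoint (nbIdx G v K (v 0)) (blk p (cnt A Q)) := by
  rw [Finset.disjoint_left]
  intro i hi hi'
  have h1 := mem_blk hi'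
  have h2 := h.attached_lt hQ hi h1.2.1
  have h3 := h.attached_length hQ hu
  omega

theorem lt_of_mem_blk (h : LongPath G A B v K) {p : ℕ} {Q : List V} {u : V}
    (hQ : Attached G v K p Q u) (hu : u ∈ A) {i f : ℕ} (hf : f ∈ nbIdx G v K (v 0)) (hpf : p < f)
    (hi : i ∈ blk p (cnt A Q)) : i < f := by
  have h1 := mem_blk hi
  have h2 := h.attached_lt hQ hf hpf
  have h3 := h.attached_length hQ hu
  omega

theorem mem_of_odd (h : LongPath G A B v K) {i : ℕ} (hi : i ≤ K) (h1 : i % 2 = 1) : v i ∈ A :=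
  (h.parity hi).2 h1

theorem odd_of_mem (h : LongPath G A B v K) {i : ℕ} (hi : i ∈ nbIdx G v K (v 0)) : i % 2 = 1 :=
  h.odd_of_adj h.zero (mem_nbIdx.1 hi).1 (mem_nbIdx.1 hi).2

theorem le_of_attached (h : LongPath G A B v K) {L : List V} (hL : ClosedList G L) {p f : ℕ}
    {Q : List V} {u : V} (hQ : Attached G v K p Q u) (hu : u ∈ A) (hf : f ∈ nbIdx G v K (v 0))
    (hpf : p < f) (h1 : ∀ i ∈ nbIdx G v K (v 0), v i ∈ L) (h2 : ∀ i, p ≤ i → i ≤ f → v i ∈ L) :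
    2 * ((nbIdx G v K (v 0)).card + cnt A Q) ≤ L.length := by
  have := hL.le_of_idx h.bip h.path (nbIdx G v K (v 0) ∪ blk p (cnt A Q)) (by
    intro i hi
    rcases Finset.mem_union.1 hi with hi | hi
    · have := (mem_nbIdx.1 hi).1
      exact ⟨this, h.mem_of_odd this (h.odd_of_mem hi), h1 i hi⟩
    · have h3 := h.lt_of_mem_blk hQ hu hf hpf hi
      have h4 := (mem_nbIdx.1 hf).1
      have h5 := mem_blk hi
      exact ⟨by omega, h.mem_of_odd (by omega) h5.1, h2 i (by omega) (by omega)⟩)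
  rwa [Finset.card_union_of_disjoint (h.disjoint_blk hQ hu), card_blk] at this

/-- As `le_of_attached`, taking also into account the successors of a set `T` of neighbours of the
first vertex of the attached path. -/
theorem le_of_attached' (h : LongPath G A B v K) {L : List V} (hL : ClosedList G L) {p f : ℕ}
    {Q : List V} {z u : V} (hQ : PathList G Q z u) (hoff : ∀ s ∈ Q, s ∉ verts v K) (hz : z ∈ A)
    (hu : u ∈ A) (hp : p ∈ nbIdx G v K z) (hf : f ∈ nbIdx G v K (v 0))
    (hpf : p < f) (h1 : ∀ i ∈ nbIdx G v K (v 0), v i ∈ L) (h2 : ∀ i, p ≤ i → i ≤ f → v i ∈ L)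
    (T : Finset ℕ) (hT : T ⊆ nbIdx G v K z) (hTp : ∀ j ∈ T, j < p) (h3 : ∀ j ∈ T, v (j + 1) ∈ L) :
    2 * ((nbIdx G v K (v 0)).card + T.card + cnt A Q) ≤ L.length := by
  have hatt : ∀ j ∈ nbIdx G v K z, Attached G v K j Q u := fun j hj =>
    ⟨(mem_nbIdx.1 hj).1, ⟨z, hQ, (mem_nbIdx.1 hj).2.symm⟩, hoff⟩
  have hfK := (mem_nbIdx.1 hf).1
  have hlen := hQ.length_pos
  have hT' : ∀ j ∈ T, (j + 1) % 2 = 1 := by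
    intro j hj
    have hj := mem_nbIdx.1 (hT hj)
    have := h.even_of_adj hz hj.1 hj.2
    omega
  have := hL.le_of_idx h.bip h.path ((nbIdx G v K (v 0) ∪ T.image (· + 1)) ∪ blk p (cnt A Q)) (by
    intro i hi
    rcases Finset.mem_union.1 hi with hi | hi
    · rcases Finset.mem_union.1 hi with hi | hi
      · have := (mem_nbIdx.1 hi).1
        exact ⟨this, h.mem_of_odd this (h.odd_of_mem hi), h1 i hi⟩
      · obtain ⟨j, hj, rfl⟩ := Finset.mem_image.1 hi
        have := hTp j hj
        exact ⟨by omega, h.mem_of_odd (by omega) (hT' j hj), h3 j hj⟩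
    · have h3 := h.lt_of_mem_blk (hatt p hp) hu hf hpf hi
      have h4 := (mem_nbIdx.1 hf).1
      have h5 := mem_blk hi
      exact ⟨by omega, h.mem_of_odd (by omega) h5.1, h2 i (by omega) (by omega)⟩)
  rw [Finset.card_union_of_disjoint, Finset.card_union_of_disjoint, card_blk,
    Finset.card_image_of_injective _ (fun a b hab => by simpa using hab)] at this
  · exact this
  · rw [Finset.disjoint_left]
    intro i hi hi'
    obtain ⟨j, hj, rfl⟩ := Finset.mem_image.1 hi'
    have := h.attached_lt (hatt j (hT hj)) hi (by omega)
    omega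
  · rw [Finset.disjoint_union_left]
    refine ⟨h.disjoint_blk (hatt p hp) hu, ?_⟩
    rw [Finset.disjoint_left]
    intro i hi hi'
    obtain ⟨j, hj, rfl⟩ := Finset.mem_image.1 hi
    have h4 := hTp j hj
    have := mem_blk hi'
    omega

end LongPath

/-- `i` is a neighbour of the last vertex, `s` one of the first vertex, and no neighbours of either
lie strictly between them. -/
structure IsGap {V : Type} (G : SimpleGraph V) (v : ℕ → V) (K i s : ℕ) : Prop where
  lt : i < s
  left : i ∈ nbIdx G v K (v K)
  right : s ∈ nbIdx G v K (v 0)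
  zero : ∀ p ∈ nbIdx G v K (v 0), p ≤ i ∨ s ≤ p
  last : ∀ p ∈ nbIdx G v K (v K), p ≤ i ∨ s ≤ p

theorem IsGap.flip {v : ℕ → V} {K i s : ℕ} (h : IsGap G v K i s) :
    IsGap G (fun i => v (K - i)) K (K - s) (K - i) := by
  have h1 := (mem_nbIdx.1 h.left).1
  have h2 := (mem_nbIdx.1 h.right).1
  have h3 := h.lt
  refine ⟨by omega, ?_, ?_, ?_, ?_⟩
  · rw [mem_nbIdx_flip]
    refine ⟨by omega, ?_⟩
    rw [show K - (K - s) = s by omega]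
    simpa using h.right
  · rw [mem_nbIdx_flip]
    refine ⟨by omega, ?_⟩
    rw [show K - (K - i) = i by omega]
    simpa using h.left
  · intro p hp
    obtain ⟨h4, h5⟩ := mem_nbIdx_flip.1 hp
    rcases h.last _ (by simpa using h5) with h6 | h6 <;> omega
  · intro p hp
    obtain ⟨h4, h5⟩ := mem_nbIdx_flip.1 hp
    rcases h.zero _ (by simpa using h5) with h6 | h6 <;> omega

theorem exists_gap {v : ℕ → V} {K g f : ℕ} (hgf : g < f) (hg : g ∈ nbIdx G v K (v K))
    (hf : f ∈ nbIdx G v K (v 0)) :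
    ∃ i s, IsGap G v K i s := by
  induction hn : f - g using Nat.strong_induction_on generalizing g f with
  | _ n ih =>
    by_cases h0 : ∃ p ∈ nbIdx G v K (v 0), g < p ∧ p < f
    · obtain ⟨p, hp, h1, h2⟩ := h0
      exact ih _ (by omega) h1 hg hp rfl
    by_cases h1 : ∃ p ∈ nbIdx G v K (v K), g < p ∧ p < f
    · obtain ⟨p, hp, h1, h2⟩ := h1
      exact ih _ (by omega) h2 hp hf rfl
    push Not at h0 h1
    refine ⟨g, f, hgf, hg, hf, fun p hp => ?_, fun p hp => ?_⟩
    · by_contra hcon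
      have := h0 p hp (by omega); omega
    · by_contra hcon
      have := h1 p hp (by omega); omega

end LongestPath

section LongestPath

open scoped Classical

variable {V : Type} {G : SimpleGraph V} {A B : Finset V}

namespace LongPath

variable {v : ℕ → V} {K : ℕ}

theorem odd_of_mem_last (h : LongPath G A B v K) {i : ℕ} (hi : i ∈ nbIdx G v K (v K)) : i % 2 = 1 :=
  h.odd_of_adj h.last (mem_nbIdx.1 hi).1 (mem_nbIdx.1 hi).2

theorem exists_of_gap_pair (h : LongPath G A B v K) {i s : ℕ} (hg : IsGap G v K i s)
    {Q : List V} {z u : V} (hQ : PathList G Q z u) (hoff : ∀ s ∈ Q, s ∉ verts v K) (hz : z ∈ A)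
    (hu : u ∈ A) {f : ℕ} (hf : f ∈ nbIdx G v K (v 0)) (hJf : ∀ j ∈ nbIdx G v K z, j < f)
    {j₁ j₂ : ℕ} (hj₁ : j₁ ∈ nbIdx G v K z) (hj₂ : j₂ ∈ nbIdx G v K z) (h₁₂ : j₁ < j₂) (hij : i < j₁)
    (hjs : j₂ < s) :
    ∃ L, ClosedList G L ∧
      2 * ((nbIdx G v K (v 0)).card + (nbIdx G v K z).card + cnt A Q) ≤ L.length + 4 := by
  set J := nbIdx G v K z with hJ
  let p := J.max' ⟨_, hj₁⟩
  have hpJ : p ∈ J := J.max'_mem _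
  have hpmax : ∀ j ∈ J, j ≤ p := fun j hj => J.le_max' j hj
  let F := (nbIdx G v K (v 0)).max' ⟨_, hf⟩
  have hFI : F ∈ nbIdx G v K (v 0) := Finset.max'_mem _ _
  have hFmax : ∀ j ∈ nbIdx G v K (v 0), j ≤ F := fun j hj => Finset.le_max' _ j hj
  have hpF : p < F := lt_of_lt_of_le (hJf p hpJ) (hFmax f hf)
  have hex : ∃ j, j ∈ J ∧ j₁ < j := ⟨j₂, hj₂, h₁₂⟩
  let j := Nat.find hex
  obtain ⟨hjJ, hj⟩ : j ∈ J ∧ j₁ < j := Nat.find_spec hex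
  have hjmin : ∀ q ∈ J, j₁ < q → j ≤ q := fun q h1 h2 => Nat.find_min' hex ⟨h1, h2⟩
  have hjp := hpmax j hjJ
  have hjj := hjmin j₂ hj₂ h₁₂
  have hzoff : z ∉ verts v K := hoff z hQ.head_mem
  have hj₁' := mem_nbIdx.1 hj₁
  have hj' := mem_nbIdx.1 hjJ
  have hD : PathList G (v j₁ :: ([z] ++ [v j])) (v j₁) (v j) := by
    have h1 : PathList G ([z] ++ [v j]) z (v j) :=
      (PathList.singleton z).concat hj'.2 (by
        rw [List.mem_singleton]; intro hh; exact hzoff (hh ▸ mem_verts hj'.1))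
    refine h1.cons hj₁'.2.symm ?_
    simp only [List.singleton_append, List.mem_cons, List.not_mem_nil, or_false, not_or]
    refine ⟨fun hh => hzoff (hh ▸ mem_verts hj₁'.1), fun hh => ?_⟩
    have := h.path.inj _ _ hj₁'.1 hj'.1 hh
    omega
  obtain ⟨L, hL, hmem⟩ := h.bridge_cycle hj (show j ≤ F by omega) hFI hD (by simpa using hzoff)
  refine ⟨L, hL, ?_⟩
  have hle := h.le_of_attached' hL hQ hoff hz hu hpJ hFI hpF ?_ ?_ ((J.erase j₁).erase p) ?_ ?_ ?_
  · have h1 := Finset.pred_card_le_card_erase (s := J) (a := j₁)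
    have h2 := Finset.pred_card_le_card_erase (s := J.erase j₁) (a := p)
    omega
  · intro q hq
    refine hmem q (hFmax q hq) ?_
    rcases hg.zero q hq with h1 | h1
    · left; omega
    · right; omega
  · intro q h1 h2
    exact hmem q h2 (by right; omega)
  · exact (Finset.erase_subset _ _).trans (Finset.erase_subset _ _)
  · intro q hq
    have h1 := Finset.ne_of_mem_erase hq
    have h2 := hpmax q (Finset.mem_of_mem_erase (Finset.mem_of_mem_erase hq))
    omega
  · intro q hq
    have h1 := Finset.ne_of_mem_erase hq
    have h3 := Finset.mem_of_mem_erase hq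
    have h4 := Finset.ne_of_mem_erase h3
    have h5 := Finset.mem_of_mem_erase h3
    have h2 := hpmax q h5
    refine hmem _ (by omega) ?_
    rcases lt_or_ge j₁ q with h6 | h6
    · have := hjmin q h5 h6
      right; omega
    · left; omega

theorem exists_of_above (h : LongPath G A B v K) {i s : ℕ} (hg : IsGap G v K i s)
    {Q : List V} {z u : V} (hQ : PathList G Q z u) (hoff : ∀ s ∈ Q, s ∉ verts v K) (hz : z ∈ A)
    (hu : u ∈ A) {f : ℕ} (hf : f ∈ nbIdx G v K (v 0)) (hJf : ∀ j ∈ nbIdx G v K z, j < f)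
    (hgap : ((nbIdx G v K z).filter fun j => i < j ∧ j < s).card ≤ 1)
    {j₁ : ℕ} (hj₁ : j₁ ∈ nbIdx G v K z) (hjs : s ≤ j₁) :
    ∃ L, ClosedList G L ∧
      2 * ((nbIdx G v K (v 0)).card + (nbIdx G v K z).card + cnt A Q) ≤ L.length + 4 := by
  set J := nbIdx G v K z with hJ
  let p := J.max' ⟨_, hj₁⟩
  have hpJ : p ∈ J := J.max'_mem _
  have hpmax : ∀ j ∈ J, j ≤ p := fun j hj => J.le_max' j hj
  have hp1 := hpmax _ hj₁
  obtain ⟨L, hL, hmem⟩ := h.crossing_cycle hg.lt hg.left hg.right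
  refine ⟨L, hL, ?_⟩
  have hfK := (mem_nbIdx.1 hf).1
  have hle := h.le_of_attached' hL hQ hoff hz hu hpJ hf (hJf p hpJ) ?_ ?_
    ((J.filter fun j => ¬ (i < j ∧ j < s)).erase p) ?_ ?_ ?_
  · have h1 := Finset.card_filter_add_card_filter_not (s := J) (fun j => i < j ∧ j < s)
    have h2 := Finset.pred_card_le_card_erase (s := J.filter fun j => ¬ (i < j ∧ j < s)) (a := p)
    omega
  · intro q hq
    exact hmem q (mem_nbIdx.1 hq).1 (hg.zero q hq)
  · intro q h1 h2
    exact hmem q (by omega) (by right; omega)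
  · exact (Finset.erase_subset _ _).trans (Finset.filter_subset _ _)
  · intro q hq
    have h1 := Finset.ne_of_mem_erase hq
    have h2 := hpmax q (Finset.mem_filter.1 (Finset.mem_of_mem_erase hq)).1
    omega
  · intro q hq
    have h1 := Finset.ne_of_mem_erase hq
    obtain ⟨h2, h3⟩ := Finset.mem_filter.1 (Finset.mem_of_mem_erase hq)
    have h4 := hJf q h2
    have h5 := h.even_of_adj hz (mem_nbIdx.1 h2).1 (mem_nbIdx.1 h2).2
    have h6 := h.odd_of_mem_last hg.left
    refine hmem _ (by omega) ?_
    omega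

/-- A vertex outside a longest path with at least two neighbours on it, all of them in the crossing
range of the ends, yields a long cycle. -/
theorem exists_of_two_le (h : LongPath G A B v K) {i s : ℕ} (hg : IsGap G v K i s)
    {Q : List V} {z u : V} (hQ : PathList G Q z u) (hoff : ∀ s ∈ Q, s ∉ verts v K) (hz : z ∈ A)
    (hu : u ∈ A) {f g : ℕ} (hf : f ∈ nbIdx G v K (v 0)) (hJf : ∀ j ∈ nbIdx G v K z, j < f)
    (hg' : g ∈ nbIdx G v K (v K)) (hJg : ∀ j ∈ nbIdx G v K z, g < j)
    (hJ : 2 ≤ (nbIdx G v K z).card) :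
    ∃ L, ClosedList G L ∧
      (2 * ((nbIdx G v K (v 0)).card + (nbIdx G v K z).card + cnt A Q) ≤ L.length + 4 ∨
      2 * ((nbIdx G v K (v K)).card + (nbIdx G v K z).card + cnt A Q) ≤ L.length + 4) := by
  by_cases h2 : 2 ≤ ((nbIdx G v K z).filter fun j => i < j ∧ j < s).card
  · obtain ⟨j₁, hj₁, j₂, hj₂, hne⟩ := Finset.one_lt_card.1 h2
    obtain ⟨a1, a2, a3⟩ := Finset.mem_filter.1 hj₁
    obtain ⟨b1, b2, b3⟩ := Finset.mem_filter.1 hj₂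
    rcases lt_or_gt_of_ne hne with hlt | hlt
    · obtain ⟨L, h1, h2⟩ := h.exists_of_gap_pair hg hQ hoff hz hu hf hJf a1 b1 hlt a2 b3
      exact ⟨L, h1, Or.inl h2⟩
    · obtain ⟨L, h1, h2⟩ := h.exists_of_gap_pair hg hQ hoff hz hu hf hJf b1 a1 hlt b2 a3
      exact ⟨L, h1, Or.inl h2⟩
  by_cases hs : ∃ j ∈ nbIdx G v K z, s ≤ j
  · obtain ⟨j, hj, hsj⟩ := hs
    obtain ⟨L, h1, h2⟩ := h.exists_of_above hg hQ hoff hz hu hf hJf (by omega) hj hsj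
    exact ⟨L, h1, Or.inl h2⟩
  have hi : ∃ j ∈ nbIdx G v K z, j ≤ i := by
    by_contra hcon
    push Not at hs hcon
    refine h2 (hJ.trans (Finset.card_le_card fun j hj => ?_))
    exact Finset.mem_filter.2 ⟨hj, hcon j hj, hs j hj⟩
  obtain ⟨j, hj, hji⟩ := hi
  have hgK := (mem_nbIdx.1 hg').1
  have hjK := (mem_nbIdx.1 hj).1
  have hiK := (mem_nbIdx.1 hg.left).1
  have hsK := (mem_nbIdx.1 hg.right).1
  have hg₁ : K - g ∈ nbIdx G (fun q => v (K - q)) K (v (K - 0)) := by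
    rw [mem_nbIdx_flip]
    refine ⟨by omega, ?_⟩
    rw [show K - (K - g) = g by omega]
    simpa using hg'
  have hJ₁ : ∀ q ∈ nbIdx G (fun q => v (K - q)) K z, q < K - g := by
    intro q hq
    obtain ⟨h4, h5⟩ := mem_nbIdx_flip.1 hq
    have := hJg _ h5
    omega
  have hgap : ((nbIdx G (fun q => v (K - q)) K z).filter
      fun q => K - s < q ∧ q < K - i).card ≤ 1 := by
    rw [← not_lt]
    intro hlt
    refine h2 (le_trans (Nat.succ_le_of_lt hlt) ?_)
    refine Finset.card_le_card_of_injOn (fun q => K - q) ?_ ?_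
    · intro q hq
      obtain ⟨h4, h5, h6⟩ := Finset.mem_filter.1 hq
      obtain ⟨h7, h8⟩ := mem_nbIdx_flip.1 h4
      refine Finset.mem_filter.2 ⟨h8, ?_⟩
      dsimp only
      omega
    · intro q hq r hr hqr
      have h4 := (mem_nbIdx.1 (Finset.mem_filter.1 hq).1).1
      have h5 := (mem_nbIdx.1 (Finset.mem_filter.1 hr).1).1
      simp only at hqr
      omega
  have hj₁ : K - j ∈ nbIdx G (fun q => v (K - q)) K z := by
    rw [mem_nbIdx_flip]
    exact ⟨by omega, by rwa [show K - (K - j) = j by omega]⟩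
  obtain ⟨L, h1, h3⟩ := h.flip.exists_of_above hg.flip hQ
    (by rw [verts_flip]; exact hoff) hz hu hg₁ hJ₁ hgap hj₁ (by omega)
  refine ⟨L, h1, Or.inr ?_⟩
  rw [card_nbIdx_flip, card_nbIdx_flip] at h3
  simpa using h3

/-- If the last attachment of a component outside the path lies beyond all the neighbours of
`v 0`. -/
theorem exists_of_end (h : LongPath G A B v K) (hc : Conn2 G (A ∪ B)) {p : ℕ} {Q : List V} {u : V}
    (hQ : Attached G v K p Q u) (hu : u ∈ A) (h0 : ∀ i ∈ nbIdx G v K (v 0), i ≤ p)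
    (hN : ∀ y, G.Adj u y → y ∈ Q ∨ ∃ i ≤ p, v i = y) :
    ∃ L, ClosedList G L ∧ 2 * (dg G A (v 0) + dg G B u) ≤ L.length + 2 := by
  obtain ⟨c, hQ1, hQ2⟩ := hQ.path
  have hP : PathList G (seg v 0 p ++ Q) (v 0) u :=
    (h.path.seg (Nat.zero_le p) hQ.le).append hQ1 hQ2 (by
      intro x hx hx'
      obtain ⟨i, -, hi, rfl⟩ := mem_seg.1 hx
      exact hQ.off _ hx' (mem_verts (hi.trans hQ.le)))
  obtain ⟨w, k, hw, hPw, hw0, hwk⟩ := hP.exists_pathFun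
  have hvw : ∀ x, x ∈ verts w k ↔ x ∈ seg v 0 p ++ Q := by
    intro x; rw [hPw, mem_seg]
    exact ⟨fun ⟨i, hi, hx⟩ => ⟨i, Nat.zero_le _, hi, hx⟩, fun ⟨i, _, hi, hx⟩ => ⟨i, hi, hx⟩⟩
  have hc' : Conn2 G (B ∪ A) := by rwa [Finset.union_comm]
  have hw₀ : ∀ x, G.Adj (w 0) x → x ∈ verts w k := by
    rw [hw0]
    intro x hx
    obtain ⟨i, hi, rfl⟩ := h.nb_zero hx
    rw [hvw, List.mem_append, mem_seg]
    exact Or.inl ⟨i, Nat.zero_le _, h0 i (mem_nbIdx.2 ⟨hi, hx⟩), rfl⟩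
  have hwₖ : ∀ x, G.Adj (w k) x → x ∈ verts w k := by
    rw [hwk]
    intro x hx
    rw [hvw, List.mem_append, mem_seg]
    rcases hN x hx with hh | ⟨i, hi, rfl⟩
    · exact Or.inr hh
    · exact Or.inl ⟨i, Nat.zero_le _, hi, rfl⟩
  obtain ⟨L, hL, hL'⟩ := exists_closed_of_ends h.bip.symm hc' hw (by rw [hw0]; exact h.zero)
    (by rw [hwk]; exact hu) hw₀ hwₖ
  rw [hw0, hwk] at hL'
  refine ⟨L, hL, hL'.resolve_left fun hall => ?_⟩
  have hpm : v p ∈ L := by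
    rw [hall, hvw, List.mem_append, mem_seg]
    exact Or.inl ⟨p, Nat.zero_le _, le_rfl, rfl⟩
  obtain ⟨L', y, hL1, hL2, hperm⟩ := hL.open_at hpm
  have hperm2 : L.Perm (seg v 0 p ++ Q) := by
    rw [List.perm_ext_iff_of_nodup hL.nodup hP.nodup]
    intro x; rw [hall, hvw]
  have hext := h.path.extend hL1.reverse hQ.le le_rfl (by
    intro q hq1 hq2 hmem
    rw [List.mem_reverse, ← hperm.mem_iff, hperm2.mem_iff, List.mem_append, mem_seg] at hmem
    rcases hmem with ⟨r, -, hr, hrq⟩ | hmem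
    · have := h.path.inj _ _ (by omega) hq2 hrq; omega
    · exact hQ.off _ hmem (mem_verts hq2))
  have hle := h.max _ _ _ hext
  have h1 := (hperm.symm.trans hperm2).length_eq
  have h2 := hQ1.length_pos
  have h3 := hQ.le
  simp [h1] at hle
  omega

theorem exists_of_attached_above (h : LongPath G A B v K) {i s : ℕ} (hg : IsGap G v K i s)
    {p : ℕ} {Q : List V} {u : V} (hQ : Attached G v K p Q u) (hu : u ∈ A) (hsp : s ≤ p) {f : ℕ}
    (hf : f ∈ nbIdx G v K (v 0)) (hpf : p < f) :
    ∃ L, ClosedList G L ∧ 2 * ((nbIdx G v K (v 0)).card + cnt A Q) ≤ L.length := by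
  obtain ⟨L, hL, hmem⟩ := h.crossing_cycle hg.lt hg.left hg.right
  have hfK := (mem_nbIdx.1 hf).1
  exact ⟨L, hL, h.le_of_attached hL hQ hu hf hpf
    (fun q hq => hmem q (mem_nbIdx.1 hq).1 (hg.zero q hq))
    (fun q h1 h2 => hmem q (by omega) (by right; omega))⟩

theorem exists_of_attached_below (h : LongPath G A B v K) {i s : ℕ} (hg : IsGap G v K i s)
    {p : ℕ} {Q : List V} {u : V} (hQ : Attached G v K p Q u) (hu : u ∈ A) (hpi : p ≤ i) {g : ℕ}
    (hg' : g ∈ nbIdx G v K (v K)) (hgp : g < p) :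
    ∃ L, ClosedList G L ∧ 2 * ((nbIdx G v K (v K)).card + cnt A Q) ≤ L.length := by
  have h1 := (mem_nbIdx.1 hg').1
  have h2 := (mem_nbIdx.1 hg.left).1
  obtain ⟨L, hL, hle⟩ := h.flip.exists_of_attached_above (f := K - g) hg.flip hQ.flip hu (by omega) (by
    rw [mem_nbIdx_flip]
    refine ⟨by omega, ?_⟩
    rw [show K - (K - g) = g by omega]
    simpa using hg') (by have := hQ.le; omega)
  rw [card_nbIdx_flip] at hle
  exact ⟨L, hL, by simpa using hle⟩

theorem exists_of_bridge (h : LongPath G A B v K) {i s : ℕ} (hg : IsGap G v K i s)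
    {p : ℕ} {Q : List V} {u : V} (hQ : Attached G v K p Q u) (hu : u ∈ A) (hps : p < s) {f : ℕ}
    (hf : f ∈ nbIdx G v K (v 0)) (hpf : p < f) {q : ℕ} (hiq : i < q) (hqp : q < p) {D : List V}
    (hD : PathList G (v q :: (D ++ [v p])) (v q) (v p)) (hoff : ∀ s ∈ D, s ∉ verts v K) :
    ∃ L, ClosedList G L ∧ 2 * ((nbIdx G v K (v 0)).card + cnt A Q) ≤ L.length := by
  let F := (nbIdx G v K (v 0)).max' ⟨_, hf⟩
  have hFI : F ∈ nbIdx G v K (v 0) := Finset.max'_mem _ _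
  have hFmax : ∀ j ∈ nbIdx G v K (v 0), j ≤ F := fun j hj => Finset.le_max' _ j hj
  have h1 := hFmax f hf
  obtain ⟨L, hL, hmem⟩ := h.bridge_cycle hqp (show p ≤ F by omega) hFI hD hoff
  refine ⟨L, hL, h.le_of_attached hL hQ hu hFI (by omega) (fun r hr => hmem r (hFmax r hr) ?_)
    (fun r h1 h2 => hmem r h2 (by right; omega))⟩
  rcases hg.zero r hr with h2 | h2
  · left; omega
  · right; omega

end LongPath

end LongestPath

section Alternating

open scoped Classical

variable {V : Type} {G : SimpleGraph V} {A B : Finset V}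

theorem PathList.length_le {l : List V} {a b : V} (h : PathList G l a b) {S : Finset V} (hS : ∀ x ∈ l, x ∈ S) :
    l.length ≤ S.card := by
  rw [← List.toFinset_card_of_nodup h.nodup]
  exact Finset.card_le_card fun x hx => hS x (List.mem_toFinset.1 hx)

theorem exists_longest {p : List V → Prop} (N : ℕ) (hp : ∃ l, p l) (hN : ∀ l, p l → l.length ≤ N) :
    ∃ l, p l ∧ ∀ l', p l' → l'.length ≤ l.length := by
  obtain ⟨l₀, hl₀⟩ := hp
  let q : ℕ → Prop := fun n => ∃ l, p l ∧ l.length = n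
  have h1 : q (Nat.findGreatest q N) := Nat.findGreatest_spec (hN _ hl₀) ⟨l₀, hl₀, rfl⟩
  obtain ⟨l, hl, hlen⟩ := h1
  exact ⟨l, hl, fun l' hl' => hlen ▸ Nat.le_findGreatest (hN _ hl') ⟨l', hl', rfl⟩⟩

/-- The vertices of `W` with a neighbour in `S`. -/
noncomputable def nbs {V : Type} (G : SimpleGraph V) (W S : Finset V) : Finset V :=
  W.filter fun w => ∃ x ∈ S, G.Adj x w

theorem mem_nbs {W S : Finset V} {w : V} : w ∈ nbs G W S ↔ w ∈ W ∧ ∃ x ∈ S, G.Adj x w :=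
  Finset.mem_filter

/-- A minimal violation of Hall's condition. -/
theorem exists_critical {Z W : Finset V} (hZW : W.card < Z.card) :
    ∃ S ⊆ Z, (nbs G W S).card < S.card ∧ ∀ T ⊂ S, T.card ≤ (nbs G W T).card := by
  have hne : (Z.powerset.filter fun S => (nbs G W S).card < S.card).Nonempty :=
    ⟨Z, Finset.mem_filter.2 ⟨Finset.mem_powerset_self _,
      (Finset.card_filter_le _ _).trans_lt hZW⟩⟩
  obtain ⟨S, hS, hmin⟩ := Finset.exists_min_image _ Finset.card hne
  obtain ⟨hSZ, hS⟩ := Finset.mem_filter.1 hS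
  rw [Finset.mem_powerset] at hSZ
  refine ⟨S, hSZ, hS, fun T hT => ?_⟩
  by_contra hcon
  have h1 := hmin T (Finset.mem_filter.2 ⟨Finset.mem_powerset.2 (hT.1.trans hSZ), by omega⟩)
  have h2 := Finset.card_lt_card hT
  omega

theorem exists_matching {W S : Finset V} (hS : (nbs G W S).card < S.card)
    (hmin : ∀ T ⊂ S, T.card ≤ (nbs G W T).card) (z : V) :
    ∃ M : V → V, (∀ w ∈ nbs G W S, M w ∈ S ∧ M w ≠ z ∧ G.Adj w (M w)) ∧
      ∀ w ∈ nbs G W S, ∀ w' ∈ nbs G W S, M w = M w' → w = w' := by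
  let t : {w // w ∈ nbs G W S} → Finset V := fun w => (S.erase z).filter (G.Adj w.1)
  have hall : ∀ T : Finset {w // w ∈ nbs G W S}, T.card ≤ (T.biUnion t).card := by
    intro T
    rcases T.eq_empty_or_nonempty with rfl | ⟨w₀, hw₀⟩
    · simp
    let N := S.filter fun x => ∃ w ∈ T, G.Adj w.1 x
    have hN : N ⊆ S := Finset.filter_subset _ _
    obtain ⟨-, x₀, hx₀, hadj⟩ := mem_nbs.1 w₀.2
    have hss : S \ N ⊂ S := by
      refine ⟨Finset.sdiff_subset, fun hh => ?_⟩
      exact (Finset.mem_sdiff.1 (hh hx₀)).2 (Finset.mem_filter.2 ⟨hx₀, w₀, hw₀, hadj.symm⟩)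
    have h1 := hmin _ hss
    have h2 : nbs G W (S \ N) ⊆ nbs G W S \ T.image Subtype.val := by
      intro w hw
      obtain ⟨hwW, x, hx, hxw⟩ := mem_nbs.1 hw
      obtain ⟨hxS, hxN⟩ := Finset.mem_sdiff.1 hx
      refine Finset.mem_sdiff.2 ⟨mem_nbs.2 ⟨hwW, x, hxS, hxw⟩, fun hwT => hxN ?_⟩
      obtain ⟨w', hw', rfl⟩ := Finset.mem_image.1 hwT
      exact Finset.mem_filter.2 ⟨hxS, w', hw', hxw.symm⟩
    have h3 := Finset.card_le_card h2
    have h4 : (T.image Subtype.val).card = T.card :=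
      Finset.card_image_of_injective _ Subtype.val_injective
    have h5 : T.image Subtype.val ⊆ nbs G W S := by
      intro w hw
      obtain ⟨w', -, rfl⟩ := Finset.mem_image.1 hw
      exact w'.2
    rw [Finset.card_sdiff_of_subset h5, h4] at h3
    have h6 := Finset.card_le_card h5
    rw [Finset.card_sdiff_of_subset hN] at h1
    have h7 : N.erase z ⊆ T.biUnion t := by
      intro x hx
      obtain ⟨hxz, hx⟩ := Finset.mem_erase.1 hx
      obtain ⟨hxS, w, hw, hwx⟩ := Finset.mem_filter.1 hx
      exact Finset.mem_biUnion.2 ⟨w, hw, Finset.mem_filter.2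
        ⟨Finset.mem_erase.2 ⟨hxz, hxS⟩, hwx⟩⟩
    have h8 := Finset.card_le_card h7
    have h9 := Finset.pred_card_le_card_erase (s := N) (a := z)
    have h10 := Finset.card_le_card hN
    omega
  obtain ⟨f, hf, hft⟩ := (Finset.all_card_le_biUnion_card_iff_exists_injective t).1 hall
  refine ⟨fun w => if hw : w ∈ nbs G W S then f ⟨w, hw⟩ else w, ?_, ?_⟩
  · intro w hw
    have := hft ⟨w, hw⟩
    obtain ⟨h1, h2⟩ := Finset.mem_filter.1 this
    obtain ⟨h3, h4⟩ := Finset.mem_erase.1 h1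
    simp only [hw, dite_true]
    exact ⟨h4, h3, h2⟩
  · intro w hw w' hw' heq
    simp only [hw, hw', dite_true] at heq
    exact congrArg Subtype.val (hf heq)

/-- From every vertex of a minimal Hall violator and its neighbourhood there is a path, inside this
set, to a vertex all of whose neighbours in `W` lie on the path. -/
theorem exists_alternating (hG : IsBip G A B) {W S : Finset V} (hSA : S ⊆ A) (hWB : W ⊆ B)
    (hS : (nbs G W S).card < S.card)
    (hmin : ∀ T ⊂ S, T.card ≤ (nbs G W T).card) {r : V} (hr : r ∈ S ∪ nbs G W S) :
    ∃ Q u, PathList G Q r u ∧ (∀ x ∈ Q, x ∈ S ∪ nbs G W S) ∧ u ∈ S ∧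
      ∀ w ∈ W, G.Adj u w → w ∈ Q := by
  have hne : S.Nonempty := Finset.card_pos.1 (by omega)
  obtain ⟨z, hz, hrz⟩ : ∃ z ∈ S, r ∈ S → r = z := by
    by_cases hrS : r ∈ S
    · exact ⟨r, hrS, fun _ => rfl⟩
    · obtain ⟨z, hz⟩ := hne
      exact ⟨z, hz, fun h => absurd h hrS⟩
  obtain ⟨M, hM, hinj⟩ := exists_matching hS hmin z
  have hWA : ∀ w ∈ nbs G W S, w ∉ S := fun w hw hwS =>
    hG.not_mem_left (hWB (mem_nbs.1 hw).1) (hSA hwS)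
  let p : List V → Prop := fun Q => ∃ u, PathList G Q r u ∧ (∀ x ∈ Q, x ∈ S ∪ nbs G W S) ∧ u ∈ S ∧
    ∀ x ∈ Q, x ∈ S → x = z ∨ ∃ w ∈ Q, w ∈ nbs G W S ∧ x = M w
  have hp : ∃ Q, p Q := by
    rcases Finset.mem_union.1 hr with hrS | hrW
    · refine ⟨[r], r, PathList.singleton r, ?_, hrS, ?_⟩
      · intro x hx; rw [List.mem_singleton.1 hx]; exact hr
      · intro x hx _; rw [List.mem_singleton.1 hx]; exact Or.inl (hrz hrS)
    · obtain ⟨h1, h2, h3⟩ := hM r hrW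
      refine ⟨[r, M r], M r, (PathList.singleton _).cons h3 ?_, ?_, h1, ?_⟩
      · rw [List.mem_singleton]; exact h3.ne
      · intro x hx
        rcases List.mem_pair.1 hx with rfl | rfl
        · exact hr
        · exact Finset.mem_union_left _ h1
      · intro x hx hxS
        rcases List.mem_pair.1 hx with rfl | rfl
        · exact absurd hxS (hWA _ hrW)
        · exact Or.inr ⟨r, by simp, hrW, rfl⟩
  obtain ⟨Q, ⟨u, hQ, hQS, hu, hQM⟩, hmax⟩ := exists_longest (S ∪ nbs G W S).card hp
    (fun Q ⟨u, hQ, hQS, _⟩ => hQ.length_le hQS)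
  refine ⟨Q, u, hQ, hQS, hu, fun w hwW huw => ?_⟩
  by_contra hwQ
  have hw : w ∈ nbs G W S := mem_nbs.2 ⟨hwW, u, hu, huw⟩
  obtain ⟨h1, h2, h3⟩ := hM w hw
  have hMQ : M w ∉ Q := by
    intro hh
    rcases hQM _ hh h1 with h4 | ⟨w', hw', hw'W, h4⟩
    · exact h2 h4
    · exact hwQ (hinj w hw w' hw'W h4 ▸ hw')
  have hnew : p (Q ++ [w] ++ [M w]) := by
    refine ⟨M w, (hQ.concat huw hwQ).concat h3 ?_, ?_, h1, ?_⟩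
    · simp only [List.mem_append, List.mem_singleton, not_or]
      exact ⟨hMQ, h3.ne'⟩
    · intro x hx
      simp only [List.mem_append, List.mem_singleton] at hx
      rcases hx with (hx | rfl) | rfl
      · exact hQS x hx
      · exact Finset.mem_union_right _ hw
      · exact Finset.mem_union_left _ h1
    · intro x hx hxS
      simp only [List.mem_append, List.mem_singleton] at hx
      rcases hx with (hx | rfl) | rfl
      · rcases hQM x hx hxS with h4 | ⟨w', hw', h5⟩
        · exact Or.inl h4
        · exact Or.inr ⟨w', by simp [hw'], h5⟩
      · exact absurd hxS (hWA _ hw)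
      · exact Or.inr ⟨w, by simp, hw, rfl⟩
  have := hmax _ hnew
  simp at this

end Alternating

section Outer

variable {V : Type} {G : SimpleGraph V}

theorem PathList.trans {l₁ l₂ : List V} {a b c : V} (h₁ : PathList G l₁ a b)
    (h₂ : PathList G l₂ b c) : ∃ l, PathList G l a c ∧ ∀ x ∈ l, x ∈ l₁ ∨ x ∈ l₂ := by
  rcases h₂.cases with ⟨rfl, rfl⟩ | ⟨l', d, rfl, hd, -, hl'⟩
  · exact ⟨l₁, h₁, fun x hx => Or.inl hx⟩
  · obtain ⟨l, hl, hsub⟩ := PathList.of_chain (l₁ ++ l') a c (by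
      rw [List.isChain_append]
      refine ⟨h₁.chain, hl'.chain, ?_⟩
      rw [h₁.last, hl'.head]
      simpa using hd) (by simp [h₁.head]) (by simp [hl'.last])
    refine ⟨l, hl, fun x hx => ?_⟩
    rcases List.mem_append.1 (hsub x hx) with h | h
    · exact Or.inl h
    · exact Or.inr (List.mem_cons_of_mem _ h)

/-- The component of `z` outside `P`. -/
def outer {V : Type} (G : SimpleGraph V) (P : Set V) (z : V) : Set V :=
  {x | ∃ Q, PathList G Q x z ∧ ∀ s ∈ Q, s ∉ P}

variable {P : Set V} {z : V}

theorem self_mem_outer (hz : z ∉ P) : z ∈ outer G P z :=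
  ⟨[z], PathList.singleton z, by simpa using hz⟩

theorem not_mem_of_mem_outer {x : V} (hx : x ∈ outer G P z) : x ∉ P := by
  obtain ⟨Q, h1, h2⟩ := hx
  exact h2 _ h1.head_mem

theorem exists_path_of_mem_outer {x y : V} (hx : x ∈ outer G P z) (hy : y ∈ outer G P z) :
    ∃ Q, PathList G Q x y ∧ ∀ s ∈ Q, s ∉ P := by
  obtain ⟨Q, h1, h2⟩ := hx
  obtain ⟨Q', h1', h2'⟩ := hy
  obtain ⟨L, hL, hs⟩ := h1.trans h1'.reverse
  refine ⟨L, hL, fun s hsL => ?_⟩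
  rcases hs s hsL with h | h
  · exact h2 s h
  · exact h2' s (List.mem_reverse.1 h)

theorem mem_outer_of_path {x y : V} {Q : List V} (hx : x ∈ outer G P z) (hQ : PathList G Q x y)
    (hP : ∀ s ∈ Q, s ∉ P) : y ∈ outer G P z := by
  obtain ⟨Q', h1, h2⟩ := hx
  obtain ⟨L, hL, hs⟩ := hQ.reverse.trans h1
  refine ⟨L, hL, fun s hsL => ?_⟩
  rcases hs s hsL with h | h
  · exact hP s (List.mem_reverse.1 h)
  · exact h2 s h

theorem mem_outer_of_adj {x y : V} (hx : x ∈ outer G P z) (hxy : G.Adj x y) (hy : y ∉ P) :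
    y ∈ outer G P z := by
  refine mem_outer_of_path hx ((PathList.singleton y).cons hxy ?_) ?_
  · simpa using hxy.ne
  · intro s hs
    rcases List.mem_pair.1 hs with rfl | rfl
    · exact not_mem_of_mem_outer hx
    · exact hy

end Outer

section LongestPath

open scoped Classical

variable {V : Type} {G : SimpleGraph V} {A B : Finset V}

namespace LongPath

variable {v : ℕ → V} {K : ℕ}

theorem dg_le {u : V} {Q : List V}
    (hN : ∀ y, G.Adj u y → y ∉ verts v K → y ∈ Q) :
    dg G B u ≤ (nbIdx G v K u).card + cnt B Q := by
  have : B.filter (G.Adj u) ⊆ (nbIdx G v K u).image v ∪ B.filter (· ∈ Q) := by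
    intro y hy
    obtain ⟨hyB, hy⟩ := Finset.mem_filter.1 hy
    by_cases hyv : y ∈ verts v K
    · obtain ⟨i, hi, rfl⟩ := hyv
      exact Finset.mem_union_left _ (Finset.mem_image_of_mem _ (mem_nbIdx.2 ⟨hi, hy⟩))
    · exact Finset.mem_union_right _ (Finset.mem_filter.2 ⟨hyB, hN y hy hyv⟩)
  refine (Finset.card_le_card this).trans ((Finset.card_union_le _ _).trans ?_)
  exact Nat.add_le_add_right Finset.card_image_le _

/-- Outside a longest path with both ends in `B` there is a component in which every vertex can
be joined to a vertex of `A` all of whose neighbours lie on the joining path or on the longest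
path. -/
theorem exists_outer_end (h : LongPath G A B v K) (hcard : A.card = B.card) :
    ∃ z ∈ A, z ∉ verts v K ∧ ∀ r ∈ outer G (verts v K) z, ∃ Q u, PathList G Q r u ∧
      (∀ s ∈ Q, s ∉ verts v K) ∧ u ∈ A ∧ ∀ y, G.Adj u y → y ∉ verts v K → y ∈ Q := by
  have hcnt : ∀ C : Finset V, (C.filter fun x => x ∉ verts v K).card + cnt C (seg v 0 K) = C.card := by
    intro C
    have h1 := Finset.card_filter_add_card_filter_not (s := C) (fun x => x ∉ verts v K)
    have h2 : cnt C (seg v 0 K) = (C.filter fun x => ¬ x ∉ verts v K).card := by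
      unfold cnt
      congr 1
      ext x
      simp [mem_seg, verts]
    omega
  obtain ⟨-, -, -, hlen⟩ := (h.path.seg (Nat.zero_le K) le_rfl).length_eq h.bip
  have hlen := hlen h.zero h.last
  have h1 := hcnt A
  have h2 := hcnt B
  obtain ⟨S, hSZ, hS, hmin⟩ := exists_critical (G := G) (Z := A.filter fun x => x ∉ verts v K)
    (W := B.filter fun x => x ∉ verts v K) (by omega)
  have hSA : S ⊆ A := hSZ.trans (Finset.filter_subset _ _)
  have hoff : ∀ x ∈ S ∪ nbs G (B.filter fun x => x ∉ verts v K) S, x ∉ verts v K := by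
    intro x hx
    rcases Finset.mem_union.1 hx with hx | hx
    · exact (Finset.mem_filter.1 (hSZ hx)).2
    · exact (Finset.mem_filter.1 (mem_nbs.1 hx).1).2
  obtain ⟨z, hz⟩ : S.Nonempty := Finset.card_pos.1 (by omega)
  refine ⟨z, hSA hz, hoff z (Finset.mem_union_left _ hz), ?_⟩
  rintro r ⟨Q₀, hQ₀, hoff₀⟩
  obtain ⟨Q₁, x, hQ₁, hx, hsub, hfirst⟩ := hQ₀.first_hit
    {x | x ∈ S ∪ nbs G (B.filter fun x => x ∉ verts v K) S} (Finset.mem_union_left _ hz)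
  obtain ⟨Q₂, u, hQ₂, hQS, hu, hN⟩ := exists_alternating h.bip hSA (Finset.filter_subset _ _) hS
    hmin hx
  have hN' : ∀ y, G.Adj u y → y ∉ verts v K → y ∈ Q₂ := fun y hy hyv =>
    hN y (Finset.mem_filter.2 ⟨h.bip.right_of_left (hSA hu) hy, hyv⟩) hy
  have hoff₁ : ∀ s ∈ Q₁, s ∉ verts v K := fun s hs => hoff₀ s (hsub s hs)
  rcases hQ₂.cases with ⟨rfl, rfl⟩ | ⟨l, c, rfl, hc, hxl, hl⟩
  · refine ⟨Q₁, x, hQ₁, hoff₁, hSA hu, fun y hy hyv => ?_⟩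
    rw [List.mem_singleton.1 (hN' y hy hyv)]
    exact hQ₁.last_mem
  · refine ⟨Q₁ ++ l, u, hQ₁.append hl hc ?_, ?_, hSA hu, ?_⟩
    · intro y hy hyl
      have hyx : y ≠ x := by rintro rfl; exact hxl hyl
      exact hfirst y hy hyx (hQS y (List.mem_cons_of_mem _ hyl))
    · intro y hy
      rcases List.mem_append.1 hy with hy | hy
      · exact hoff₁ y hy
      · exact hoff y (hQS y (List.mem_cons_of_mem _ hy))
    · intro y hy hyv
      rcases List.mem_cons.1 (hN' y hy hyv) with rfl | hyl
      · exact List.mem_append_left _ hQ₁.last_mem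
      · exact List.mem_append_right _ hyl

theorem two_le (h : LongPath G A B v K) (hdeg : ∀ x ∈ A, ∀ y ∈ B, 1 ≤ dg G B x + dg G A y)
    (hA : A.Nonempty) : 2 ≤ K := by
  by_contra hcon
  have hK : K = 0 := by have := h.even; omega
  obtain ⟨x, hx⟩ := hA
  have : ∃ a b, G.Adj a b := by
    by_contra hno
    push Not at hno
    have h1 := hdeg x hx _ h.zero
    rw [dg, dg, Finset.filter_false_of_mem fun y _ => hno _ y,
      Finset.filter_false_of_mem fun y _ => hno _ y] at h1
    simp at h1
  obtain ⟨a, b, hab⟩ := this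
  have := h.max _ _ _ ((PathList.singleton b).cons hab (by simpa using hab.ne))
  simp at this
  omega

/-- A component outside the longest path is attached at two places at least. -/
theorem exists_two_attached (h : LongPath G A B v K) (hc : Conn2 G (A ∪ B)) (hK : 1 ≤ K) {z : V}
    (hz : z ∈ A) (hzv : z ∉ verts v K) :
    ∃ p q r s, p < q ∧ q ≤ K ∧ r ∈ outer G (verts v K) z ∧ s ∈ outer G (verts v K) z ∧
      G.Adj (v p) r ∧ G.Adj (v q) s := by
  have hU : ∀ x ∈ outer G (verts v K) z, x ∈ A ∪ B := by
    rintro x ⟨Q, hQ, -⟩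
    rcases hQ.cases with ⟨-, rfl⟩ | ⟨l, c, -, hxc, -⟩
    · exact Finset.mem_union_left _ hz
    · rcases h.bip.adj _ _ hxc with h1 | h1
      · exact Finset.mem_union_left _ h1.1
      · exact Finset.mem_union_right _ h1.1
  have hout : ∀ i ≤ K, v i ∉ outer G (verts v K) z := fun i hi hh =>
    not_mem_of_mem_outer hh (mem_verts hi)
  have key : ∀ i ≤ K, ∃ j ≤ K, j ≠ i ∧ ∃ r ∈ outer G (verts v K) z, G.Adj (v j) r := by
    intro i hi
    obtain ⟨r, hr, b, hb, hbi, hrb⟩ := hc _ (v i) ⟨z, self_mem_outer hzv⟩ hU (hout i hi) (by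
      rcases eq_or_ne i 0 with rfl | hi0
      · refine ⟨v K, Finset.mem_union_right _ h.last, hout K le_rfl, fun hh => ?_⟩
        have := h.path.inj _ _ le_rfl (Nat.zero_le _) hh; omega
      · refine ⟨v 0, Finset.mem_union_right _ h.zero, hout 0 (Nat.zero_le _), fun hh => hi0 ?_⟩
        exact (h.path.inj _ _ (Nat.zero_le _) hi hh).symm)
    have hbv : b ∈ verts v K := by
      by_contra hbv
      exact hb (mem_outer_of_adj hr hrb hbv)
    obtain ⟨j, hj, rfl⟩ := hbv
    exact ⟨j, hj, fun hh => hbi (by rw [hh]), r, hr, hrb.symm⟩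
  obtain ⟨p, hp, -, r, hr, hpr⟩ := key 0 (Nat.zero_le _)
  obtain ⟨q, hq, hqp, s, hs, hqs⟩ := key p hp
  rcases lt_or_gt_of_ne hqp with hlt | hlt
  · exact ⟨q, p, s, r, hlt, hp, hs, hr, hqs, hpr⟩
  · exact ⟨p, q, r, s, hlt, hq, hr, hs, hpr, hqs⟩

theorem exists_closed_of_attached_le (h : LongPath G A B v K) (hc : Conn2 G (A ∪ B)) {t : ℕ}
    (hdeg : ∀ x ∈ A, ∀ y ∈ B, t + 1 ≤ dg G B x + dg G A y) {z : V}
    (hend : ∀ r ∈ outer G (verts v K) z, ∃ Q u, PathList G Q r u ∧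
      (∀ s ∈ Q, s ∉ verts v K) ∧ u ∈ A ∧ ∀ y, G.Adj u y → y ∉ verts v K → y ∈ Q) {p : ℕ} (hp : p ≤ K)
    {r : V} (hr : r ∈ outer G (verts v K) z) (hpr : G.Adj (v p) r)
    (hmax : ∀ q ≤ K, ∀ s ∈ outer G (verts v K) z, G.Adj (v q) s → q ≤ p)
    (h0 : ∀ i ∈ nbIdx G v K (v 0), i ≤ p) : ∃ L, ClosedList G L ∧ 2 * t ≤ L.length := by
  obtain ⟨Q, u, hQ, hoff, hu, hN⟩ := hend r hr
  have huR := mem_outer_of_path hr hQ hoff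
  obtain ⟨L, hL, hlen⟩ := h.exists_of_end hc ⟨hp, ⟨r, hQ, hpr⟩, hoff⟩ hu h0 (by
    intro y hy
    by_cases hyv : y ∈ verts v K
    · obtain ⟨i, hi, rfl⟩ := hyv
      exact Or.inr ⟨i, hmax i hi u huR hy.symm, rfl⟩
    · exact Or.inl (hN y hy hyv))
  have := hdeg u hu _ h.zero
  exact ⟨L, hL, by omega⟩

theorem exists_closed (h : LongPath G A B v K) (hc : Conn2 G (A ∪ B)) (hcard : A.card = B.card)
    {t : ℕ} (hdeg : ∀ x ∈ A, ∀ y ∈ B, t + 1 ≤ dg G B x + dg G A y) :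
    ∃ L, ClosedList G L ∧ 2 * t ≤ L.length := by
  obtain ⟨z, hz, hzv, hend⟩ := h.exists_outer_end hcard
  have hK := h.two_le (fun x hx y hy => le_trans (by omega) (hdeg x hx y hy)) ⟨z, hz⟩
  obtain ⟨p₁, p₂, r₁, r₂, hp12, hp2K, hr₁, hr₂, hpr₁, hpr₂⟩ :=
    h.exists_two_attached hc (by omega) hz hzv
  set R := outer G (verts v K) z with hR
  let Att : Finset ℕ := (range (K + 1)).filter fun p => ∃ r ∈ R, G.Adj (v p) r
  have hAtt : ∀ {p}, p ∈ Att ↔ p ≤ K ∧ ∃ r ∈ R, G.Adj (v p) r := by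
    intro p; simp [Att]
  have hp₁ : p₁ ∈ Att := hAtt.2 ⟨by omega, r₁, hr₁, hpr₁⟩
  have hp₂ : p₂ ∈ Att := hAtt.2 ⟨hp2K, r₂, hr₂, hpr₂⟩
  have hI0 : 1 ∈ nbIdx G v K (v 0) := mem_nbIdx.2 ⟨by omega, h.path.adj 0 (by omega)⟩
  have hIK : K - 1 ∈ nbIdx G v K (v K) := by
    refine mem_nbIdx.2 ⟨by omega, ?_⟩
    have := (h.path.adj (K - 1) (by omega)).symm
    rwa [show K - 1 + 1 = K by omega] at this
  let f := (nbIdx G v K (v 0)).max' ⟨_, hI0⟩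
  let g := (nbIdx G v K (v K)).min' ⟨_, hIK⟩
  have hf : f ∈ nbIdx G v K (v 0) := Finset.max'_mem _ _
  have hg : g ∈ nbIdx G v K (v K) := Finset.min'_mem _ _
  have hfmax : ∀ i ∈ nbIdx G v K (v 0), i ≤ f := fun i hi => Finset.le_max' _ i hi
  have hgmin : ∀ i ∈ nbIdx G v K (v K), g ≤ i := fun i hi => Finset.min'_le _ i hi
  by_cases hf1 : f ≤ Att.max' ⟨_, hp₁⟩
  · obtain ⟨h1, r, hr, hpr⟩ := hAtt.1 (Att.max'_mem ⟨_, hp₁⟩)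
    exact h.exists_closed_of_attached_le hc hdeg hend h1 hr hpr
      (fun q hq s hs hqs => Finset.le_max' _ _ (hAtt.2 ⟨hq, s, hs, hqs⟩))
      (fun i hi => (hfmax i hi).trans hf1)
  by_cases hg1 : Att.min' ⟨_, hp₁⟩ ≤ g
  · obtain ⟨h1, r, hr, hpr⟩ := hAtt.1 (Att.min'_mem ⟨_, hp₁⟩)
    refine h.flip.exists_closed_of_attached_le (z := z) (p := K - Att.min' ⟨_, hp₁⟩) hc hdeg
      (by rw [verts_flip]; exact hend) (by omega) (r := r) (by rw [verts_flip]; exact hr)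
      (by rwa [show K - (K - Att.min' ⟨_, hp₁⟩) = Att.min' ⟨_, hp₁⟩ by omega]) ?_ ?_
    · intro q hq s hs hqs
      rw [verts_flip] at hs
      have := Finset.min'_le Att _ (hAtt.2 ⟨Nat.sub_le K q, s, hs, hqs⟩)
      omega
    · intro i hi
      obtain ⟨h2, h3⟩ := mem_nbIdx_flip.1 hi
      have := hgmin _ (by simpa using h3)
      omega
  have hAf : ∀ p ∈ Att, p < f := fun p hp => by
    have := Finset.le_max' _ _ hp; omega
  have hAg : ∀ p ∈ Att, g < p := fun p hp => by
    have := Finset.min'_le _ _ hp; omega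
  obtain ⟨i, s, hgap⟩ := exists_gap ((hAg _ hp₁).trans (hAf _ hp₁)) hg hf
  by_contra hno
  have hno' : ∀ L, ClosedList G L → L.length < 2 * t := by
    intro L hL
    by_contra hcon
    exact hno ⟨L, hL, by omega⟩
  have hda : ∀ u ∈ A, t + 1 ≤ dg G B u + (nbIdx G v K (v 0)).card := fun u hu => by
    rw [h.card_nb_zero]; exact hdeg u hu _ h.zero
  have hdb : ∀ u ∈ A, t + 1 ≤ dg G B u + (nbIdx G v K (v K)).card := fun u hu => by
    rw [h.card_nb_last]; exact hdeg u hu _ h.last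
  have hJ : ∀ u ∈ R, nbIdx G v K u ⊆ Att := fun u hu j hj =>
    hAtt.2 ⟨(mem_nbIdx.1 hj).1, u, hu, (mem_nbIdx.1 hj).2.symm⟩
  have hone : ∀ x ∈ R, x ∈ A → (nbIdx G v K x).card ≤ 1 := by
    intro x hx hxA
    obtain ⟨Q, u, hQ, hoff, hu, hN⟩ := hend x hx
    have huR := mem_outer_of_path hx hQ hoff
    obtain ⟨hlen, -⟩ := hQ.length_eq h.bip
    have hlen := hlen hxA hu
    have hle := dg_le (B := B) hN
    have h1 := hda u hu
    have h2 := hdb u hu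
    have hu1 : (nbIdx G v K u).card ≤ 1 := by
      by_contra hcon
      obtain ⟨L, hL, h3⟩ := h.exists_of_two_le hgap hQ.reverse
        (fun s hs => hoff s (List.mem_reverse.1 hs)) hu hxA hf
        (fun j hj => hAf j (hJ u huR hj)) hg (fun j hj => hAg j (hJ u huR hj)) (by omega)
      have h4 := hno' L hL
      rw [cnt_perm (List.reverse_perm Q)] at h3
      omega
    by_contra hcon
    obtain ⟨L, hL, h3⟩ := h.exists_of_two_le hgap hQ hoff hxA hu hf
        (fun j hj => hAf j (hJ x hx hj)) hg (fun j hj => hAg j (hJ x hx hj)) (by omega)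
    have h4 := hno' L hL
    omega
  have hatt : ∀ p ∈ Att, ∃ Q u, Attached G v K p Q u ∧ u ∈ A ∧
      t ≤ (nbIdx G v K (v 0)).card + cnt A Q ∧ t ≤ (nbIdx G v K (v K)).card + cnt A Q := by
    intro p hp
    obtain ⟨hpK, r, hr, hpr⟩ := hAtt.1 hp
    obtain ⟨Q, u, hQ, hoff, hu, hN⟩ := hend r hr
    have h1 := hone u (mem_outer_of_path hr hQ hoff) hu
    have hle := dg_le (B := B) hN
    have h2 := hda u hu
    have h3 := hdb u hu
    obtain ⟨i1, -, i3, -⟩ := hQ.length_eq h.bip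
    have h4 : cnt B Q ≤ cnt A Q := by
      rcases h.bip.adj _ _ hpr with ⟨-, hrB⟩ | ⟨-, hrA⟩
      · have := i3 hrB hu; omega
      · have := i1 hrA hu; omega
    exact ⟨Q, u, ⟨hpK, ⟨r, hQ, hpr⟩, hoff⟩, hu, by omega, by omega⟩
  have hin : ∀ p ∈ Att, i < p ∧ p < s := by
    intro p hp
    obtain ⟨Q, u, hQ, hu, h1, h2⟩ := hatt p hp
    constructor
    · by_contra hcon
      obtain ⟨L, hL, h3⟩ := h.exists_of_attached_below hgap hQ hu (by omega) hg (hAg p hp)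
      have := hno' L hL
      omega
    · by_contra hcon
      obtain ⟨L, hL, h3⟩ := h.exists_of_attached_above hgap hQ hu (by omega) hf (hAf p hp)
      have := hno' L hL
      omega
  obtain ⟨Q, u, hQ, hu, h1, h2⟩ := hatt p₂ hp₂
  obtain ⟨D, hD, hDoff⟩ := exists_path_of_mem_outer hr₁ hr₂
  have hne : v p₁ ≠ v p₂ := fun hh => by
    have := h.path.inj _ _ (by omega) hp2K hh; omega
  have hD' : PathList G (v p₁ :: (D ++ [v p₂])) (v p₁) (v p₂) := by
    refine (hD.concat hpr₂.symm fun hh => hDoff _ hh (mem_verts hp2K)).cons hpr₁ ?_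
    simp only [List.mem_append, List.mem_singleton, not_or]
    exact ⟨fun hh => hDoff _ hh (mem_verts (by omega)), hne⟩
  obtain ⟨L, hL, h3⟩ := h.exists_of_bridge hgap hQ hu (hin p₂ hp₂).2 hf (hAf p₂ hp₂)
    (hin p₁ hp₁).1 hp12 hD' hDoff
  have := hno' L hL
  omega

end LongPath

end LongestPath

section Balanced

open scoped Classical

variable {V : Type} {G : SimpleGraph V} {A B : Finset V}

theorem IsBip.mem_union (hG : IsBip G A B) {x y : V} (h : G.Adj x y) : x ∈ A ∪ B := by
  rcases hG.adj _ _ h with h | h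
  · exact Finset.mem_union_left _ h.1
  · exact Finset.mem_union_right _ h.1

theorem PathList.last_mem_union (hG : IsBip G A B) {l : List V} {a b : V} (h : PathList G l a b)
    (ha : a ∈ A ∪ B) : b ∈ A ∪ B := by
  rcases h.reverse.cases with ⟨-, rfl⟩ | ⟨l, c, -, hc, -, -⟩
  · exact ha
  · exact hG.mem_union hc

theorem PathList.length_le_of_bip (hG : IsBip G A B) {l : List V} {a b : V} (h : PathList G l a b)
    (ha : a ∈ A ∪ B) : l.length ≤ 2 * A.card + 1 := by
  obtain ⟨i1, i2, i3, i4⟩ := h.length_eq hG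
  have hcnt := cnt_le (A := A) (l := l)
  rcases Finset.mem_union.1 ha with ha | ha <;>
    rcases Finset.mem_union.1 (h.last_mem_union hG ‹_›) with hb | hb
  · have := i1 ha hb; omega
  · have := i2 ha hb; omega
  · have := i3 ha hb; omega
  · have := i4 ha hb; omega

/-- The case of a longest path with an even number of vertices. -/
theorem exists_closed_of_max_path (hG : IsBip G A B) (hc : Conn2 G (A ∪ B))
    (hcard : A.card = B.card) {t : ℕ} (ht : t ≤ A.card)
    (hdeg : ∀ x ∈ A, ∀ y ∈ B, t + 1 ≤ dg G B x + dg G A y) {l : List V} {a b : V}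
    (hl : PathList G l a b) (ha : a ∈ A) (hb : b ∈ B)
    (hmax : ∀ L a b, PathList G L a b → L.length ≤ l.length) :
    ∃ L, ClosedList G L ∧ 2 * t ≤ L.length := by
  obtain ⟨v, k, hv, hlv, rfl, rfl⟩ := hl.exists_pathFun
  have hmem : ∀ x, x ∈ verts v k ↔ x ∈ l := by
    intro x; rw [hlv, mem_seg]
    exact ⟨fun ⟨i, hi, hx⟩ => ⟨i, Nat.zero_le _, hi, hx⟩, fun ⟨i, _, hi, hx⟩ => ⟨i, hi, hx⟩⟩
  have hend : ∀ {l a b}, PathList G l a b → (∀ L a b, PathList G L a b → L.length ≤ l.length) →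
      ∀ x, G.Adj a x → x ∈ l := by
    intro l a b hl hmax x hx
    by_contra hxl
    have := hmax _ _ _ (hl.cons hx.symm hxl)
    simp at this
  obtain ⟨L, hL, hfull | hlen⟩ := exists_closed_of_ends hG hc hv ha hb
    (fun x hx => (hmem x).2 (hend hl hmax x hx))
    (fun x hx => (hmem x).2 (by
      have := hend hl.reverse (by simpa using hmax) x hx
      simpa using this))
  · refine ⟨L, hL, ?_⟩
    by_contra hcon
    have hex : ∀ C : Finset V, t ≤ C.card → cnt C L < t → ∃ z ∈ C, z ∉ L := by
      intro C h1 h2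
      by_contra! hno
      have := le_cnt (Finset.Subset.refl C) hno
      omega
    obtain ⟨h1, h2⟩ := hL.length_eq hG
    obtain ⟨z, hz, hzL⟩ := hex A ht (by omega)
    obtain ⟨w, hw, hwL⟩ := hex B (by omega) (by omega)
    obtain ⟨r, hr, c, hcL, -, hrc⟩ := hc {x | x ∈ L} z ⟨v 0, (hfull _).2 (mem_verts (Nat.zero_le _))⟩
      (by
        intro x hx
        obtain ⟨L', y, -, hyx, -⟩ := hL.open_at hx
        exact (hG.mem_union hyx.symm)) hzL
      ⟨w, Finset.mem_union_right _ hw, hwL, by rintro rfl; exact hG.not_mem_right hz hw⟩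
    obtain ⟨L', y, hL', -, hperm⟩ := hL.open_at hr
    have hlen := hmax _ _ _ (hL'.cons hrc.symm fun hh => hcL (hperm.mem_iff.2 hh))
    have hperm2 : L.Perm l := by
      rw [List.perm_ext_iff_of_nodup hL.nodup hl.nodup]
      intro x; rw [hfull, hmem]
    have := (hperm.symm.trans hperm2).length_eq
    simp [this] at hlen
  · have := hdeg _ ha _ hb
    exact ⟨L, hL, by omega⟩

theorem exists_max_path (hG : IsBip G A B) (hne : A.Nonempty) :
    ∃ l a b, PathList G l a b ∧ a ∈ A ∪ B ∧ ∀ L c d, PathList G L c d → L.length ≤ l.length := by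
  obtain ⟨x₀, hx₀⟩ := hne
  obtain ⟨l, ⟨a, b, hl, ha⟩, hmax⟩ := exists_longest
    (p := fun l => ∃ a b, PathList G l a b ∧ a ∈ A ∪ B) (2 * A.card + 1)
    ⟨[x₀], x₀, x₀, PathList.singleton _, Finset.mem_union_left _ hx₀⟩
    (fun l ⟨a, b, hl, ha⟩ => hl.length_le_of_bip hG ha)
  refine ⟨l, a, b, hl, ha, fun L c d hL => ?_⟩
  rcases hL.cases with ⟨rfl, -⟩ | ⟨l', e, rfl, he, -⟩
  · exact hl.length_pos
  · exact hmax _ ⟨c, d, hL, hG.mem_union he⟩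

/-- A balanced bipartite graph without cut vertices in which the degree sum of any two vertices
from different classes exceeds `t` has a cycle of length at least `2 * t`. -/
theorem exists_closed_of_conn2 (hG : IsBip G A B) (hc : Conn2 G (A ∪ B))
    (hcard : A.card = B.card) {t : ℕ} (ht1 : 1 ≤ t) (ht : t ≤ A.card)
    (hdeg : ∀ x ∈ A, ∀ y ∈ B, t + 1 ≤ dg G B x + dg G A y) :
    ∃ L, ClosedList G L ∧ 2 * t ≤ L.length := by
  obtain ⟨l, a, b, hl, ha, hmax'⟩ := exists_max_path hG (Finset.card_pos.1 (by omega))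
  have hb := hl.last_mem_union hG ha
  have hc' : Conn2 G (B ∪ A) := by rwa [Finset.union_comm]
  have key : ∀ {C D : Finset V}, IsBip G C D → Conn2 G (C ∪ D) → C.card = D.card →
      (∀ x ∈ C, ∀ y ∈ D, t + 1 ≤ dg G D x + dg G C y) → a ∈ D → b ∈ D →
      ∃ L, ClosedList G L ∧ 2 * t ≤ L.length := by
    intro C D hCD hc hcard hdeg ha hb
    obtain ⟨v, k, hv, hlv, rfl, rfl⟩ := hl.exists_pathFun
    refine LongPath.exists_closed (v := v) (K := k) ⟨hCD, hv, ha, ?_, ?_⟩ hc hcard hdeg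
    · by_contra hcon
      exact hCD.not_mem_right ((hv.parity hCD.symm ha k le_rfl).2 (by omega)) hb
    · simpa [hlv] using hmax'
  rcases Finset.mem_union.1 ha with ha | ha <;> rcases Finset.mem_union.1 hb with hb | hb
  · exact key hG.symm hc' hcard.symm (fun x hx y hy => (hdeg y hy x hx).trans_eq (add_comm _ _)) ha hb
  · exact exists_closed_of_max_path hG hc hcard ht hdeg hl ha hb hmax'
  · exact exists_closed_of_max_path hG hc hcard ht hdeg hl.reverse hb ha (by simpa using hmax')
  · exact key hG hc hcard hdeg ha hb

end Balanced

section Cycles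

open scoped Classical

variable {V : Type} {G : SimpleGraph V} {A B : Finset V}

theorem PathFun.dg_eq {v : ℕ → V} {k : ℕ} (h : PathFun G v k) (C : Finset V) {y : V}
    (hC : ∀ x, G.Adj y x → x ∈ C) :
    dg G C y = dg G (C.filter (· ∉ verts v k)) y + (nbIdx G v k y).card := by
  have h1 : ((nbIdx G v k y).image v).card = (nbIdx G v k y).card := by
    refine Finset.card_image_of_injOn fun i hi j hj hij => ?_
    exact h.inj _ _ (mem_nbIdx.1 hi).1 (mem_nbIdx.1 hj).1 hij
  rw [← h1, dg, dg, ← Finset.card_union_of_disjoint]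
  · congr 1
    ext x
    simp only [Finset.mem_filter, Finset.mem_union, Finset.mem_image, mem_nbIdx]
    constructor
    · rintro ⟨h2, h3⟩
      by_cases h4 : x ∈ verts v k
      · obtain ⟨i, hi, rfl⟩ := h4
        exact Or.inr ⟨i, ⟨hi, h3⟩, rfl⟩
      · exact Or.inl ⟨⟨h2, h4⟩, h3⟩
    · rintro (⟨⟨h2, -⟩, h3⟩ | ⟨i, ⟨hi, h2⟩, rfl⟩)
      · exact ⟨h2, h3⟩
      · exact ⟨hC _ h2, h2⟩
  · rw [Finset.disjoint_left]
    intro x hx hx'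
    obtain ⟨i, hi, rfl⟩ := Finset.mem_image.1 hx'
    exact (Finset.mem_filter.1 (Finset.mem_filter.1 hx).1).2 (mem_verts (mem_nbIdx.1 hi).1)

theorem card_off_verts {v : ℕ → V} {k : ℕ} (C : Finset V) :
    (C.filter (· ∉ verts v k)).card + cnt C (seg v 0 k) = C.card := by
  have h1 := Finset.card_filter_add_card_filter_not (s := C) (· ∉ verts v k)
  have h2 : cnt C (seg v 0 k) = (C.filter fun x => ¬ x ∉ verts v k).card := by
    unfold cnt
    congr 1
    ext x
    simp [mem_seg, verts]
  omega

/-- `v 0, v 1, …, v (2 * c - 1)` is a closed path whose first vertex lies in `A`. -/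
structure CycFun {V : Type} (G : SimpleGraph V) (A : Finset V) (v : ℕ → V) (c : ℕ) : Prop where
  path : PathFun G v (2 * c - 1)
  close : G.Adj (v (2 * c - 1)) (v 0)
  zero : v 0 ∈ A
  pos : 1 ≤ c

theorem ClosedList.exists_cycFun (hG : IsBip G A B) {L : List V} (hL : ClosedList G L) {x : V}
    (hx : x ∈ L) (hxA : x ∈ A) : ∃ v c, CycFun G A v c ∧ L.length = 2 * c ∧ v 0 = x ∧
      ∀ y, y ∈ L ↔ y ∈ verts v (2 * c - 1) := by
  obtain ⟨L', y, hL', hyx, hperm⟩ := hL.open_at hx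
  obtain ⟨v, k, hv, rfl, rfl, rfl⟩ := hL'.exists_pathFun
  obtain ⟨h1, -⟩ := hL.length_eq hG
  have h2 := hperm.length_eq
  rw [length_seg] at h2
  have hk : k = 2 * cnt A L - 1 := by omega
  rw [hk] at hv hyx
  refine ⟨v, cnt A L, ⟨hv, hyx, hxA, by omega⟩, h1, rfl, fun y => ?_⟩
  rw [hperm.mem_iff, mem_seg, ← hk]
  exact ⟨fun ⟨i, _, hi, hx⟩ => ⟨i, hi, hx⟩, fun ⟨i, hi, hx⟩ => ⟨i, Nat.zero_le _, hi, hx⟩⟩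

namespace CycFun

variable {v : ℕ → V} {c : ℕ}

theorem parity (hG : IsBip G A B) (h : CycFun G A v c) {i : ℕ} (hi : i ≤ 2 * c - 1) :
    (i % 2 = 0 → v i ∈ A) ∧ (i % 2 = 1 → v i ∈ B) :=
  h.path.parity hG h.zero i hi

theorem even_of_adj (hG : IsBip G A B) (h : CycFun G A v c) {y : V} (hy : y ∈ B) {i : ℕ}
    (hi : i ∈ nbIdx G v (2 * c - 1) y) : i % 2 = 0 := by
  obtain ⟨hi, hyi⟩ := mem_nbIdx.1 hi
  by_contra hcon
  exact hG.not_mem_left ((h.parity hG hi).2 (by omega)) (hG.left_of_right hy hyi)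

theorem odd_of_adj (hG : IsBip G A B) (h : CycFun G A v c) {y : V} (hy : y ∈ A) {i : ℕ}
    (hi : i ∈ nbIdx G v (2 * c - 1) y) : i % 2 = 1 := by
  obtain ⟨hi, hyi⟩ := mem_nbIdx.1 hi
  by_contra hcon
  exact hG.not_mem_right ((h.parity hG hi).1 (by omega)) (hG.right_of_left hy hyi)

theorem closed (h : CycFun G A v c) : ClosedList G (seg v 0 (2 * c - 1)) :=
  ⟨_, _, h.path.seg (Nat.zero_le _) le_rfl, h.close⟩

theorem length_seg (h : CycFun G A v c) : (seg v 0 (2 * c - 1)).length = 2 * c := by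
  have := h.pos
  rw [_root_.length_seg]; omega

/-- Replace the vertices between `v i` and `v j` by another path. -/
theorem insert (h : CycFun G A v c) {i j : ℕ} (hij : i < j) (hj : j ≤ 2 * c - 1) {D : List V}
    {x y : V} (hD : PathList G D x y) (hoff : ∀ s ∈ D, s ∉ verts v (2 * c - 1))
    (hx : G.Adj x (v i)) (hy : G.Adj y (v j)) :
    ∃ L, ClosedList G L ∧ L.length + j = 2 * c + D.length + (i + 1) := by
  refine ⟨seg v 0 i ++ D ++ seg v j (2 * c - 1), ⟨_, _, ((h.path.seg (Nat.zero_le i)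
    (by omega)).append hD hx.symm ?_).append (h.path.seg hj le_rfl) hy ?_, h.close⟩, ?_⟩
  · intro s hs hsD
    obtain ⟨p, -, hp, rfl⟩ := mem_seg.1 hs
    exact hoff _ hsD (mem_verts (by omega))
  · intro s hs hs'
    obtain ⟨q, hq, hq', rfl⟩ := mem_seg.1 hs'
    rcases List.mem_append.1 hs with hs | hs
    · obtain ⟨p, -, hp, hpq⟩ := mem_seg.1 hs
      have := h.path.inj _ _ (by omega) hq' hpq
      omega
    · exact hoff _ hs (mem_verts hq')
  · simp; omega

/-- Close up the part of the cycle between `v i` and `v j` by another path. -/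
theorem insert_wrap (h : CycFun G A v c) {i j : ℕ} (hij : i ≤ j) (hj : j ≤ 2 * c - 1)
    {D : List V} {x y : V} (hD : PathList G D x y) (hoff : ∀ s ∈ D, s ∉ verts v (2 * c - 1))
    (hx : G.Adj x (v j)) (hy : G.Adj y (v i)) :
    ∃ L, ClosedList G L ∧ L.length + i = j + 1 + D.length := by
  refine ⟨seg v i j ++ D, ⟨_, _, (h.path.seg hij hj).append hD hx.symm ?_, hy⟩, ?_⟩
  · intro s hs hsD
    obtain ⟨p, -, hp, rfl⟩ := mem_seg.1 hs
    exact hoff _ hsD (mem_verts (by omega))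
  · simp; omega

/-- Extend a closed path by two vertices, one adjacent to `v i` and `v j`, the other to their
successors. -/
theorem two_chord (h : CycFun G A v c) {i j : ℕ} (hij : i < j) (hj : j < 2 * c - 1) {x y : V}
    (hx : x ∉ verts v (2 * c - 1)) (hy : y ∉ verts v (2 * c - 1)) (hxy : x ≠ y)
    (hxi : G.Adj x (v i)) (hxj : G.Adj x (v j)) (hyi : G.Adj y (v (i + 1)))
    (hyj : G.Adj y (v (j + 1))) : ∃ L, ClosedList G L ∧ L.length = 2 * c + 2 := by
  have h1 := (h.path.seg (show i + 1 ≤ j by omega) hj.le).concat hxj.symm (by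
    rw [mem_seg]; rintro ⟨p, -, hp, rfl⟩; exact hx (mem_verts (by omega)))
  have h2 := (h.path.seg (show j + 1 ≤ 2 * c - 1 by omega) le_rfl).append
    (h.path.seg (Nat.zero_le i) (by omega)) h.close (by
      intro s hs hs'
      obtain ⟨p, hp, hp', rfl⟩ := mem_seg.1 hs
      obtain ⟨q, -, hq, hqp⟩ := mem_seg.1 hs'
      have := h.path.inj _ _ (by omega) hp' hqp
      omega)
  have h3 := h1.append h2.reverse hxi (by
    intro s hs hs'
    rw [List.mem_reverse, List.mem_append, mem_seg, mem_seg] at hs'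
    rw [List.mem_append, mem_seg, List.mem_singleton] at hs
    have hs'' : ∃ q, (q ≤ i ∨ j < q) ∧ q ≤ 2 * c - 1 ∧ v q = s := by
      rcases hs' with ⟨q, a, b, e⟩ | ⟨q, a, b, e⟩
      · exact ⟨q, Or.inr (by omega), b, e⟩
      · exact ⟨q, Or.inl b, by omega, e⟩
    obtain ⟨q, hq, hq', rfl⟩ := hs''
    rcases hs with ⟨p, hp, hp', hpq⟩ | hs
    · have := h.path.inj _ _ (by omega) hq' hpq
      omega
    · exact hx (hs ▸ mem_verts hq'))
  have h4 := h3.concat hyj.symm (by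
    intro hs
    rw [List.mem_append, List.mem_append, List.mem_reverse, List.mem_append, mem_seg, mem_seg,
      mem_seg, List.mem_singleton] at hs
    rcases hs with (⟨p, -, hp, rfl⟩ | rfl) | ⟨p, -, hp, rfl⟩ | ⟨p, -, hp, rfl⟩
    · exact hy (mem_verts (by omega))
    · exact hxy rfl
    · exact hy (mem_verts hp)
    · exact hy (mem_verts (by omega)))
  refine ⟨_, ⟨_, _, h4, hyi⟩, ?_⟩
  simp
  omega

theorem card_off (hG : IsBip G A B) (h : CycFun G A v c) :
    (A.filter (· ∉ verts v (2 * c - 1))).card + c = A.card ∧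
      (B.filter (· ∉ verts v (2 * c - 1))).card + c = B.card := by
  obtain ⟨h1, h2⟩ := h.closed.length_eq hG
  rw [h.length_seg] at h1 h2
  have h3 := card_off_verts (v := v) (k := 2 * c - 1) A
  have h4 := card_off_verts (v := v) (k := 2 * c - 1) B
  omega

theorem card_nbIdx_le (hG : IsBip G A B) (h : CycFun G A v c) {y : V} (hy : y ∈ A ∪ B) :
    (nbIdx G v (2 * c - 1) y).card ≤ c := by
  have : (nbIdx G v (2 * c - 1) y).card ≤ (range c).card := by
    refine Finset.card_le_card_of_injOn (fun i => i / 2) ?_ ?_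
    · intro i hi
      have := (mem_nbIdx.1 hi).1
      have := h.pos
      rw [Finset.mem_coe, Finset.mem_range]
      dsimp only
      omega
    · intro i hi j hj hij
      simp only at hij
      rcases Finset.mem_union.1 hy with hy | hy
      · have := h.odd_of_adj hG hy hi
        have := h.odd_of_adj hG hy hj
        omega
      · have := h.even_of_adj hG hy hi
        have := h.even_of_adj hG hy hj
        omega
  simpa using this

end CycFun

theorem dg_add_dg_le {C : Finset V} {x y : V} :
    dg G C x + dg G C y ≤ C.card + (C.filter fun z => G.Adj x z ∧ G.Adj y z).card := by
  have h1 := Finset.card_union_add_card_inter (C.filter (G.Adj x)) (C.filter (G.Adj y))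
  rw [← Finset.filter_and] at h1
  have h2 : (C.filter (G.Adj x) ∪ C.filter (G.Adj y)).card ≤ C.card :=
    Finset.card_le_card (Finset.union_subset (Finset.filter_subset _ _) (Finset.filter_subset _ _))
  unfold dg
  omega

/-- If all the degrees in `B` exceed half of `A.card`, every cycle that misses a vertex of `B`
can be prolonged. -/
theorem exists_closed_succ (hG : IsBip G A B) {t : ℕ} (hA : A.card + 2 ≤ 2 * t)
    (hB : t ≤ B.card) (hdeg : ∀ y ∈ B, t ≤ dg G A y) {c : ℕ} (hc : 2 ≤ c) (hct : c < t)
    {L : List V} (hL : ClosedList G L) (hlen : L.length = 2 * c) :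
    ∃ L, ClosedList G L ∧ L.length = 2 * (c + 1) := by
  obtain ⟨x, hx, hxA⟩ : ∃ x ∈ L, x ∈ A := by
    by_contra! hno
    have h1 := (hL.length_eq hG).1
    have : cnt A L = 0 := Finset.card_eq_zero.2 (Finset.filter_eq_empty_iff.2 fun x h1 h2 => hno x h2 h1)
    omega
  obtain ⟨v, c', h, hlen', -, -⟩ := hL.exists_cycFun hG hx hxA
  obtain rfl : c' = c := by omega
  obtain ⟨ho1, ho2⟩ := h.card_off hG
  set O := A.filter (· ∉ verts v (2 * c' - 1)) with hO
  have hoff : ∀ {z}, z ∈ O → z ∈ A ∧ z ∉ verts v (2 * c' - 1) := fun hz => Finset.mem_filter.1 hz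
  have hsplit : ∀ y ∈ B, t ≤ dg G O y + (nbIdx G v (2 * c' - 1) y).card := by
    intro y hy
    rw [← h.path.dg_eq A (fun x hx => hG.left_of_right hy hx)]
    exact hdeg y hy
  obtain ⟨u, hu⟩ : (B.filter (· ∉ verts v (2 * c' - 1))).Nonempty :=
    Finset.card_pos.1 (by omega)
  obtain ⟨huB, huv⟩ := Finset.mem_filter.1 hu
  have hcyc : ∀ i ≤ 2 * c' - 1, i % 2 = 1 → v i ∈ B ∧ t ≤ dg G O (v i) + c' := by
    intro i hi hi2
    have h1 := (h.parity hG hi).2 hi2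
    have h2 := h.card_nbIdx_le hG (Finset.mem_union_right A h1)
    have h3 := hsplit _ h1
    exact ⟨h1, by omega⟩
  rcases (nbIdx G v (2 * c' - 1) u).eq_empty_or_nonempty with hN | hN
  · have h1 := hsplit u huB
    rw [hN, Finset.card_empty] at h1
    have hcommon : ∀ i ≤ 2 * c' - 1, i % 2 = 1 →
        1 < (O.filter fun z => G.Adj u z ∧ G.Adj (v i) z).card := by
      intro i hi hi2
      have h2 := (hcyc i hi hi2).2
      have h3 := dg_add_dg_le (G := G) (C := O) (x := u) (y := v i)
      omega
    have hcommon1 := hcommon 1 (by omega) rfl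
    obtain ⟨z, hz⟩ := Finset.card_pos.1 (zero_lt_one.trans hcommon1)
    obtain ⟨z', hz', hne⟩ := Finset.exists_mem_ne
      (hcommon (2 * c' - 1) le_rfl (by omega)) z
    obtain ⟨hzO, hz1, hz2⟩ := Finset.mem_filter.1 hz
    obtain ⟨hzO', hz1', hz2'⟩ := Finset.mem_filter.1 hz'
    have huA : u ∉ A := hG.not_mem_left huB
    have hD : PathList G [z', u, z] z' z := ((PathList.singleton z).cons hz1 (by
      rw [List.mem_singleton]; rintro rfl; exact huA (hoff hzO).1)).cons hz1'.symm (by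
      rw [List.mem_pair, not_or]; exact ⟨hz1'.ne', hne⟩)
    refine ⟨_, ⟨_, _, (h.path.seg (show 1 ≤ 2 * c' - 1 by omega) le_rfl).append hD hz2' ?_,
      hz2.symm⟩, ?_⟩
    · intro s hs hsD
      obtain ⟨p, -, hp, rfl⟩ := mem_seg.1 hs
      have hpv := mem_verts (v := v) hp
      simp only [List.mem_cons, List.not_mem_nil, or_false] at hsD
      rcases hsD with e | e | e
      · exact (hoff hzO').2 (e ▸ hpv)
      · exact huv (e ▸ hpv)
      · exact (hoff hzO).2 (e ▸ hpv)
    · simp; omega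
  by_contra hno
  have hdisj : ∀ i ∈ nbIdx G v (2 * c' - 1) u, ∀ z ∈ O, G.Adj u z → G.Adj (v (i + 1)) z → False := by
    intro i hi z hz h1 h2
    have := h.even_of_adj hG huB hi
    obtain ⟨hi, hadj⟩ := mem_nbIdx.1 hi
    obtain ⟨L, hL, hlen⟩ := h.insert (Nat.lt_succ_self i) (show i + 1 ≤ 2 * c' - 1 by omega)
      ((PathList.singleton z).cons h1 (by simpa using h1.ne)) (by
        intro s hs
        rcases List.mem_pair.1 hs with rfl | rfl
        · exact huv
        · exact (hoff hz).2) hadj h2.symm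
    exact hno ⟨L, hL, by simp at hlen; omega⟩
  have hdisj' : ∀ i ∈ nbIdx G v (2 * c' - 1) u, ∀ j ∈ nbIdx G v (2 * c' - 1) u, i < j →
      ∀ z ∈ O, G.Adj (v (i + 1)) z → G.Adj (v (j + 1)) z → False := by
    intro i hi j hj hij z hz h1 h2
    have := h.even_of_adj hG huB hj
    obtain ⟨hi, hadj⟩ := mem_nbIdx.1 hi
    obtain ⟨hj, hadj'⟩ := mem_nbIdx.1 hj
    obtain ⟨L, hL, hlen⟩ := h.two_chord hij (show j < 2 * c' - 1 by omega) huv (hoff hz).2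
      (by rintro rfl; exact hG.not_mem_left huB (hoff hz).1) hadj hadj' h1.symm h2.symm
    exact hno ⟨L, hL, by omega⟩
  have hU : ((nbIdx G v (2 * c' - 1) u).biUnion fun i => O.filter (G.Adj (v (i + 1)))).card =
      ∑ i ∈ nbIdx G v (2 * c' - 1) u, dg G O (v (i + 1)) := by
    refine Finset.card_biUnion fun i hi j hj hij => ?_
    rw [Function.onFun, Finset.disjoint_left]
    intro z hz hz'
    obtain ⟨h1, h2⟩ := Finset.mem_filter.1 hz
    obtain ⟨-, h3⟩ := Finset.mem_filter.1 hz'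
    rcases lt_or_gt_of_ne hij with hlt | hlt
    · exact hdisj' i hi j hj hlt z h1 h2 h3
    · exact hdisj' j hj i hi hlt z h1 h3 h2
  have hsum : (nbIdx G v (2 * c' - 1) u).card * (t - c') ≤
      ∑ i ∈ nbIdx G v (2 * c' - 1) u, dg G O (v (i + 1)) := by
    rw [← smul_eq_mul]
    refine Finset.card_nsmul_le_sum _ _ _ fun i hi => ?_
    have := h.even_of_adj hG huB hi
    have := (mem_nbIdx.1 hi).1
    have := (hcyc (i + 1) (by omega) (by omega)).2
    omega
  have hdis : Disjoint (O.filter (G.Adj u))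
      ((nbIdx G v (2 * c' - 1) u).biUnion fun i => O.filter (G.Adj (v (i + 1)))) := by
    rw [Finset.disjoint_left]
    intro z hz hz'
    obtain ⟨h1, h2⟩ := Finset.mem_filter.1 hz
    obtain ⟨i, hi, hz'⟩ := Finset.mem_biUnion.1 hz'
    exact hdisj i hi z h1 h2 (Finset.mem_filter.1 hz').2
  have hle : (O.filter (G.Adj u) ∪
      (nbIdx G v (2 * c' - 1) u).biUnion fun i => O.filter (G.Adj (v (i + 1)))).card ≤ O.card :=
    Finset.card_le_card (Finset.union_subset (Finset.filter_subset _ _)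
      (Finset.biUnion_subset.2 fun i _ => Finset.filter_subset _ _))
  rw [Finset.card_union_of_disjoint hdis, hU] at hle
  have h1 := hsplit u huB
  unfold dg at h1
  obtain ⟨d, rfl⟩ : ∃ d, t = c' + 1 + d := ⟨t - c' - 1, by omega⟩
  have hs := Finset.card_pos.2 hN
  rw [show c' + 1 + d - c' = d + 1 by omega, Nat.mul_add, mul_one] at hsum
  have := Nat.le_mul_of_pos_left d hs
  omega

/-- If all the degrees in `B` are at least `t` and `A` has at most `2 * t - 2` vertices, there are
cycles of all even lengths up to `2 * t`. -/
theorem exists_closed_of_degree (hG : IsBip G A B) {t : ℕ} (hA : A.card + 2 ≤ 2 * t)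
    (hB : t ≤ B.card) (hdeg : ∀ y ∈ B, t ≤ dg G A y) {c : ℕ} (hc : 2 ≤ c) (hct : c ≤ t) :
    ∃ L, ClosedList G L ∧ L.length = 2 * c := by
  induction c, hc using Nat.le_induction with
  | base =>
    obtain ⟨y, hy, y', hy', hne⟩ := Finset.one_lt_card.1 (show 1 < B.card by omega)
    have h1 := dg_add_dg_le (G := G) (C := A) (x := y) (y := y')
    have h2 := hdeg y hy
    have h3 := hdeg y' hy'
    obtain ⟨z, hz, z', hz', hzz⟩ := Finset.one_lt_card.1
      (show 1 < (A.filter fun z => G.Adj y z ∧ G.Adj y' z).card by omega)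
    obtain ⟨-, hz1, hz2⟩ := Finset.mem_filter.1 hz
    obtain ⟨-, hz1', hz2'⟩ := Finset.mem_filter.1 hz'
    refine ⟨[z', y, z, y'], ⟨_, _, (((PathList.singleton y').cons hz2.symm ?_).cons hz1 ?_).cons
      hz1'.symm ?_, hz2'⟩, rfl⟩
    · simpa using hz2.ne'
    · simpa using ⟨hz1.ne, hne⟩
    · simpa using ⟨hz1'.ne', hzz.symm, hz2'.ne'⟩
  | succ c hc ih =>
    obtain ⟨L, hL, hlen⟩ := ih (by omega)
    exact exists_closed_succ hG hA hB hdeg hc (by omega) hL hlen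

end Cycles

section Bipancyclic

open scoped Classical

variable {V : Type} {G : SimpleGraph V} {A B : Finset V} {v : ℕ → V} {c : ℕ}

namespace CycFun

/-- Two consecutive vertices of large degree sum on a cycle give all shorter even cycles. -/
theorem exists_closed_of_pair (hG : IsBip G A B) (h : CycFun G A v c)
    (hd : c + 2 ≤ (nbIdx G v (2 * c - 1) (v 0)).card +
      (nbIdx G v (2 * c - 1) (v (2 * c - 1))).card) {l : ℕ} (hl : 2 ≤ l) (hlc : l ≤ c) :
    ∃ L, ClosedList G L ∧ L.length = 2 * l := by
  by_contra hno
  have hw : v (2 * c - 1) ∈ B := (h.parity hG le_rfl).2 (by omega)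
  set φ : ℕ → ℕ := fun j => if j ≤ 2 * c + 1 - 2 * l then j + 2 * l - 3
    else j - (2 * c + 1 - 2 * l) with hφ
  have hinj : Set.InjOn φ ((nbIdx G v (2 * c - 1) (v 0)).erase 1 : Finset ℕ) := by
    intro i hi j hj hij
    obtain ⟨hi1, hi⟩ := Finset.mem_erase.1 hi
    obtain ⟨hj1, hj⟩ := Finset.mem_erase.1 hj
    have := h.odd_of_adj hG h.zero hi
    have := h.odd_of_adj hG h.zero hj
    have := (mem_nbIdx.1 hi).1
    have := (mem_nbIdx.1 hj).1
    simp only [hφ] at hij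
    split_ifs at hij <;> omega
  have hdisj : Disjoint (((nbIdx G v (2 * c - 1) (v 0)).erase 1).image φ)
      (nbIdx G v (2 * c - 1) (v (2 * c - 1))) := by
    rw [Finset.disjoint_left]
    intro i hi hiw
    obtain ⟨j, hj, rfl⟩ := Finset.mem_image.1 hi
    obtain ⟨hj1, hj⟩ := Finset.mem_erase.1 hj
    have := h.odd_of_adj hG h.zero hj
    obtain ⟨hj2, hadj⟩ := mem_nbIdx.1 hj
    obtain ⟨-, hadj'⟩ := mem_nbIdx.1 hiw
    refine hno ?_
    simp only [hφ] at hadj'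
    split_ifs at hadj' with hcase
    · have h1 := (h.path.seg (show j ≤ j + 2 * l - 3 by omega) (by omega)).cons hadj (by
        rw [mem_seg]; rintro ⟨p, hp, hp', e⟩
        have := h.path.inj _ _ (by omega) (Nat.zero_le _) e
        omega)
      have h2 := h1.concat hadj'.symm (by
        rw [List.mem_cons, mem_seg]; rintro (e | ⟨p, hp, hp', e⟩)
        · have := h.path.inj _ _ le_rfl (Nat.zero_le _) e
          omega
        · have := h.path.inj _ _ (by omega) le_rfl e
          omega)
      exact ⟨_, ⟨_, _, h2, h.close⟩, by simp; omega⟩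
    · have h1 := (h.path.seg (Nat.zero_le (j - (2 * c + 1 - 2 * l))) (by omega)).append
        (h.path.seg hj2 le_rfl).reverse hadj'.symm (by
          intro s hs hs'
          rw [List.mem_reverse, mem_seg] at hs'
          obtain ⟨q, hq, hq', rfl⟩ := hs'
          obtain ⟨p, hp, hp', e⟩ := mem_seg.1 hs
          have := h.path.inj _ _ (by omega) hq' e
          omega)
      exact ⟨_, ⟨_, _, h1, hadj.symm⟩, by simp; omega⟩
  have hle : (((nbIdx G v (2 * c - 1) (v 0)).erase 1).image φ ∪
      nbIdx G v (2 * c - 1) (v (2 * c - 1))).card ≤ (range c).card := by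
    refine Finset.card_le_card_of_injOn (fun i => i / 2) ?_ ?_
    · intro i hi
      rw [Finset.mem_coe, Finset.mem_range]
      dsimp only
      rcases Finset.mem_union.1 hi with hi | hi
      · obtain ⟨j, hj, rfl⟩ := Finset.mem_image.1 hi
        have := (mem_nbIdx.1 (Finset.mem_erase.1 hj).2).1
        simp only [hφ]
        split_ifs <;> omega
      · have := (mem_nbIdx.1 hi).1
        omega
    · have heven : ∀ i ∈ (((nbIdx G v (2 * c - 1) (v 0)).erase 1).image φ ∪
          nbIdx G v (2 * c - 1) (v (2 * c - 1))), i % 2 = 0 := by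
        intro i hi
        rcases Finset.mem_union.1 hi with hi | hi
        · obtain ⟨j, hj, rfl⟩ := Finset.mem_image.1 hi
          have := h.odd_of_adj hG h.zero (Finset.mem_erase.1 hj).2
          simp only [hφ]
          split_ifs <;> omega
        · exact h.even_of_adj hG hw hi
      intro i hi j hj hij
      have := heven i hi
      have := heven j hj
      dsimp only at hij
      omega
  rw [Finset.card_union_of_disjoint hdisj, Finset.card_image_of_injOn hinj,
    Finset.card_range] at hle
  have := Finset.pred_card_le_card_erase (s := nbIdx G v (2 * c - 1) (v 0)) (a := 1)
  omega

/-- Rotating a cycle by an odd amount. -/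
theorem rotate (hG : IsBip G A B) (h : CycFun G A v c) {s : ℕ} (hs : s ≤ 2 * c - 1)
    (hs2 : s % 2 = 1) :
    CycFun G B (fun i => if i + s ≤ 2 * c - 1 then v (i + s) else v (i + s - 2 * c)) c := by
  have hc := h.pos
  refine ⟨⟨fun i j hi hj hij => ?_, fun i hi => ?_⟩, ?_, ?_, hc⟩
  · split_ifs at hij <;>
    · have := h.path.inj _ _ (by omega) (by omega) hij
      omega
  · split_ifs with h1 h2 h2
    · have := h.path.adj (i + s) (by omega)
      rwa [show i + s + 1 = i + 1 + s by omega] at this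
    · have := h.close
      rwa [show 2 * c - 1 = i + s by omega, show 0 = i + 1 + s - 2 * c by omega] at this
    · omega
    · have := h.path.adj (i + s - 2 * c) (by omega)
      rwa [show i + s - 2 * c + 1 = i + 1 + s - 2 * c by omega] at this
  · rw [if_neg (by omega), if_pos (by omega)]
    have := h.path.adj (s - 1) (by omega)
    rwa [show s - 1 + 1 = 0 + s by omega, show s - 1 = 2 * c - 1 + s - 2 * c by omega] at this
  · rw [if_pos (by omega)]
    exact (h.parity hG (i := 0 + s) (by omega)).2 (by omega)

theorem card_nbIdx_rotate {s : ℕ} (hc : 1 ≤ c) (hs : s ≤ 2 * c - 1) (y : V) :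
    (nbIdx G v (2 * c - 1) y).card ≤ (nbIdx G
      (fun i => if i + s ≤ 2 * c - 1 then v (i + s) else v (i + s - 2 * c)) (2 * c - 1) y).card := by
  refine Finset.card_le_card_of_injOn (fun i => if s ≤ i then i - s else i + 2 * c - s) ?_ ?_
  · intro i hi
    obtain ⟨hi, hadj⟩ := mem_nbIdx.1 hi
    rw [Finset.mem_coe, mem_nbIdx]
    dsimp only
    split_ifs with h1 h2 h2
    · exact ⟨by omega, by rwa [show i - s + s = i by omega]⟩
    · omega
    · omega
    · exact ⟨by omega, by rwa [show i + 2 * c - s + s - 2 * c = i by omega]⟩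
  · intro i hi j hj hij
    have := (mem_nbIdx.1 hi).1
    have := (mem_nbIdx.1 hj).1
    dsimp only at hij
    split_ifs at hij <;> omega

/-- A cycle of length `2 * c` spanning more than `c * (c + 1) / 2` edges gives all shorter even
cycles. -/
theorem exists_closed_of_sum (hG : IsBip G A B) (h : CycFun G A v c)
    (hsum : c * (c + 1) < ∑ i ∈ range (2 * c), (nbIdx G v (2 * c - 1) (v i)).card)
    {l : ℕ} (hl : 2 ≤ l) (hlc : l ≤ c) : ∃ L, ClosedList G L ∧ L.length = 2 * l := by
  have hpair : ∀ n, ∑ i ∈ range (2 * n), (nbIdx G v (2 * c - 1) (v i)).card =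
      ∑ i ∈ range n, ((nbIdx G v (2 * c - 1) (v (2 * i))).card +
        (nbIdx G v (2 * c - 1) (v (2 * i + 1))).card) := by
    intro n
    induction n with
    | zero => simp
    | succ n ih =>
      rw [Finset.sum_range_succ, ← ih, show 2 * (n + 1) = 2 * n + 1 + 1 by ring,
        Finset.sum_range_succ, Finset.sum_range_succ, add_assoc]
  rw [hpair] at hsum
  obtain ⟨i, hi, hlt⟩ : ∃ i ∈ range c, c + 1 < (nbIdx G v (2 * c - 1) (v (2 * i))).card +
      (nbIdx G v (2 * c - 1) (v (2 * i + 1))).card := by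
    by_contra! hcon
    have := Finset.sum_le_card_nsmul _ _ _ hcon
    rw [Finset.card_range, smul_eq_mul] at this
    omega
  rw [Finset.mem_range] at hi
  refine (h.rotate hG (s := 2 * i + 1) (by omega) (by omega)).exists_closed_of_pair hG.symm ?_ hl hlc
  have h1 := card_nbIdx_rotate (G := G) (v := v) h.pos (s := 2 * i + 1) (by omega) (v (2 * i))
  have h2 := card_nbIdx_rotate (G := G) (v := v) h.pos (s := 2 * i + 1) (by omega) (v (2 * i + 1))
  rw [if_pos (by omega), if_neg (by omega), Nat.zero_add,
    show 2 * c - 1 + (2 * i + 1) - 2 * c = 2 * i by omega]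
  omega

end CycFun

end Bipancyclic

section EdgeCount

open scoped Classical

variable {V : Type} {G : SimpleGraph V} {A B : Finset V}

/-- The number of edges between `A` and `B`. -/
noncomputable def edg {V : Type} (G : SimpleGraph V) (A B : Finset V) : ℕ := ∑ x ∈ A, dg G B x

theorem edg_comm : edg G A B = edg G B A := by
  have := Finset.sum_card_bipartiteAbove_eq_sum_card_bipartiteBelow (s := A) (t := B) G.Adj
  unfold edg dg
  simp only [Finset.bipartiteAbove, Finset.bipartiteBelow] at this
  rw [this]
  simp only [G.adj_comm]

theorem dg_le (x : V) : dg G B x ≤ B.card := Finset.card_filter_le _ _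

theorem edg_le_mul : edg G A B ≤ A.card * B.card := by
  rw [← smul_eq_mul]
  exact Finset.sum_le_card_nsmul _ _ _ fun x _ => dg_le x

theorem edg_erase_add {x : V} (hx : x ∈ A) : edg G (A.erase x) B + dg G B x = edg G A B :=
  Finset.sum_erase_add _ _ hx

theorem dg_erase_add {x y : V} (hy : y ∈ B) :
    dg G (B.erase y) x + (if G.Adj x y then 1 else 0) = dg G B x := by
  unfold dg
  rw [Finset.filter_erase]
  split_ifs with h
  · exact Finset.card_erase_add_one (Finset.mem_filter.2 ⟨hy, h⟩)
  · rw [Finset.erase_eq_of_notMem fun hy' => h (Finset.mem_filter.1 hy').2, add_zero]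

theorem edg_erase_pair {x y : V} (hx : x ∈ A) (hy : y ∈ B) :
    edg G (A.erase x) (B.erase y) + dg G B x + dg G A y =
      edg G A B + (if G.Adj x y then 1 else 0) := by
  have h1 := edg_erase_add (G := G) (B := B) hx
  have h2 := edg_erase_add (G := G) (B := A.erase x) hy
  have h3 := dg_erase_add (G := G) (x := y) hx
  rw [edg_comm, edg_comm (A := B)] at h2
  rw [G.adj_comm] at h3
  omega

theorem dg_union {C D : Finset V} (h : Disjoint C D) (x : V) :
    dg G (C ∪ D) x = dg G C x + dg G D x := by
  unfold dg
  rw [Finset.filter_union, Finset.card_union_of_disjoint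
    (Finset.disjoint_filter_filter h)]

theorem dg_eq_zero {x : V} (h : ∀ y ∈ B, ¬ G.Adj x y) : dg G B x = 0 :=
  Finset.card_eq_zero.2 (Finset.filter_eq_empty_iff.2 fun _ => h _)

/-- The edges of `G` with both ends in `U`. -/
def within {V : Type} (G : SimpleGraph V) (U : Finset V) : SimpleGraph V where
  Adj x y := G.Adj x y ∧ x ∈ U ∧ y ∈ U
  symm := ⟨fun _ _ h => ⟨h.1.symm, h.2.2, h.2.1⟩⟩
  loopless := ⟨fun _ h => h.1.ne rfl⟩

theorem within_le (U : Finset V) : ∀ x y, (within G U).Adj x y → G.Adj x y := fun _ _ h => h.1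

theorem IsBip.within (hG : IsBip G A B) {A' B' : Finset V} (hA : A' ⊆ A) (hB : B' ⊆ B) :
    IsBip (within G (A' ∪ B')) A' B' := by
  refine ⟨Finset.disjoint_of_subset_left hA (Finset.disjoint_of_subset_right hB hG.disj), ?_⟩
  rintro x y ⟨hxy, hx, hy⟩
  rcases Finset.mem_union.1 hx with hx | hx <;> rcases Finset.mem_union.1 hy with hy | hy
  · exact absurd (hG.right_of_left (hA hx) hxy) (hG.not_mem_right (hA hy))
  · exact Or.inl ⟨hx, hy⟩
  · exact Or.inr ⟨hx, hy⟩
  · exact absurd (hG.left_of_right (hB hx) hxy) (hG.not_mem_left (hB hy))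

theorem dg_within {U : Finset V} {x : V} (hx : x ∈ U) (hB : B ⊆ U) :
    dg (within G U) B x = dg G B x := by
  unfold dg
  congr 1
  refine Finset.filter_congr fun y hy => ?_
  exact ⟨fun h => h.1, fun h => ⟨h, hx, hB hy⟩⟩

/-- Connectivity between the complements of vertices of `U` suffices. -/
theorem conn2_of_mem {U : Finset V} (hU : 3 ≤ U.card) (hG : ∀ x y, G.Adj x y → x ∈ U)
    (h : ∀ (R : Set V) (v : V), R.Nonempty → (∀ x ∈ R, x ∈ U) → v ∈ U → v ∉ R →
      (∃ z ∈ U, z ∉ R ∧ z ≠ v) → ∃ r ∈ R, ∃ b, b ∉ R ∧ b ≠ v ∧ G.Adj r b) : Conn2 G U := by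
  intro R v hR hRU hvR hz
  by_cases hv : v ∈ U
  · exact h R v hR hRU hv hvR hz
  obtain ⟨z, hzU, hzR, hzv⟩ := hz
  have hne : ∀ r b, G.Adj r b → b ≠ v := fun r b hrb hbv => hv (hbv ▸ hG _ _ hrb.symm)
  obtain ⟨r0, hr0⟩ := hR
  by_cases hR2 : ∃ r ∈ R, r ≠ r0
  · obtain ⟨r, hr, hrr⟩ := hR2
    obtain ⟨r', hr', b, hb, hbr, hadj⟩ := h (R \ {r0}) r0 ⟨r, hr, hrr⟩ (fun x hx => hRU x hx.1)
      (hRU _ hr0) (fun hh => hh.2 rfl) ⟨z, hzU, fun hh => hzR hh.1, by rintro rfl; exact hzR hr0⟩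
    exact ⟨r', hr'.1, b, fun hbR => hb ⟨hbR, hbr⟩, hne _ _ hadj, hadj⟩
  · push Not at hR2
    have hcard : 0 < ((U.erase z).erase r0).card := by
      have h1 := Finset.pred_card_le_card_erase (s := U) (a := z)
      have h2 := Finset.pred_card_le_card_erase (s := U.erase z) (a := r0)
      omega
    obtain ⟨z', hz'⟩ := Finset.card_pos.1 hcard
    rw [Finset.mem_erase, Finset.mem_erase] at hz'
    obtain ⟨r', hr', b, hb, hbr, hadj⟩ := h R z ⟨r0, hr0⟩ hRU hzU hzR
      ⟨z', hz'.2.2, fun hh => hz'.1 (hR2 _ hh), hz'.2.1⟩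
    exact ⟨r', hr', b, hb, hne _ _ hadj, hadj⟩

end EdgeCount

section CircumferenceBound

open scoped Classical

variable {V : Type} {G : SimpleGraph V} {X Y A B : Finset V}

theorem cut_bound_aux {c n p₁ p₂ q₁ q₂ e₁ e₂ : ℕ} (hnc : n ≤ 2 * c)
    (hp : p₁ + p₂ + 1 = n) (hq : q₁ + q₂ = n) (h₁ : e₁ ≤ (p₁ + 1) * q₁) (h₂ : e₂ ≤ (p₂ + 1) * q₂)
    (f₁ : e₁ + c ≤ c * (p₁ + 1) + q₁) (f₂ : e₂ + c ≤ c * q₂ + (p₂ + 1))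
    (hd : c + 2 ≤ q₁ + p₂ + 1) : e₁ + e₂ + c ≤ c * n + n := by
  obtain ⟨b, rfl⟩ : ∃ b, b = p₂ + 1 := ⟨_, rfl⟩
  zify at *
  obtain ⟨a, ha⟩ : ∃ a : ℤ, a = q₁ := ⟨_, rfl⟩
  obtain ⟨b, hb⟩ : ∃ b : ℤ, b = p₂ + 1 := ⟨_, rfl⟩
  have hp1 : (p₁ : ℤ) + 1 = n - b + 1 := by linarith
  have hq2 : (q₂ : ℤ) = n - a := by linarith
  have ha0 : 0 ≤ a := by omega
  have hb0 : 1 ≤ b := by omega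
  have hbn : b ≤ n := by omega
  have han : a ≤ n := by omega
  rw [hp1, ← ha] at h₁ f₁
  rw [hq2, ← hb] at h₂ f₂
  have hd' : (c : ℤ) + 2 ≤ a + b := by linarith
  rcases le_or_gt a c with hac | hac
  · rcases le_or_gt b c with hbc | hbc
    · nlinarith [mul_nonneg (sub_nonneg.2 hac) (sub_nonneg.2 hbc),
        mul_nonneg (sub_nonneg.2 hd') (sub_nonneg.2 hnc)]
    · nlinarith [mul_nonneg ha0 (show (0 : ℤ) ≤ b + c - n - 1 by omega)]
  · nlinarith [mul_nonneg (show (0 : ℤ) ≤ b - 1 by omega) (show (0 : ℤ) ≤ a + c - n by omega)]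

theorem cut_bound {c n p₁ p₂ q₁ q₂ e₁ e₂ : ℕ} (hnc : n ≤ 2 * c)
    (hp : p₁ + p₂ + 1 = n) (hq : q₁ + q₂ = n) (h₁ : e₁ ≤ (p₁ + 1) * q₁) (h₂ : e₂ ≤ (p₂ + 1) * q₂)
    (f₁ : e₁ + c ≤ c * max (p₁ + 1) q₁ + min (p₁ + 1) q₁)
    (f₂ : e₂ + c ≤ c * max (p₂ + 1) q₂ + min (p₂ + 1) q₂)
    (hd₁ : 1 ≤ p₁ → 1 ≤ q₂ → c + 2 ≤ q₁ + p₂ + 1) (hd₂ : 1 ≤ p₂ → 1 ≤ q₁ → c + 2 ≤ q₂ + p₁ + 1) :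
    e₁ + e₂ + c ≤ c * n + n := by
  rcases lt_trichotomy q₁ p₁ with h | h | h
  · rw [max_eq_left (by omega), min_eq_right (by omega)] at f₁
    rw [max_eq_right (by omega), min_eq_left (by omega)] at f₂
    exact cut_bound_aux hnc hp hq h₁ h₂ f₁ f₂ (hd₁ (by omega) (by omega))
  · rw [max_eq_left (by omega), min_eq_right (by omega)] at f₁
    rw [max_eq_right (by omega), min_eq_left (by omega)] at f₂
    subst h
    obtain rfl : q₂ = p₂ + 1 := by omega
    subst hp
    nlinarith
  · rcases Nat.lt_or_ge q₁ (p₁ + 2) with h' | h'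
    · obtain rfl : q₁ = p₁ + 1 := by omega
      obtain rfl : p₂ = q₂ := by omega
      rw [max_eq_left (by omega), min_eq_right (by omega)] at f₁ f₂
      subst hq
      nlinarith
    · rw [max_eq_right (by omega), min_eq_left (by omega)] at f₁
      rw [max_eq_left (by omega), min_eq_right (by omega)] at f₂
      have := cut_bound_aux hnc (by omega) (by omega) h₂ h₁ f₂ f₁ (hd₂ (by omega) (by omega))
      omega

/-- Counting the edges of a square bipartite graph with a cut vertex. -/
theorem edg_le_of_cut {c : ℕ} (hAB : Disjoint A B) (hcard : A.card = B.card)  (hAc : A.card ≤ 2 * c)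
    (ih : ∀ A' ⊆ A, ∀ B' ⊆ B, A'.card + B'.card < A.card + B.card → 1 ≤ A'.card →
      edg G A' B' + c ≤ c * max A'.card B'.card + min A'.card B'.card)
    (hdeg : ∀ x ∈ A, ∀ y ∈ B, ¬ G.Adj x y → c + 2 ≤ dg G B x + dg G A y)
    {R : Set V} {v : V} (hR : R.Nonempty) (hRU : ∀ x ∈ R, x ∈ A ∪ B) (hv : v ∈ A) (hvR : v ∉ R)
    (hz : ∃ z ∈ A ∪ B, z ∉ R ∧ z ≠ v)
    (hcut : ∀ r ∈ R, ∀ b ∈ A ∪ B, b ∉ R → b ≠ v → ¬ G.Adj r b) :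
    edg G A B + c ≤ c * A.card + A.card := by
  set A₁ := (A.erase v).filter (· ∈ R) with hA1
  set A₂ := (A.erase v).filter (· ∉ R) with hA2
  set B₁ := B.filter (· ∈ R) with hB1
  set B₂ := B.filter (· ∉ R) with hB2
  have hA1' : ∀ {x}, x ∈ A₁ → (x ≠ v ∧ x ∈ A) ∧ x ∈ R := fun hx => by
    simpa [hA1] using hx
  have hA2' : ∀ {x}, x ∈ A₂ → (x ≠ v ∧ x ∈ A) ∧ x ∉ R := fun hx => by
    simpa [hA2] using hx
  have hB1' : ∀ {x}, x ∈ B₁ → x ∈ B ∧ x ∈ R := fun hx => Finset.mem_filter.1 hx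
  have hB2' : ∀ {x}, x ∈ B₂ → x ∈ B ∧ x ∉ R := fun hx => Finset.mem_filter.1 hx
  have hvB : v ∉ B := Finset.disjoint_left.1 hAB hv
  have hv1 : v ∉ A₁ := fun h => (hA1' h).1.1 rfl
  have hv2 : v ∉ A₂ := fun h => (hA2' h).1.1 rfl
  have h12 : ∀ x ∈ A₁, ∀ y ∈ B₂, ¬ G.Adj x y := fun x hx y hy =>
    hcut x (hA1' hx).2 y (Finset.mem_union_right _ (hB2' hy).1) (hB2' hy).2
      (by rintro rfl; exact hvB (hB2' hy).1)
  have h21 : ∀ x ∈ A₂, ∀ y ∈ B₁, ¬ G.Adj x y := fun x hx y hy hxy =>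
    hcut y (hB1' hy).2 x (Finset.mem_union_left _ (hA2' hx).1.2) (hA2' hx).2 (hA2' hx).1.1 hxy.symm
  have hp : A₁.card + A₂.card + 1 = A.card := by
    rw [hA1, hA2, Finset.card_filter_add_card_filter_not, Finset.card_erase_add_one hv]
  have hq : B₁.card + B₂.card = B.card := Finset.card_filter_add_card_filter_not _
  have hBd : B₁ ∪ B₂ = B := Finset.filter_union_filter_not_eq _ _
  have hBdis : Disjoint B₁ B₂ := Finset.disjoint_filter_filter_not _ _ _
  have hAd : A₁ ∪ A₂ = A.erase v := Finset.filter_union_filter_not_eq _ _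
  have hAdis : Disjoint A₁ A₂ := Finset.disjoint_filter_filter_not _ _ _
  have hdg : ∀ x, dg G B x = dg G B₁ x + dg G B₂ x := fun x => by rw [← hBd, dg_union hBdis]
  have hedg : edg G A B = edg G (insert v A₁) B₁ + edg G (insert v A₂) B₂ := by
    rw [← edg_erase_add hv]
    unfold edg
    rw [Finset.sum_insert hv1, Finset.sum_insert hv2, ← hAd, Finset.sum_union hAdis, hdg v]
    have e1 : ∑ x ∈ A₁, dg G B x = ∑ x ∈ A₁, dg G B₁ x :=
      Finset.sum_congr rfl fun x hx => by rw [hdg x, dg_eq_zero (h12 x hx), add_zero]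
    have e2 : ∑ x ∈ A₂, dg G B x = ∑ x ∈ A₂, dg G B₂ x :=
      Finset.sum_congr rfl fun x hx => by rw [hdg x, dg_eq_zero (h21 x hx), zero_add]
    rw [e1, e2]
    ring
  have hR1 : 1 ≤ A₁.card + B₁.card := by
    obtain ⟨r, hr⟩ := hR
    rcases Finset.mem_union.1 (hRU r hr) with h | h
    · have : 0 < A₁.card := Finset.card_pos.2 ⟨r, by
        simpa [hA1, h, hr] using (by rintro rfl; exact hvR hr : r ≠ v)⟩
      omega
    · have : 0 < B₁.card := Finset.card_pos.2 ⟨r, Finset.mem_filter.2 ⟨h, hr⟩⟩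
      omega
  have hR2 : 1 ≤ A₂.card + B₂.card := by
    obtain ⟨r, hr', hr, hrv⟩ := hz
    rcases Finset.mem_union.1 hr' with h | h
    · have : 0 < A₂.card := Finset.card_pos.2 ⟨r, by simp [hA2, h, hr, hrv]⟩
      omega
    · have : 0 < B₂.card := Finset.card_pos.2 ⟨r, Finset.mem_filter.2 ⟨h, hr⟩⟩
      omega
  have hi1 : (insert v A₁).card = A₁.card + 1 := Finset.card_insert_of_notMem hv1
  have hi2 : (insert v A₂).card = A₂.card + 1 := Finset.card_insert_of_notMem hv2
  have hs1 : insert v A₁ ⊆ A := Finset.insert_subset hv fun x hx => (hA1' hx).1.2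
  have hs2 : insert v A₂ ⊆ A := Finset.insert_subset hv fun x hx => (hA2' hx).1.2
  have f1 := ih _ hs1 B₁ (Finset.filter_subset _ _) (by omega) (by omega)
  have f2 := ih _ hs2 B₂ (Finset.filter_subset _ _) (by omega) (by omega)
  have m1 := edg_le_mul (G := G) (A := insert v A₁) (B := B₁)
  have m2 := edg_le_mul (G := G) (A := insert v A₂) (B := B₂)
  rw [hi1] at f1 m1
  rw [hi2] at f2 m2
  rw [hedg]
  have hAA : ∀ y, dg G A y ≤ dg G A₁ y + dg G A₂ y + 1 := fun y => by
    rw [← dg_union hAdis, hAd, ← dg_erase_add hv]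
    split_ifs <;> omega
  refine cut_bound hAc hp (hq.trans hcard.symm) m1 m2 f1 f2 (fun h1 h2 => ?_) fun h1 h2 => ?_
  · obtain ⟨x, hx⟩ := Finset.card_pos.1 h1
    obtain ⟨y, hy⟩ := Finset.card_pos.1 h2
    have h3 := hdeg x (hA1' hx).1.2 y (hB2' hy).1 (h12 x hx y hy)
    have h4 := hAA y
    rw [hdg x, dg_eq_zero (h12 x hx)] at h3
    rw [dg_eq_zero (B := A₁) fun x hx hyx => h12 x hx y hy hyx.symm] at h4
    have h5 := dg_le (G := G) (B := B₁) x
    have h6 := dg_le (G := G) (B := A₂) y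
    omega
  · obtain ⟨x, hx⟩ := Finset.card_pos.1 h1
    obtain ⟨y, hy⟩ := Finset.card_pos.1 h2
    have h3 := hdeg x (hA2' hx).1.2 y (hB1' hy).1 (h21 x hx y hy)
    have h4 := hAA y
    rw [hdg x, dg_eq_zero (h21 x hx)] at h3
    rw [dg_eq_zero (B := A₂) fun x hx hyx => h21 x hx y hy hyx.symm] at h4
    have h5 := dg_le (G := G) (B := B₂) x
    have h6 := dg_le (G := G) (B := A₁) y
    omega

theorem mul_min_bound {c p q e : ℕ} (he : e ≤ p * q) (hc : min p q ≤ c) (hpq : 1 ≤ max p q) :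
    e + c ≤ c * max p q + min p q := by
  rw [← max_mul_min] at he
  obtain ⟨d, rfl⟩ := Nat.exists_eq_add_of_le hc
  obtain ⟨m, hm⟩ := Nat.exists_eq_add_of_le hpq
  rw [hm] at he ⊢
  nlinarith [Nat.zero_le (d * m)]

/-- A bipartite graph without cycles of length at least `2 * (c + 1)` has few edges. -/
theorem edg_le_of_no_closed (hG : IsBip G X Y) {c : ℕ}
    (hno : ∀ L, ClosedList G L → L.length < 2 * (c + 1)) (N : ℕ) :
    ∀ A ⊆ X, ∀ B ⊆ Y, A.card + B.card ≤ N → min A.card B.card ≤ 2 * c →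
      1 ≤ max A.card B.card → edg G A B + c ≤ c * max A.card B.card + min A.card B.card := by
  induction N with
  | zero => omega
  | succ N ih =>
    intro A hA B hB hN hmin hmax
    rcases le_or_gt (min A.card B.card) c with hc | hc
    · exact mul_min_bound edg_le_mul hc hmax
    have hH := hG.within hA hB
    have hHno : ∀ L, ClosedList (within G (A ∪ B)) L → L.length < 2 * (c + 1) :=
      fun L hL => hno L (hL.mono (within_le _))
    have hdA : ∀ x ∈ A, dg (within G (A ∪ B)) B x = dg G B x := fun x hx =>
      dg_within (Finset.mem_union_left _ hx) Finset.subset_union_right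
    have hdB : ∀ y ∈ B, dg (within G (A ∪ B)) A y = dg G A y := fun y hy =>
      dg_within (Finset.mem_union_right _ hy) Finset.subset_union_left
    rcases lt_trichotomy A.card B.card with hlt | heq | hlt
    · rw [max_eq_right hlt.le, min_eq_left hlt.le] at *
      by_cases hlow : ∃ y ∈ B, dg G A y ≤ c
      · obtain ⟨y, hy, hyc⟩ := hlow
        have h1 := Finset.card_erase_of_mem hy
        have h2 := ih A hA (B.erase y) ((Finset.erase_subset _ _).trans hB) (by omega) (by omega)
          (by omega)
        have h3 := edg_erase_add (G := G) (B := A) hy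
        rw [edg_comm, edg_comm (A := B)] at h3
        rw [max_eq_right (by omega), min_eq_left (by omega), h1] at h2
        obtain ⟨b, hb⟩ : ∃ b, B.card = b + 1 := ⟨B.card - 1, by omega⟩
        rw [hb, Nat.add_sub_cancel] at h2
        rw [hb, Nat.mul_add]
        omega
      · push Not at hlow
        obtain ⟨L, hL, hlen⟩ := exists_closed_of_degree hH (t := c + 1) (by omega) (by omega)
          (fun y hy => by rw [hdB y hy]; exact hlow y hy) (c := c + 1) (by omega) le_rfl
        exact absurd (hHno L hL) (by omega)
    · rw [← heq, max_self] at hmax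
      rw [← heq, min_self] at hc hmin
      rw [← heq, max_self, min_self]
      by_cases hlow : ∃ x ∈ A, ∃ y ∈ B, dg G B x + dg G A y ≤
          c + 1 + (if G.Adj x y then 1 else 0)
      · obtain ⟨x, hx, y, hy, hxy⟩ := hlow
        have h1 := Finset.card_erase_of_mem hx
        have h1' := Finset.card_erase_of_mem hy
        have h2 := ih (A.erase x) ((Finset.erase_subset _ _).trans hA) (B.erase y)
          ((Finset.erase_subset _ _).trans hB) (by omega) (by omega) (by omega)
        have h3 := edg_erase_pair (G := G) hx hy
        rw [h1', ← heq, h1, max_self, min_self] at h2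
        obtain ⟨b, hb⟩ : ∃ b, A.card = b + 1 := ⟨A.card - 1, by omega⟩
        rw [hb, Nat.add_sub_cancel] at h2
        rw [hb, Nat.mul_add]
        omega
      · push Not at hlow
        by_contra hbig
        have hdeg : ∀ x ∈ A, ∀ y ∈ B, ¬ G.Adj x y → c + 2 ≤ dg G B x + dg G A y := by
          intro x hx y hy hxy
          have := hlow x hx y hy
          rw [if_neg hxy] at this
          omega
        have ih' : ∀ A' ⊆ A, ∀ B' ⊆ B, A'.card + B'.card < A.card + B.card →
            1 ≤ max A'.card B'.card →
            edg G A' B' + c ≤ c * max A'.card B'.card + min A'.card B'.card := by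
          intro A' hA' B' hB' hlt h1
          have h2 := Finset.card_le_card hA'
          exact ih A' (hA'.trans hA) B' (hB'.trans hB) (by omega)
            ((min_le_left _ _).trans (by omega)) h1
        have hconn : Conn2 (within G (A ∪ B)) (A ∪ B) := by
          refine conn2_of_mem ?_ (fun x y h => h.2.1) fun R v hR hRU hv hvR hz => ?_
          · rw [Finset.card_union_of_disjoint hH.disj]
            have : 0 < c := Nat.pos_of_ne_zero (by rintro rfl; omega)
            omega
          · by_contra! hcut
            have hcut' : ∀ r ∈ R, ∀ b ∈ A ∪ B, b ∉ R → b ≠ v → ¬ G.Adj r b :=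
              fun r hr b hb hbR hbv hrb => hcut r hr b hbR hbv ⟨hrb, hRU r hr, hb⟩
            rcases Finset.mem_union.1 hv with hv | hv
            · exact hbig (edg_le_of_cut hH.disj heq hmin (fun A' hA' B' hB' h1 h2 =>
                ih' A' hA' B' hB' h1 (h2.trans (le_max_left _ _))) hdeg hR hRU hv hvR hz hcut')
            · rw [Finset.union_comm] at hRU hz hcut'
              refine hbig ?_
              rw [edg_comm, heq]
              refine edg_le_of_cut hH.disj.symm heq.symm (heq ▸ hmin) (fun B' hB' A' hA' h1 h2 => ?_)
                (fun y hy x hx hyx => ?_) hR hRU hv hvR hz hcut'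
              · rw [edg_comm, max_comm, min_comm]
                exact ih' A' hA' B' hB' (by omega) (h2.trans (le_max_right _ _))
              · rw [add_comm (dg G A y)]
                exact hdeg x hx y hy fun h => hyx h.symm
        obtain ⟨L, hL, hlen⟩ := exists_closed_of_conn2 hH hconn heq (t := c + 1) (by omega)
          (by omega) (fun x hx y hy => by
            rw [hdA x hx, hdB y hy]
            have := hlow x hx y hy
            omega)
        exact absurd (hHno L hL) (by omega)
    · rw [max_eq_left hlt.le, min_eq_right hlt.le] at *
      by_cases hlow : ∃ x ∈ A, dg G B x ≤ c
      · obtain ⟨x, hx, hxc⟩ := hlow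
        have h1 := Finset.card_erase_of_mem hx
        have h2 := ih (A.erase x) ((Finset.erase_subset _ _).trans hA) B hB (by omega) (by omega)
          (by omega)
        have h3 := edg_erase_add (G := G) (B := B) hx
        rw [max_eq_left (by omega), min_eq_right (by omega), h1] at h2
        obtain ⟨b, hb⟩ : ∃ b, A.card = b + 1 := ⟨A.card - 1, by omega⟩
        rw [hb, Nat.add_sub_cancel] at h2
        rw [hb, Nat.mul_add]
        omega
      · push Not at hlow
        obtain ⟨L, hL, hlen⟩ := exists_closed_of_degree hH.symm (t := c + 1) (by omega) (by omega)
          (fun x hx => by rw [hdA x hx]; exact hlow x hx) (c := c + 1) (by omega) le_rfl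
        exact absurd (hHno L hL) (by omega)

end CircumferenceBound

section OffCycle

open scoped Classical

variable {V : Type} {G : SimpleGraph V} {A B : Finset V}

/-- In a balanced bipartite graph with large degree sums, no longest path has both ends in the
same class. -/
theorem not_max_path_of_degree (hG : IsBip G A B) (hcard : A.card = B.card)
    (hdeg : ∀ x ∈ A, ∀ y ∈ B, A.card ≤ dg G B x + dg G A y) {l : List V} {a b : V}
    (hl : PathList G l a b) (ha : a ∈ A) (hb : b ∈ A) :
    ∃ L c d, PathList G L c d ∧ l.length < L.length := by
  by_contra! hmax
  have hlen := (hl.length_eq hG).1 ha hb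
  obtain ⟨w, k, hw, rfl, rfl, rfl⟩ := hl.exists_pathFun
  have hA := card_off_verts (v := w) (k := k) A
  have hB := card_off_verts (v := w) (k := k) B
  rw [length_seg] at hlen hmax
  obtain ⟨y, hy⟩ : (B.filter (· ∉ verts w k)).Nonempty := Finset.card_pos.1 (by omega)
  obtain ⟨hyB, hyw⟩ := Finset.mem_filter.1 hy
  have hx : ∀ z, G.Adj (w 0) z → z ∈ verts w k := by
    intro z hz
    by_contra hcon
    have := hmax _ _ _ ((hw.seg (Nat.zero_le k) le_rfl).cons hz.symm (by
      rw [mem_seg]; rintro ⟨p, -, hp, rfl⟩; exact hcon (mem_verts hp)))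
    simp at this
  have h1 := dg_eq_card_nbIdx hG hw ha hx
  have h2 := hw.dg_eq A (y := y) fun x hx => hG.left_of_right hyB hx
  have h3 := dg_le (G := G) (B := A.filter (· ∉ verts w k)) y
  have h4 := hdeg _ ha y hyB
  have hodd : ∀ i ∈ nbIdx G w k (w 0), i % 2 = 1 := by
    intro i hi
    obtain ⟨hi, hadj⟩ := mem_nbIdx.1 hi
    have := hw.parity_of_adj hG ha (Nat.zero_le _) hi hadj
    omega
  have heven : ∀ i ∈ nbIdx G w k y, i % 2 = 0 := by
    intro i hi
    obtain ⟨hi, hadj⟩ := mem_nbIdx.1 hi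
    by_contra hcon
    exact hG.not_mem_left ((hw.parity hG ha i hi).2 (by omega)) (hG.left_of_right hyB hadj)
  have hne : ∀ i ∈ nbIdx G w k y, i < k := by
    intro i hi
    obtain ⟨hi, hadj⟩ := mem_nbIdx.1 hi
    refine lt_of_le_of_ne hi ?_
    rintro rfl
    have := hmax _ _ _ ((hw.seg (Nat.zero_le i) le_rfl).concat hadj.symm (by
      rw [mem_seg]; rintro ⟨p, -, hp, rfl⟩; exact hyw (mem_verts hp)))
    simp at this
  have hdisj : Disjoint ((nbIdx G w k (w 0)).image (· - 1)) (nbIdx G w k y) := by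
    rw [Finset.disjoint_left]
    intro i hi hiy
    obtain ⟨j, hj, rfl⟩ := Finset.mem_image.1 hi
    have := hodd j hj
    obtain ⟨hj, hadj⟩ := mem_nbIdx.1 hj
    obtain ⟨-, hadj'⟩ := mem_nbIdx.1 hiy
    have h5 := (hw.seg (Nat.zero_le (j - 1)) (by omega)).reverse.append (hw.seg hj le_rfl) hadj (by
      intro s hs hs'
      rw [List.mem_reverse, mem_seg] at hs
      obtain ⟨p, -, hp, rfl⟩ := hs
      obtain ⟨q, hq, hq', e⟩ := mem_seg.1 hs'
      have := hw.inj _ _ hq' (by omega) e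
      omega)
    have := hmax _ _ _ (h5.cons hadj' (by
      rw [List.mem_append, List.mem_reverse, mem_seg, mem_seg]
      rintro (⟨p, -, hp, rfl⟩ | ⟨p, -, hp, rfl⟩) <;> exact hyw (mem_verts (by omega))))
    simp at this
    omega
  have hle : ((nbIdx G w k (w 0)).image (· - 1) ∪ nbIdx G w k y).card ≤ (range (k / 2)).card := by
    refine Finset.card_le_card_of_injOn (fun i => i / 2) ?_ ?_
    · intro i hi
      rw [Finset.mem_coe, Finset.mem_range]
      dsimp only
      rcases Finset.mem_union.1 hi with hi | hi
      · obtain ⟨j, hj, rfl⟩ := Finset.mem_image.1 hi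
        have := hodd j hj
        have := (mem_nbIdx.1 hj).1
        omega
      · have := heven i hi
        have := hne i hi
        omega
    · have hpar : ∀ i ∈ (nbIdx G w k (w 0)).image (· - 1) ∪ nbIdx G w k y, i % 2 = 0 := by
        intro i hi
        rcases Finset.mem_union.1 hi with hi | hi
        · obtain ⟨j, hj, rfl⟩ := Finset.mem_image.1 hi
          have := hodd j hj
          omega
        · exact heven i hi
      intro i hi j hj hij
      have := hpar i hi
      have := hpar j hj
      dsimp only at hij
      omega
  rw [Finset.card_union_of_disjoint hdisj, Finset.card_image_of_injOn, Finset.card_range] at hle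
  · omega
  · intro i hi j hj hij
    have := hodd i hi
    have := hodd j hj
    dsimp only at hij
    omega

end OffCycle

section OffCyclePaths

open scoped Classical

variable {V : Type} {G : SimpleGraph V} {A B : Finset V} {v : ℕ → V} {c : ℕ}

namespace CycFun

/-- If a cycle cannot be prolonged by a path of `2 * m` vertices both ends of which have neighbours
on it, these ends have few neighbours on it. -/
theorem card_nbIdx_add_le (hG : IsBip G A B) (h : CycFun G A v c)
    (hno : ∀ L, ClosedList G L → L.length ≤ 2 * c) {D : List V} {x y : V} (hD : PathList G D x y)
    (hoff : ∀ s ∈ D, s ∉ verts v (2 * c - 1)) (hx : x ∈ A) (hy : y ∈ B) {m : ℕ}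
    (hlen : D.length = 2 * m) (hm : 1 ≤ m) (hxN : (nbIdx G v (2 * c - 1) x).Nonempty)
    (hyN : (nbIdx G v (2 * c - 1) y).Nonempty) :
    (nbIdx G v (2 * c - 1) x).card + (nbIdx G v (2 * c - 1) y).card + m ≤ c := by
  set Nx := nbIdx G v (2 * c - 1) x with hNx
  set Ny := nbIdx G v (2 * c - 1) y with hNy
  have hodd : ∀ i ∈ Nx, i % 2 = 1 := fun i hi => h.odd_of_adj hG hx hi
  have heven : ∀ i ∈ Ny, i % 2 = 0 := fun i hi => h.even_of_adj hG hy hi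
  have hlt : ∀ i ∈ Nx, ∀ j ∈ Ny, i < j → i + 2 * m < j := by
    intro i hi j hj hij
    obtain ⟨hi, hxi⟩ := mem_nbIdx.1 hi
    obtain ⟨hj, hyj⟩ := mem_nbIdx.1 hj
    obtain ⟨L, hL, hLlen⟩ := h.insert hij hj hD hoff hxi hyj
    have := hno L hL
    omega
  have hne : ∀ i ∈ Nx, i - 1 ∉ Ny := by
    intro i hi hj
    have := hodd i hi
    obtain ⟨hi, hxi⟩ := mem_nbIdx.1 hi
    obtain ⟨hj, hyj⟩ := mem_nbIdx.1 hj
    obtain ⟨L, hL, hLlen⟩ := h.insert (show i - 1 < i by omega) hi hD.reverse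
      (fun s hs => hoff s (List.mem_reverse.1 hs)) hyj hxi
    have := hno L hL
    rw [List.length_reverse] at hLlen
    omega
  have hcard : (Nx.image (· - 1)).card = Nx.card := by
    refine Finset.card_image_of_injOn fun i hi j hj hij => ?_
    have := hodd i hi
    have := hodd j hj
    omega
  have hdisj : Disjoint (Nx.image (· - 1)) Ny := by
    rw [Finset.disjoint_left]
    intro i hi
    obtain ⟨j, hj, rfl⟩ := Finset.mem_image.1 hi
    exact hne j hj
  have hpar : ∀ i ∈ Nx.image (· - 1) ∪ Ny, i % 2 = 0 := by
    intro i hi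
    rcases Finset.mem_union.1 hi with hi | hi
    · obtain ⟨j, hj, rfl⟩ := Finset.mem_image.1 hi
      have := hodd j hj
      omega
    · exact heven i hi
  have hle : ∀ i ∈ Nx.image (· - 1) ∪ Ny, i ≤ 2 * c - 1 := by
    intro i hi
    rcases Finset.mem_union.1 hi with hi | hi
    · obtain ⟨j, hj, rfl⟩ := Finset.mem_image.1 hi
      have := (mem_nbIdx.1 hj).1
      omega
    · exact (mem_nbIdx.1 hi).1
  by_cases hcase : ∃ i ∈ Nx, ∃ j ∈ Ny, i < j
  · obtain ⟨i₀, hi₀, j₀, hj₀, hij₀⟩ := hcase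
    obtain ⟨⟨i, j⟩, hij, hmin⟩ := Finset.exists_min_image ((Nx ×ˢ Ny).filter fun p => p.1 < p.2)
      (fun p => p.2 - p.1) ⟨(i₀, j₀), by simp [hi₀, hj₀, hij₀]⟩
    simp only [Finset.mem_filter, Finset.mem_product] at hij hmin
    obtain ⟨⟨hi, hj⟩, hij⟩ := hij
    have h1 := hlt i hi j hj hij
    have h2 : ∀ p ∈ Nx, i < p → j ≤ p := by
      intro p hp hip
      by_contra hcon
      have := hmin (p, j) ⟨⟨hp, hj⟩, by dsimp only; omega⟩
      dsimp only at this
      omega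
    have h3 : ∀ p ∈ Ny, i < p → j ≤ p := by
      intro p hp hip
      by_contra hcon
      have := hmin (i, p) ⟨⟨hi, hp⟩, by dsimp only; omega⟩
      dsimp only at this
      omega
    have hi1 := hodd i hi
    have hj2 := (mem_nbIdx.1 hj).1
    have h4 : ∀ p ∈ (range m).image (fun s => i + 1 + 2 * s), i < p ∧ p + 2 ≤ j ∧ p % 2 = 0 := by
      intro p hp
      obtain ⟨s, hs, rfl⟩ := Finset.mem_image.1 hp
      rw [Finset.mem_range] at hs
      have := heven j hj
      omega
    have hdisj' : Disjoint (Nx.image (· - 1) ∪ Ny) ((range m).image (fun s => i + 1 + 2 * s)) := by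
      rw [Finset.disjoint_left]
      intro p hp hp'
      obtain ⟨h5, h6, -⟩ := h4 p hp'
      rcases Finset.mem_union.1 hp with hp | hp
      · obtain ⟨q, hq, rfl⟩ := Finset.mem_image.1 hp
        have := h2 q hq (by omega)
        omega
      · have := h3 p hp h5
        omega
    have hfin : (Nx.image (· - 1) ∪ Ny ∪ (range m).image (fun s => i + 1 + 2 * s)).card ≤
        (range c).card := by
      refine Finset.card_le_card_of_injOn (fun i => i / 2) ?_ ?_
      · intro p hp
        rw [Finset.mem_coe, Finset.mem_range]
        dsimp only
        rcases Finset.mem_union.1 hp with hp | hp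
        · have := hle p hp
          have := h.pos
          omega
        · have := h4 p hp
          omega
      · have hpar' : ∀ p ∈ Nx.image (· - 1) ∪ Ny ∪ (range m).image (fun s => i + 1 + 2 * s),
            p % 2 = 0 := by
          intro p hp
          rcases Finset.mem_union.1 hp with hp | hp
          · exact hpar p hp
          · exact (h4 p hp).2.2
        intro p hp q hq hpq
        have := hpar' p hp
        have := hpar' q hq
        dsimp only at hpq
        omega
    rw [Finset.card_union_of_disjoint hdisj', Finset.card_union_of_disjoint hdisj, hcard,
      Finset.card_image_of_injective _ (fun a b hab => by omega),
      Finset.card_range, Finset.card_range] at hfin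
    exact hfin
  · push Not at hcase
    obtain ⟨j, hj, hjmin⟩ := Finset.exists_min_image Ny id hyN
    obtain ⟨i, hi, himax⟩ := Finset.exists_max_image Nx id hxN
    simp only [id] at hjmin himax
    have h2 := hcase i hi j hj
    obtain ⟨hi', hxi⟩ := mem_nbIdx.1 hi
    obtain ⟨-, hyj⟩ := mem_nbIdx.1 hj
    obtain ⟨L, hL, hLlen⟩ := h.insert_wrap h2 hi' hD hoff hxi hyj
    have h3 := hno L hL
    have h4 : ∀ p ∈ Nx.image (· - 1) ∪ Ny, j ≤ p ∧ p < i := by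
      intro p hp
      rcases Finset.mem_union.1 hp with hp | hp
      · obtain ⟨q, hq, rfl⟩ := Finset.mem_image.1 hp
        have h5 := himax q hq
        have h6 := hcase q hq j hj
        have h7 := hodd q hq
        have h8 := heven j hj
        omega
      · have h5 := hcase i hi p hp
        have h6 := heven p hp
        have h7 := hodd i hi
        exact ⟨hjmin p hp, by omega⟩
    have hfin : (Nx.image (· - 1) ∪ Ny).card ≤ (range (c - m)).card := by
      refine Finset.card_le_card_of_injOn (fun p => (p - j) / 2) ?_ ?_
      · intro p hp
        rw [Finset.mem_coe, Finset.mem_range]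
        dsimp only
        have := h4 p hp
        omega
      · intro p hp q hq hpq
        have := h4 p hp
        have := h4 q hq
        have := hpar p hp
        have := hpar q hq
        have := heven j hj
        dsimp only at hpq
        omega
    rw [Finset.card_union_of_disjoint hdisj, hcard, Finset.card_range] at hfin
    omega

/-- If a cycle cannot be prolonged by a path of `2 * m - 1` vertices, one end of which is adjacent
to `v i`, the other end has few neighbours after `v i`. -/
theorem card_nbIdx_le_of_first (h : CycFun G A v c)
    (hno : ∀ L, ClosedList G L → L.length ≤ 2 * c) {D : List V} {x y : V} (hD : PathList G D x y)
    (hoff : ∀ s ∈ D, s ∉ verts v (2 * c - 1)) {m : ℕ} (hlen : D.length + 1 = 2 * m) {i : ℕ}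
    (hi : i ∈ nbIdx G v (2 * c - 1) x)
    (hpar : ∀ j ∈ nbIdx G v (2 * c - 1) y, i ≤ j ∧ i % 2 = j % 2) :
    (nbIdx G v (2 * c - 1) y).card ≤ 1 + (c + 1 - 2 * m) := by
  obtain ⟨hi, hxi⟩ := mem_nbIdx.1 hi
  have key : ∀ j ∈ (nbIdx G v (2 * c - 1) y).erase i,
      i + 2 * m ≤ j ∧ j + 2 * m ≤ i + 2 * c ∧ i % 2 = j % 2 := by
    intro j hj
    obtain ⟨hji, hj⟩ := Finset.mem_erase.1 hj
    obtain ⟨hij, hp⟩ := hpar j hj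
    obtain ⟨hj, hyj⟩ := mem_nbIdx.1 hj
    obtain ⟨L, hL, hLlen⟩ := h.insert (lt_of_le_of_ne hij (Ne.symm hji)) hj hD hoff hxi hyj
    obtain ⟨L', hL', hLlen'⟩ := h.insert_wrap hij hj hD.reverse
      (fun s hs => hoff s (List.mem_reverse.1 hs)) hyj hxi
    have h1 := hno L hL
    have h2 := hno L' hL'
    rw [List.length_reverse] at hLlen'
    omega
  have hle : ((nbIdx G v (2 * c - 1) y).erase i).card ≤ (range (c + 1 - 2 * m)).card := by
    refine Finset.card_le_card_of_injOn (fun j => (j - i - 2 * m) / 2) ?_ ?_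
    · intro j hj
      have := key j hj
      rw [Finset.mem_coe, Finset.mem_range]
      dsimp only
      omega
    · intro j hj j' hj' hjj
      have := key j hj
      have := key j' hj'
      dsimp only at hjj
      omega
  rw [Finset.card_range] at hle
  have := Finset.pred_card_le_card_erase (s := nbIdx G v (2 * c - 1) y) (a := i)
  omega

/-- The ends of a path avoiding a longest cycle cannot both have many neighbours on it. -/
theorem card_nbIdx_lt_of_path (h : CycFun G A v c)
    (hno : ∀ L, ClosedList G L → L.length ≤ 2 * c) {D : List V} {x y : V} (hD : PathList G D x y)
    (hoff : ∀ s ∈ D, s ∉ verts v (2 * c - 1)) {m : ℕ} (hlen : D.length + 1 = 2 * m) (hm : 2 ≤ m)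
    (hmc : m + 2 ≤ c) (hpar : ∀ i ∈ nbIdx G v (2 * c - 1) x ∪ nbIdx G v (2 * c - 1) y,
      ∀ j ∈ nbIdx G v (2 * c - 1) x ∪ nbIdx G v (2 * c - 1) y, i % 2 = j % 2)
    (hx : c + 1 ≤ (nbIdx G v (2 * c - 1) x).card + m) :
    (nbIdx G v (2 * c - 1) y).card + m < c + 1 := by
  by_contra! hy
  have hxN : (nbIdx G v (2 * c - 1) x).Nonempty := Finset.card_pos.1 (by omega)
  obtain ⟨i, hi, hmin⟩ := Finset.exists_min_image
    (nbIdx G v (2 * c - 1) x ∪ nbIdx G v (2 * c - 1) y) id (hxN.mono Finset.subset_union_left)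
  rcases Finset.mem_union.1 hi with hi' | hi'
  · have := h.card_nbIdx_le_of_first hno hD hoff hlen hi' fun j hj =>
      ⟨hmin j (Finset.mem_union_right _ hj), hpar i hi j (Finset.mem_union_right _ hj)⟩
    omega
  · have := h.card_nbIdx_le_of_first hno hD.reverse (fun s hs => hoff s (List.mem_reverse.1 hs))
      (by rwa [List.length_reverse]) hi' fun j hj =>
      ⟨hmin j (Finset.mem_union_left _ hj), hpar i hi j (Finset.mem_union_left _ hj)⟩
    omega

end CycFun

end OffCyclePaths

section LowPair

open scoped Classical

variable {V : Type} {G : SimpleGraph V} {A B : Finset V} {v : ℕ → V} {c : ℕ}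

theorem PathList.mem_union (hG : IsBip G A B) {l : List V} {a b : V} (h : PathList G l a b)
    (ha : a ∈ A ∪ B) {s : V} (hs : s ∈ l) : s ∈ A ∪ B := by
  obtain ⟨l₁, l₂, -, h1, -⟩ := h.split hs
  exact h1.last_mem_union hG ha

/-- The end of a longest path has all its neighbours on the path. -/
theorem PathList.dg_le_cnt {l : List V} {a b : V} (h : PathList G l a b)
    (hmax : ∀ L c d, PathList G L c d → L.length ≤ l.length) : dg G B a ≤ cnt B l := by
  refine Finset.card_le_card fun z hz => ?_
  obtain ⟨hzB, hz⟩ := Finset.mem_filter.1 hz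
  refine Finset.mem_filter.2 ⟨hzB, ?_⟩
  by_contra hzl
  have := hmax _ _ _ (h.cons hz.symm hzl)
  simp at this

namespace CycFun

/-- Two vertices off a longest cycle have few neighbours on it. -/
theorem card_nbIdx_add_le_succ (hG : IsBip G A B) (h : CycFun G A v c)
    (hno : ∀ L, ClosedList G L → L.length ≤ 2 * c) {x y : V} (hx : x ∈ A) (hy : y ∈ B)
    (hxv : x ∉ verts v (2 * c - 1)) (hyv : y ∉ verts v (2 * c - 1)) :
    (nbIdx G v (2 * c - 1) x).card + (nbIdx G v (2 * c - 1) y).card ≤ c + 1 := by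
  set Nx := nbIdx G v (2 * c - 1) x with hNx
  set Ny := nbIdx G v (2 * c - 1) y with hNy
  have hodd : ∀ i ∈ Nx, i % 2 = 1 := fun i hi => h.odd_of_adj hG hx hi
  have heven : ∀ i ∈ Ny, i % 2 = 0 := fun i hi => h.even_of_adj hG hy hi
  have hc := h.pos
  have hy1 : (Ny.image (· + 1)).card = Ny.card :=
    Finset.card_image_of_injective _ (add_left_injective 1)
  have hinter : (Nx ∩ Ny.image (· + 1)).card ≤ 1 := by
    refine Finset.card_le_one.2 fun i hi j hj => ?_
    by_contra hij
    wlog hlt : i < j generalizing i j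
    · exact this j hj i hi (Ne.symm hij) (by omega)
    obtain ⟨hi, hi'⟩ := Finset.mem_inter.1 hi
    obtain ⟨hj, hj'⟩ := Finset.mem_inter.1 hj
    obtain ⟨p, hp, rfl⟩ := Finset.mem_image.1 hi'
    obtain ⟨q, hq, rfl⟩ := Finset.mem_image.1 hj'
    have h1 := (mem_nbIdx.1 hj).1
    obtain ⟨L, hL, hlen⟩ := h.two_chord (i := p) (j := q) (by omega) (by omega) hyv hxv
      (by rintro rfl; exact hG.not_mem_left hy hx) (mem_nbIdx.1 hp).2 (mem_nbIdx.1 hq).2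
      (mem_nbIdx.1 hi).2 (mem_nbIdx.1 hj).2
    have := hno L hL
    omega
  have hunion : (Nx ∪ Ny.image (· + 1)).card ≤ (range c).card := by
    have hmem : ∀ i ∈ Nx ∪ Ny.image (· + 1), i % 2 = 1 ∧ i ≤ 2 * c - 1 := by
      intro i hi
      rcases Finset.mem_union.1 hi with hi | hi
      · exact ⟨hodd i hi, (mem_nbIdx.1 hi).1⟩
      · obtain ⟨j, hj, rfl⟩ := Finset.mem_image.1 hi
        have := heven j hj
        have := (mem_nbIdx.1 hj).1
        omega
    refine Finset.card_le_card_of_injOn (fun i => i / 2) ?_ ?_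
    · intro i hi
      have := hmem i hi
      rw [Finset.mem_coe, Finset.mem_range]
      dsimp only
      omega
    · intro i hi j hj hij
      have := hmem i hi
      have := hmem j hj
      dsimp only at hij
      omega
  have := Finset.card_union_add_card_inter Nx (Ny.image (· + 1))
  rw [Finset.card_range] at hunion
  omega

theorem false_of_nbIdx_eq_empty (h : CycFun G A v c)
    (hno : ∀ L, ClosedList G L → L.length ≤ 2 * c) {K : SimpleGraph V}
    (hKG : ∀ x y, K.Adj x y → G.Adj x y) {C D : Finset V} (hK : IsBip K C D)
    (hoff : ∀ s ∈ C ∪ D, s ∉ verts v (2 * c - 1))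
    (hpar : ∀ x ∈ C, ∀ x' ∈ C, ∀ i ∈ nbIdx G v (2 * c - 1) x, ∀ j ∈ nbIdx G v (2 * c - 1) x',
      i % 2 = j % 2) (hs : ∀ x ∈ C, (nbIdx G v (2 * c - 1) x).card ≤ c) {r m : ℕ}
    (hD : D.card = r) (hrc : r + 2 ≤ c) {Q : List V} {x y : V} (hQ : PathList K Q x y)
    (hx : x ∈ C) (hy : y ∈ D) (hlen : Q.length = 2 * m) (hmr : m ≤ r) (hdx : dg K D x ≤ m)
    (hdy : dg K C y ≤ m) (hdeg : ∀ x ∈ C, c + r + (if G.Adj x y then 1 else 0) <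
      dg K D x + dg K C y + (nbIdx G v (2 * c - 1) x).card) : False := by
  have hpos := hQ.length_pos
  rcases hQ.reverse.cases with ⟨h1, -⟩ | ⟨l, z, h1, hyz, -, hl⟩
  · have := congrArg List.length h1
    rw [List.length_reverse, List.length_singleton] at this
    omega
  have hz : z ∈ C := hK.left_of_right hy hyz
  have h2 := congrArg List.length h1
  rw [List.length_reverse, List.length_cons] at h2
  have hlow : ∀ x ∈ C, c + 1 ≤ (nbIdx G v (2 * c - 1) x).card + m := by
    intro x hx
    have h3 := hdeg x hx
    have h4 := dg_le (G := K) (B := D) x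
    omega
  rcases Nat.lt_or_ge m 2 with hm | hm
  · have hzx : z = x := by
      rcases hl.cases with ⟨-, h3⟩ | ⟨l', z', rfl, -, -, h3⟩
      · exact h3
      · have := h3.length_pos
        rw [List.length_cons] at h2
        omega
    have h3 := hdeg x hx
    rw [if_pos (hKG _ _ (hzx ▸ hyz.symm))] at h3
    have h4 := hs x hx
    omega
  · have h3 := h.card_nbIdx_lt_of_path hno (hl.mono hKG)
      (fun s hs => hoff s (hl.mem_union hK (Finset.mem_union_left _ hz) hs)) (m := m) (by omega) hm
      (by omega) (fun i hi j hj => by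
        rcases Finset.mem_union.1 hi with hi | hi <;> rcases Finset.mem_union.1 hj with hj | hj
        · exact hpar z hz z hz i hi j hj
        · exact hpar z hz x hx i hi j hj
        · exact hpar x hx z hz i hi j hj
        · exact hpar x hx x hx i hi j hj) (hlow z hz)
    have h4 := hlow x hx
    omega

/-- Among the vertices missed by a longest cycle there are two with small degree sum. -/
theorem exists_low_pair (hG : IsBip G A B) (h : CycFun G A v c)
    (hno : ∀ L, ClosedList G L → L.length ≤ 2 * c) {r : ℕ} (hA : A.card = c + r)
    (hB : B.card = c + r) (hr : 1 ≤ r) (hrc : r + 2 ≤ c) :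
    ∃ x ∈ A, x ∉ verts v (2 * c - 1) ∧ ∃ y ∈ B, y ∉ verts v (2 * c - 1) ∧
      dg G B x + dg G A y ≤ c + r + (if G.Adj x y then 1 else 0) := by
  by_contra! hcon
  obtain ⟨OA, hOA⟩ : ∃ S, S = A.filter (· ∉ verts v (2 * c - 1)) := ⟨_, rfl⟩
  obtain ⟨OB, hOB⟩ : ∃ S, S = B.filter (· ∉ verts v (2 * c - 1)) := ⟨_, rfl⟩
  obtain ⟨hcA, hcB⟩ := h.card_off hG
  rw [← hOA] at hcA
  rw [← hOB] at hcB
  have hmemA : ∀ {x}, x ∈ OA → x ∈ A ∧ x ∉ verts v (2 * c - 1) := fun hx => by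
    rw [hOA] at hx
    exact Finset.mem_filter.1 hx
  have hmemB : ∀ {x}, x ∈ OB → x ∈ B ∧ x ∉ verts v (2 * c - 1) := fun hx => by
    rw [hOB] at hx
    exact Finset.mem_filter.1 hx
  have hdA : ∀ y ∈ B, dg G A y = dg G OA y + (nbIdx G v (2 * c - 1) y).card := fun y hy => by
    rw [hOA]
    exact h.path.dg_eq A fun z hz => hG.left_of_right hy hz
  have hdB : ∀ x ∈ A, dg G B x = dg G OB x + (nbIdx G v (2 * c - 1) x).card := fun x hx => by
    rw [hOB]
    exact h.path.dg_eq B fun z hz => hG.right_of_left hx hz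
  have hmA : ∀ {x}, x ∈ OA → x ∈ A := fun hx => (hmemA hx).1
  have hmB : ∀ {x}, x ∈ OB → x ∈ B := fun hx => (hmemB hx).1
  clear hOA hOB
  have hK := hG.within (A' := OA) (B' := OB) (fun _ => hmA) (fun _ => hmB)
  have hKdA : ∀ y ∈ OB, dg (within G (OA ∪ OB)) OA y = dg G OA y := fun y hy =>
    dg_within (Finset.mem_union_right _ hy) Finset.subset_union_left
  have hKdB : ∀ x ∈ OA, dg (within G (OA ∪ OB)) OB x = dg G OB x := fun x hx =>
    dg_within (Finset.mem_union_left _ hx) Finset.subset_union_right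
  have hKG := within_le (G := G) (OA ∪ OB)
  generalize within G (OA ∪ OB) = K at hK hKdA hKdB hKG
  have hoff : ∀ s ∈ OA ∪ OB, s ∉ verts v (2 * c - 1) := by
    intro s hs
    rcases Finset.mem_union.1 hs with hs | hs
    · exact (hmemA hs).2
    · exact (hmemB hs).2
  have hdeg : ∀ x ∈ OA, ∀ y ∈ OB, c + r + (if G.Adj x y then 1 else 0) <
      dg K OB x + (nbIdx G v (2 * c - 1) x).card +
        (dg K OA y + (nbIdx G v (2 * c - 1) y).card) := by
    intro x hx y hy
    have h1 := hcon x (hmA hx) (hmemA hx).2 y (hmB hy) (hmemB hy).2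
    rw [hdA y (hmB hy), hdB x (hmA hx)] at h1
    rw [hKdA y hy, hKdB x hx]
    exact h1
  have hKdeg : ∀ x ∈ OA, ∀ y ∈ OB, r ≤ dg K OB x + dg K OA y := by
    intro x hx y hy
    have h1 := hdeg x hx y hy
    have h2 := h.card_nbIdx_add_le_succ hG hno (hmA hx) (hmB hy) (hmemA hx).2
      (hmemB hy).2
    omega
  have hsA : ∀ x ∈ OA, (nbIdx G v (2 * c - 1) x).card ≤ c := fun x hx =>
    h.card_nbIdx_le hG (Finset.mem_union_left _ (hmA hx))
  have hsB : ∀ x ∈ OB, (nbIdx G v (2 * c - 1) x).card ≤ c := fun x hx =>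
    h.card_nbIdx_le hG (Finset.mem_union_right _ (hmB hx))
  obtain ⟨Q, a, b, hQ, ha, hmax⟩ := exists_max_path hK (Finset.card_pos.1 (by omega))
  have hb := hQ.last_mem_union hK ha
  have core : ∀ {P x y}, PathList K P x y → x ∈ OA → y ∈ OB →
      (∀ L c d, PathList K L c d → L.length ≤ P.length) → False := by
    intro P x y hP hx hy hmax
    obtain ⟨hl1, hl2⟩ := (hP.length_eq hK).2.1 hx hy
    have hpos := hP.length_pos
    have hm : cnt OA P ≤ OA.card := cnt_le
    have hdx := hP.dg_le_cnt (B := OB) hmax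
    have hdy := hP.reverse.dg_le_cnt (B := OA) (by simpa using hmax)
    have hcr : cnt OA P.reverse = cnt OA P := by unfold cnt; simp
    rw [hcr] at hdy
    rcases (nbIdx G v (2 * c - 1) y).eq_empty_or_nonempty with hy0 | hy0
    · refine h.false_of_nbIdx_eq_empty hno hKG hK hoff (fun x hx x' hx' i hi j hj => ?_) hsA
        (r := r) (m := cnt OA P) (by omega) hrc hP hx hy hl1 (by omega) (by omega) hdy
        fun x hx => ?_
      · rw [h.odd_of_adj hG (hmA hx) hi, h.odd_of_adj hG (hmA hx') hj]
      · have := hdeg x hx y hy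
        rw [hy0, Finset.card_empty] at this
        omega
    rcases (nbIdx G v (2 * c - 1) x).eq_empty_or_nonempty with hx0 | hx0
    · refine h.false_of_nbIdx_eq_empty hno hKG hK.symm (by rwa [Finset.union_comm])
        (fun x hx x' hx' i hi j hj => ?_) hsB (r := r) (m := cnt OA P) (by omega) hrc hP.reverse hy
        hx (by rwa [List.length_reverse]) (by omega) hdy (by omega) fun y hy => ?_
      · rw [h.even_of_adj hG (hmB hx) hi, h.even_of_adj hG (hmB hx') hj]
      · have := hdeg x hx y hy
        rw [hx0, Finset.card_empty, G.adj_comm] at this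
        omega
    have h1 := h.card_nbIdx_add_le hG hno (hP.mono hKG)
      (fun s hs => hoff s (hP.mem_union hK (Finset.mem_union_left _ hx) hs)) (hmA hx) (hmB hy)
      hl1 (by omega) hx0 hy0
    have h2 := hdeg x hx y hy
    omega
  rcases Finset.mem_union.1 ha with ha | ha <;> rcases Finset.mem_union.1 hb with hb | hb
  · obtain ⟨L, c, d, hL, hlt⟩ := not_max_path_of_degree hK (by omega)
      (fun x hx y hy => by have := hKdeg x hx y hy; omega) hQ ha hb
    exact absurd (hmax L c d hL) (by omega)
  · exact core hQ ha hb hmax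
  · exact core hQ.reverse hb ha (by simpa using hmax)
  · obtain ⟨L, c, d, hL, hlt⟩ := not_max_path_of_degree hK.symm (by omega)
      (fun x hx y hy => by have := hKdeg y hy x hx; omega) hQ ha hb
    exact absurd (hmax L c d hL) (by omega)

end CycFun

end LowPair

section Pancyclic

open scoped Classical

variable {V : Type} {G : SimpleGraph V} {A B : Finset V} {v : ℕ → V} {c : ℕ}

theorem edg_within : edg (within G (A ∪ B)) A B = edg G A B :=
  Finset.sum_congr rfl fun _ hx =>
    dg_within (Finset.mem_union_left _ hx) Finset.subset_union_right

namespace CycFun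

theorem within (h : CycFun G A v c) {U A' : Finset V} (hU : ∀ i ≤ 2 * c - 1, v i ∈ U)
    (h0 : v 0 ∈ A') : CycFun (within G U) A' v c :=
  ⟨⟨h.path.inj, fun i hi => ⟨h.path.adj i hi, hU _ hi.le, hU _ hi⟩⟩,
    ⟨h.close, hU _ le_rfl, hU _ (Nat.zero_le _)⟩, h0, h.pos⟩

/-- Every edge of a graph with a Hamiltonian cycle is counted twice along that cycle. -/
theorem two_mul_edg_le (hG : IsBip G A B) (h : CycFun G A v c) (hA : A.card = c)
    (hB : B.card = c) :
    2 * edg G A B ≤ ∑ i ∈ range (2 * c), (nbIdx G v (2 * c - 1) (v i)).card := by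
  obtain ⟨hcA, hcB⟩ := h.card_off hG
  have hpos := h.pos
  have hA0 : A.filter (· ∉ verts v (2 * c - 1)) = ∅ := Finset.card_eq_zero.1 (by omega)
  have hB0 : B.filter (· ∉ verts v (2 * c - 1)) = ∅ := Finset.card_eq_zero.1 (by omega)
  have hA1 : ∀ x ∈ A, x ∈ verts v (2 * c - 1) := fun x hx =>
    not_not.1 (Finset.filter_eq_empty_iff.1 hA0 hx)
  have hB1 : ∀ x ∈ B, x ∈ verts v (2 * c - 1) := fun x hx =>
    not_not.1 (Finset.filter_eq_empty_iff.1 hB0 hx)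
  have h1 : edg G A B = ∑ x ∈ A, (nbIdx G v (2 * c - 1) x).card :=
    Finset.sum_congr rfl fun x hx =>
      dg_eq_card_nbIdx hG h.path hx fun y hxy => hB1 y (hG.right_of_left hx hxy)
  have h2 : edg G B A = ∑ x ∈ B, (nbIdx G v (2 * c - 1) x).card :=
    Finset.sum_congr rfl fun x hx =>
      dg_eq_card_nbIdx hG.symm h.path hx fun y hxy => hA1 y (hG.left_of_right hx hxy)
  rw [edg_comm] at h2
  rw [two_mul]
  nth_rewrite 1 [h1]
  rw [h2, ← Finset.sum_union hG.disj, ← Finset.sum_image (s := range (2 * c)) (g := v)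
    (f := fun x => (nbIdx G v (2 * c - 1) x).card)]
  · refine Finset.sum_le_sum_of_subset fun x hx => ?_
    obtain ⟨i, hi, rfl⟩ : x ∈ verts v (2 * c - 1) :=
      (Finset.mem_union.1 hx).elim (hA1 x) (hB1 x)
    exact Finset.mem_image_of_mem _ (Finset.mem_range.2 (by omega))
  · intro i hi j hj hij
    rw [Finset.mem_coe, Finset.mem_range] at hi hj
    exact h.path.inj i j (by omega) (by omega) hij

theorem lt_sum_of_lt_edg (r : ℕ) : ∀ {G : SimpleGraph V} {A B : Finset V}, IsBip G A B →
    CycFun G A v c → (∀ L, ClosedList G L → L.length ≤ 2 * c) → A.card = c + r →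
    B.card = c + r → r + 2 ≤ c → (c + r) * (c + r + 1) < 2 * edg G A B →
    c * (c + 1) < ∑ i ∈ range (2 * c), (nbIdx G v (2 * c - 1) (v i)).card := by
  induction r with
  | zero =>
    intro G A B hG h _ hA hB _ he
    exact he.trans_le (h.two_mul_edg_le hG hA hB)
  | succ r ih =>
    intro G A B hG h hno hA hB hrc he
    obtain ⟨x, hx, hxv, y, hy, hyv, hdeg⟩ := h.exists_low_pair hG hno hA hB (by omega) hrc
    have hmem : ∀ i ≤ 2 * c - 1, v i ∈ A.erase x ∪ B.erase y := by
      intro i hi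
      have h1 := h.parity hG hi
      rcases Nat.mod_two_eq_zero_or_one i with h2 | h2
      · exact Finset.mem_union_left _ (Finset.mem_erase.2
          ⟨fun h3 => hxv (h3 ▸ mem_verts hi), h1.1 h2⟩)
      · exact Finset.mem_union_right _ (Finset.mem_erase.2
          ⟨fun h3 => hyv (h3 ▸ mem_verts hi), h1.2 h2⟩)
    have h0 : v 0 ∈ A.erase x :=
      Finset.mem_erase.2 ⟨fun h3 => hxv (h3 ▸ mem_verts (Nat.zero_le _)), h.zero⟩
    have h1 := Finset.card_erase_of_mem hx
    have h2 := Finset.card_erase_of_mem hy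
    have h3 := edg_erase_pair (G := G) hx hy
    refine (ih (hG.within (Finset.erase_subset x A) (Finset.erase_subset y B)) (h.within hmem h0)
      (fun L hL => hno L (hL.mono (within_le _))) (by omega) (by omega) (by omega) ?_).trans_le
      (Finset.sum_le_sum fun i _ => Finset.card_le_card fun j hj => ?_)
    · rw [edg_within]
      have h4 : (c + (r + 1)) * (c + (r + 1) + 1) = (c + r) * (c + r + 1) + 2 * (c + r + 1) := by
        ring
      omega
    · rw [mem_nbIdx] at hj ⊢
      exact ⟨hj.1, within_le _ _ _ hj.2⟩

end CycFun

theorem exists_closed_of_edg_square (hG : IsBip G A B) {n t : ℕ} (hA : A.card = n)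
    (hB : B.card = n) (ht : 2 ≤ t) (htn : t ≤ n) (hnt : n + 2 ≤ 2 * t)
    (he : n * t + 2 ≤ edg G A B + t) {l : ℕ} (hl : 2 ≤ l) (hlt : l ≤ t) :
    ∃ L, ClosedList G L ∧ L.length = 2 * l := by
  obtain ⟨L₀, hL₀, hlen₀⟩ : ∃ L, ClosedList G L ∧ 2 * t ≤ L.length := by
    by_contra! hno
    have h1 := edg_le_of_no_closed hG (c := t - 1)
      (fun L hL => by have := hno L hL; omega) (n + n) A subset_rfl B subset_rfl
      (by omega) (by omega) (by omega)
    obtain ⟨s, rfl⟩ : ∃ s, t = s + 1 := ⟨t - 1, by omega⟩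
    rw [hA, hB, max_self, min_self, Nat.add_sub_cancel] at h1
    have h2 : n * (s + 1) = s * n + n := by ring
    omega
  obtain ⟨L, ⟨hL, hLt⟩, hmax⟩ := exists_longest
    (p := fun L => ClosedList G L ∧ 2 * t ≤ L.length) (2 * n) ⟨L₀, hL₀, hlen₀⟩ (fun L hL => by
      rw [(hL.1.length_eq hG).1, ← hA]
      exact Nat.mul_le_mul_left _ cnt_le)
  have hlen := (hL.length_eq hG).1
  obtain ⟨x, hx⟩ := Finset.card_pos.1 (show 0 < cnt A L by omega)
  obtain ⟨hxA, hxL⟩ := Finset.mem_filter.1 hx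
  obtain ⟨v, c, hv, hc, -⟩ := hL.exists_cycFun hG hxL hxA
  have hcn : cnt A L ≤ A.card := cnt_le
  obtain ⟨r, hr⟩ : ∃ r, n = c + r := ⟨n - c, by omega⟩
  refine hv.exists_closed_of_sum hG (hv.lt_sum_of_lt_edg r hG ?_ (hA.trans hr) (hB.trans hr)
    (by omega) ?_) hl (by omega)
  · intro L' hL'
    rcases le_or_gt (2 * t) L'.length with h1 | h1
    · exact (hmax L' ⟨hL', h1⟩).trans hc.le
    · omega
  · rw [← hr]
    nlinarith

/-- A bipartite graph with classes of sizes `m ≤ n` and more than `n * (t - 1) + (m - t) + 1`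
edges has cycles of all even lengths up to `2 * t`, provided that `m + 2 ≤ 2 * t`. -/
theorem exists_closed_of_edg {m t : ℕ} (ht : 2 ≤ t) (htm : t ≤ m) (hmt : m + 2 ≤ 2 * t) {n : ℕ}
    (hmn : m ≤ n) : ∀ {G : SimpleGraph V} {A B : Finset V}, IsBip G A B → A.card = m →
    B.card = n → n * (t - 1) + m + 2 ≤ edg G A B + t → ∀ {l : ℕ}, 2 ≤ l → l ≤ t →
    ∃ L, ClosedList G L ∧ L.length = 2 * l := by
  induction n, hmn using Nat.le_induction with
  | base =>
    intro G A B hG hA hB he l hl hlt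
    obtain ⟨s, rfl⟩ : ∃ s, t = s + 1 := ⟨t - 1, by omega⟩
    refine exists_closed_of_edg_square hG hA hB ht htm hmt ?_ hl hlt
    rw [Nat.add_sub_cancel] at he
    rw [Nat.mul_succ]
    exact he
  | succ n hmn ih =>
    intro G A B hG hA hB he l hl hlt
    by_cases hdeg : ∀ y ∈ B, t ≤ dg G A y
    · exact exists_closed_of_degree hG (by omega) (by omega) hdeg hl hlt
    push Not at hdeg
    obtain ⟨y, hy, hyt⟩ := hdeg
    have h1 := Finset.card_erase_of_mem hy
    have h2 := edg_erase_add (G := G) (B := A) hy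
    rw [edg_comm, edg_comm (A := B)] at h2
    obtain ⟨L, hL, hlen⟩ := ih (hG.within (subset_refl A) (Finset.erase_subset y B)) hA
      (by omega) (by rw [edg_within]; rw [Nat.succ_mul] at he; omega) hl hlt
    exact ⟨L, hL.mono (within_le _), hlen⟩

/-- The number of edges of a bipartite graph is the sum of the degrees of one class. -/
theorem IsBip.ncard_edgeSet_le (hG : IsBip G A B) : G.edgeSet.ncard ≤ edg G A B := by
  have h1 : G.edgeSet ⊆ ((A.sigma fun x => B.filter (G.Adj x)).image fun p => s(p.1, p.2) :
      Finset (Sym2 V)) := by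
    intro e he
    induction e using Sym2.ind with
    | _ x y =>
      rw [SimpleGraph.mem_edgeSet] at he
      rw [Finset.mem_coe, Finset.mem_image]
      rcases hG.adj _ _ he with ⟨hx, hy⟩ | ⟨hx, hy⟩
      · exact ⟨⟨x, y⟩, Finset.mem_sigma.2 ⟨hx, Finset.mem_filter.2 ⟨hy, he⟩⟩, rfl⟩
      · exact ⟨⟨y, x⟩, Finset.mem_sigma.2 ⟨hy, Finset.mem_filter.2 ⟨hx, he.symm⟩⟩, Sym2.eq_swap⟩
  refine (Set.ncard_le_ncard h1 (Finset.finite_toSet _)).trans ?_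
  rw [Set.ncard_coe_finset]
  exact Finset.card_image_le.trans (Finset.card_sigma _ _).le

end Pancyclic

/-- **Theorem (Li–Ning).** Let `G = (X,Y;E)` be a bipartite graph with `|X| = m`, `|Y| = n`,
`n ≥ m ≥ 2k+2`. If `e(G) ≥ n(m-k-1) + k + 2`, then `G` contains cycles of all even lengths
from `4` up to `2m - 2k`. -/
theorem stmt_1 {V : Type} [Fintype V] [DecidableEq V]
    (G : SimpleGraph V) (X Y : Finset V) (m n k : ℕ)
    (hpart : ∀ v : V, v ∈ X ∨ v ∈ Y) (hdisj : Disjoint X Y)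
    (hbip : ∀ u v : V, G.Adj u v → (u ∈ X ∧ v ∈ Y) ∨ (u ∈ Y ∧ v ∈ X))
    (hm : X.card = m) (hn : Y.card = n)
    (hnm : m ≤ n) (hkm : 2 * k + 2 ≤ m)
    (he : n * (m - k - 1) + k + 2 ≤ G.edgeSet.ncard) :
    ∀ ℓ : ℕ, 2 ≤ ℓ → ℓ ≤ m - k →
      ∃ (v : V) (w : G.Walk v v), w.IsCycle ∧ w.length = 2 * ℓ := by
  intro ℓ h2 hℓ
  have hG : IsBip G X Y := ⟨hdisj, hbip⟩
  have h1 := hG.ncard_edgeSet_le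
  obtain ⟨L, hL, hlen⟩ := exists_closed_of_edg (t := m - k) (by omega) (by omega) (by omega) hnm hG
    hm hn (by omega) h2 hℓ
  obtain ⟨v, w, hw, hwl⟩ := hL.exists_cycle (by omega)
  exact ⟨v, w, hw, hwl.trans hlen⟩
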